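/- arXiv:2505.23384 — 4 statements merged into one kernel-verified Lean document; each statement's English description precedes it below -/
import Mathlib

section
/- There exist constants δ₁, δ₂, δ₃ > 0 such that the following holds for all positive integers n and d. If G is an (n,d,λ)-graph with d ≤ δ₃·n and λ/d ≤ δ₁, then G contains an induced cycle of length at least δ₂·n/d. -/
open Finset

/-- The adjacency matrix of `G` over `ℝ` is Hermitian. -/
noncomputable def SimpleGraph.adjHermitian {n : ℕ} (G : SimpleGraph (Fin n)) :
    letI := Classical.decRel G.Adj
    ((G.adjMatrix ℝ).IsHermitian) := by
  letI := Classical.decRel G.Adj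
  rw [Matrix.IsHermitian, Matrix.conjTranspose_eq_transpose_of_trivial]
  exact G.isSymm_adjMatrix

/-- `G` is an `(n,d,λ)`-graph: a `d`-regular graph on `n` vertices all of whose
adjacency-matrix eigenvalues, except one eigenvalue equal to `d`, have absolute
value at most `lam`. -/
noncomputable def IsNDLGraph (n d : ℕ) (lam : ℝ) (G : SimpleGraph (Fin n)) : Prop :=
  letI := Classical.decRel G.Adj
  G.IsRegularOfDegree d ∧
    ∃ i₀ : Fin n, (G.adjHermitian.eigenvalues i₀ = d ∧
      ∀ i : Fin n, i ≠ i₀ → |G.adjHermitian.eigenvalues i| ≤ lam)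

/-- `G` has an induced path on `k` vertices. -/
def HasInducedPath {V : Type*} (G : SimpleGraph V) (k : ℕ) : Prop :=
  ∃ f : Fin k → V, Function.Injective f ∧
    ∀ i j : Fin k, G.Adj (f i) (f j) ↔ ((i : ℕ) + 1 = (j : ℕ) ∨ (j : ℕ) + 1 = (i : ℕ))

/-- `G` has an induced cycle of length `k`. -/
def HasInducedCycle {V : Type*} (G : SimpleGraph V) (k : ℕ) : Prop :=
  3 ≤ k ∧ ∃ f : ZMod k → V, Function.Injective f ∧
    ∀ i j : ZMod k, G.Adj (f i) (f j) ↔ (i - j = 1 ∨ j - i = 1)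

/-- The graph obtained from `G` by deleting all edges that meet `X`. -/
def SimpleGraph.avoid {V : Type*} (G : SimpleGraph V) (X : Finset V) : SimpleGraph V where
  Adj x y := G.Adj x y ∧ x ∉ X ∧ y ∉ X
  symm := ⟨fun _ _ h => ⟨h.1.symm, h.2.2, h.2.1⟩⟩
  loopless := ⟨fun _ h => G.loopless.irrefl _ h.1⟩

namespace SimpleGraph

section Avoid

variable {V : Type*} {G : SimpleGraph V} {X Y : Finset V} {a b : V}

theorem avoid_anti (h : X ⊆ Y) : G.avoid Y ≤ G.avoid X :=
  fun _ _ hab => ⟨hab.1, fun hx => hab.2.1 (h hx), fun hx => hab.2.2 (h hx)⟩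

theorem Reachable.notMem_of_avoid (h : (G.avoid X).Reachable a b) (ha : a ∉ X) : b ∉ X := by
  obtain ⟨w⟩ := h
  induction w with
  | nil => exact ha
  | cons h _ ih => exact ih h.2.2

/-- A walk avoiding `X` that enters a larger set `Y` does so along an edge from the component of
its starting point in the complement of `Y`. -/
theorem Reachable.exists_first_entry (h : (G.avoid X).Reachable a b) (ha : a ∉ Y) (hb : b ∈ Y) :
    ∃ u w, u ∈ Y ∧ u ∉ X ∧ G.Adj w u ∧ (G.avoid Y).Reachable a w := by
  obtain ⟨w⟩ := h
  induction w with
  | nil => exact absurd hb ha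
  | @cons x y z h _ ih =>
    by_cases hy : y ∈ Y
    · exact ⟨y, x, hy, h.2.2, h.1, Reachable.refl _⟩
    · obtain ⟨u, w, hu, huX, hwu, hw⟩ := ih hy hb
      have hxy : (G.avoid Y).Adj x y := ⟨h.1, ha, hy⟩
      exact ⟨u, w, hu, huX, hwu, hxy.reachable.trans hw⟩

end Avoid

end SimpleGraph

/-- Any two disjoint sets containing at least a twentieth of the vertices are joined by an edge. -/
def LargeSetsAdjacent {V : Type*} [Fintype V] (G : SimpleGraph V) : Prop :=
  ∀ A B : Finset V, Disjoint A B → Fintype.card V ≤ 20 * #A → Fintype.card V ≤ 20 * #B →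
    ∃ a ∈ A, ∃ b ∈ B, G.Adj a b

section Holes

variable {V : Type*} [Fintype V] {G : SimpleGraph V}

open Classical in
/-- The vertices reachable from `a` along edges avoiding `X`. -/
noncomputable def reachSet (G : SimpleGraph V) (X : Finset V) (a : V) : Finset V :=
  {b | (G.avoid X).Reachable a b}

@[simp]
theorem mem_reachSet {X : Finset V} {a b : V} :
    b ∈ reachSet G X a ↔ (G.avoid X).Reachable a b := by
  simp [reachSet]

open Classical in
theorem LargeSetsAdjacent.exists_giant (hG : LargeSetsAdjacent G) (hV : 0 < Fintype.card V)
    {X : Finset V} (hX : 4 * #X ≤ Fintype.card V) :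
    ∃ a ∉ X, Fintype.card V < 2 * #(reachSet G X a) := by
  let closed : Finset V → Prop := fun S =>
    Fintype.card V ≤ 20 * #S ∧ Disjoint S X ∧ ∀ x ∈ S, ∀ y ∉ S, ¬ (G.avoid X).Adj x y
  have hcompl := Finset.card_add_card_compl X
  have hne : (Finset.univ.filter closed).Nonempty := by
    refine ⟨Xᶜ, ?_⟩
    simp only [Finset.mem_filter, Finset.mem_univ, true_and, closed]
    refine ⟨by omega, disjoint_compl_left, fun x _ y hy hxy => hxy.2.2 (by simpa using hy)⟩
  obtain ⟨S, hS, hmin⟩ := Finset.exists_min_image _ (fun S => #S) hne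
  simp only [Finset.mem_filter, Finset.mem_univ, true_and, closed] at hS hmin
  obtain ⟨hcard, hdisj, hclosed⟩ := hS
  have hSX : S ⊆ Xᶜ := fun x hx => Finset.mem_compl.2 (Finset.disjoint_left.1 hdisj hx)
  have hrest : 20 * #(Xᶜ \ S) < Fintype.card V := by
    by_contra! hge
    obtain ⟨x, hx, y, hy, hxy⟩ := hG S (Xᶜ \ S) Finset.disjoint_sdiff hcard hge
    rw [Finset.mem_sdiff, Finset.mem_compl] at hy
    exact hclosed x hx y hy.2 ⟨hxy, Finset.disjoint_left.1 hdisj hx, hy.1⟩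
  have hsub := Finset.card_sdiff_add_card_eq_card hSX
  obtain ⟨a, ha⟩ : S.Nonempty := Finset.card_pos.1 (by omega)
  have haX : a ∉ X := Finset.disjoint_left.1 hdisj ha
  have hCS : reachSet G X a ⊆ S := by
    intro b hb
    obtain ⟨w⟩ := mem_reachSet.1 hb
    clear hb haX
    induction w with
    | nil => exact ha
    | @cons x y z h _ ih =>
      refine ih ?_
      by_contra hy
      exact hclosed _ ha _ hy h
  have hCX : Disjoint (reachSet G X a) X := hdisj.mono_left hCS
  have hC : ∀ x ∈ reachSet G X a, ∀ y ∉ reachSet G X a, ¬ (G.avoid X).Adj x y := by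
    intro x hx y hy hxy
    rw [mem_reachSet] at hx hy
    exact hy (hx.trans hxy.reachable)
  refine ⟨a, haX, ?_⟩
  have hsub' := Finset.card_sdiff_add_card_eq_card hCS
  have hpos : 0 < #(reachSet G X a) := Finset.card_pos.2 ⟨a, by simp⟩
  by_cases hbig : Fintype.card V ≤ 20 * #(reachSet G X a)
  · have := hmin _ ⟨hbig, hCX, hC⟩
    omega
  · have := hmin (S \ reachSet G X a) ⟨by omega, hdisj.mono_left Finset.sdiff_subset, ?_⟩
    · omega
    · intro x hx y hy hxy
      rw [Finset.mem_sdiff] at hx hy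
      by_cases hyS : y ∈ S
      · exact hC y (by tauto) x hx.2 hxy.symm
      · exact hclosed x hx.1 y hyS hxy

/-- The vertex `v` has a neighbour in the giant component of the complement of `X`. -/
def AttachedToGiant (G : SimpleGraph V) (X : Finset V) (v : V) : Prop :=
  ∃ a c, a ∉ X ∧ Fintype.card V < 2 * #(reachSet G X a) ∧ (G.avoid X).Reachable a c ∧ G.Adj v c

open Classical in
/-- The closed neighbourhood of `v`. -/
noncomputable def closedNbhd (G : SimpleGraph V) (v : V) : Finset V :=
  {w | w = v ∨ G.Adj v w}

@[simp]
theorem mem_closedNbhd {v w : V} : w ∈ closedNbhd G v ↔ w = v ∨ G.Adj v w := by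
  simp [closedNbhd]

open Classical in
theorem LargeSetsAdjacent.exists_extension (hG : LargeSetsAdjacent G) {X : Finset V} {v : V}
    (hv : AttachedToGiant G X v) (hX : 4 * #(X ∪ closedNbhd G v) ≤ Fintype.card V) :
    ∃ u, G.Adj v u ∧ u ∉ X ∧ AttachedToGiant G (X ∪ closedNbhd G v) u := by
  obtain ⟨a, c, -, hbig, hac, hvc⟩ := hv
  obtain ⟨a', ha', hbig'⟩ := hG.exists_giant (Fintype.card_pos_iff.2 ⟨v⟩) hX
  obtain ⟨z, hz, hz'⟩ : ∃ z, z ∈ reachSet G X a ∧ z ∈ reachSet G (X ∪ closedNbhd G v) a' := by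
    by_contra! hdis
    have h1 := Finset.card_union_of_disjoint (Finset.disjoint_left.2 hdis)
    have h2 := Finset.card_le_univ (reachSet G X a ∪ reachSet G (X ∪ closedNbhd G v) a')
    omega
  rw [mem_reachSet] at hz hz'
  have hreach : (G.avoid X).Reachable a' c :=
    (hz'.mono (SimpleGraph.avoid_anti Finset.subset_union_left)).trans (hz.symm.trans hac)
  obtain ⟨u, w, hu, huX, hwu, hw⟩ := hreach.exists_first_entry ha' (by simp [hvc])
  have hvu : G.Adj v u := by
    rcases Finset.mem_union.1 hu with h | h
    · exact absurd h huX
    · rcases mem_closedNbhd.1 h with rfl | h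
      · exact absurd (by simp [hwu.symm]) (hw.notMem_of_avoid ha')
      · exact h
  exact ⟨u, hvu, huX, a', w, ha', hbig', hw, hwu.symm⟩

theorem LargeSetsAdjacent.exists_attached (hG : LargeSetsAdjacent G) (hV : 0 < Fintype.card V)
    (hdeg : ∀ v, ∃ w, G.Adj v w) : ∃ v, AttachedToGiant G ∅ v := by
  obtain ⟨a, ha, hbig⟩ := hG.exists_giant (X := ∅) hV (by simp)
  obtain ⟨w, hw⟩ := hdeg a
  exact ⟨w, a, a, ha, hbig, SimpleGraph.Reachable.refl _, hw.symm⟩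

open Classical in
/-- The greedy induced path `p`, where `X j` is the closed neighbourhood of `p 0, …, p (j - 1)`. -/
theorem LargeSetsAdjacent.exists_greedy (hG : LargeSetsAdjacent G) (hV : 0 < Fintype.card V)
    (hdeg : ∀ v, ∃ w, G.Adj v w) :
    ∃ (p : ℕ → V) (X : ℕ → Finset V), X 0 = ∅ ∧ (∀ j, X (j + 1) = X j ∪ closedNbhd G (p j)) ∧
      ∀ j, 4 * #(X (j + 1)) ≤ Fintype.card V → G.Adj (p j) (p (j + 1)) ∧ p (j + 1) ∉ X j ∧
        AttachedToGiant G (X (j + 1)) (p (j + 1)) := by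
  obtain ⟨v₀, hv₀⟩ := hG.exists_attached hV hdeg
  have hstep : ∀ (X : Finset V) (v : V), ∃ u, AttachedToGiant G X v →
      4 * #(X ∪ closedNbhd G v) ≤ Fintype.card V →
      G.Adj v u ∧ u ∉ X ∧ AttachedToGiant G (X ∪ closedNbhd G v) u := by
    intro X v
    by_cases h : AttachedToGiant G X v ∧ 4 * #(X ∪ closedNbhd G v) ≤ Fintype.card V
    · obtain ⟨u, hu⟩ := hG.exists_extension h.1 h.2
      exact ⟨u, fun _ _ => hu⟩
    · exact ⟨v, fun h1 h2 => absurd ⟨h1, h2⟩ h⟩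
  choose next hnext using hstep
  let s : ℕ → Finset V × V := fun j =>
    Nat.rec (∅, v₀) (fun _ t => (t.1 ∪ closedNbhd G t.2, next t.1 t.2)) j
  have hatt : ∀ j, 4 * #(s j).1 ≤ Fintype.card V → AttachedToGiant G (s j).1 (s j).2 := by
    intro j
    induction j with
    | zero => exact fun _ => hv₀
    | succ j ih =>
      intro hj
      refine (hnext (s j).1 (s j).2 (ih ?_) hj).2.2
      have : #(s j).1 ≤ #(s (j + 1)).1 := Finset.card_le_card Finset.subset_union_left
      omega
  refine ⟨fun j => (s j).2, fun j => (s j).1, rfl, fun _ => rfl, fun j hj => ?_⟩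
  refine hnext (s j).1 (s j).2 (hatt j ?_) hj
  change 4 * #(s (j + 1)).1 ≤ _ at hj
  have : #(s j).1 ≤ #(s (j + 1)).1 := Finset.card_le_card Finset.subset_union_left
  omega

end Holes

theorem hasInducedCycle_of_nat {V : Type*} {G : SimpleGraph V} {N : ℕ} (hN : 3 ≤ N) (g : ℕ → V)
    (hne : ∀ i j, i < j → j < N → g i ≠ g j)
    (hadj : ∀ i j, i < j → j < N → (G.Adj (g i) (g j) ↔ j = i + 1 ∨ i = 0 ∧ j + 1 = N)) :
    HasInducedCycle G N := by
  have : NeZero N := ⟨by omega⟩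
  have : Fact (1 < N) := ⟨by omega⟩
  have key : ∀ i j : ZMod N, i.val < j.val →
      (G.Adj (g i.val) (g j.val) ↔ (i - j = 1 ∨ j - i = 1)) := by
    intro i j hij
    have hj := ZMod.val_lt j
    rw [hadj _ _ hij hj, sub_eq_iff_eq_add, sub_eq_iff_eq_add,
      ← (ZMod.val_injective N).eq_iff, ← (ZMod.val_injective N).eq_iff (a := j),
      ZMod.val_add, ZMod.val_add, ZMod.val_one, Nat.mod_eq_of_lt (a := 1 + i.val) (by omega)]
    rcases Nat.lt_or_ge (1 + j.val) N with h | h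
    · rw [Nat.mod_eq_of_lt h]
      omega
    · have h' : 1 + j.val = N := by omega
      rw [h', Nat.mod_self]
      omega
  refine ⟨hN, fun z => g z.val, ?_, ?_⟩
  · intro i j hij
    rcases lt_trichotomy i.val j.val with h | h | h
    · exact absurd hij (hne _ _ h (ZMod.val_lt j))
    · exact ZMod.val_injective N h
    · exact absurd hij.symm (hne _ _ h (ZMod.val_lt i))
  · intro i j
    rcases lt_trichotomy i.val j.val with h | h | h
    · exact key i j h
    · obtain rfl := ZMod.val_injective N h
      simp
    · rw [G.adj_comm, key j i h, or_comm]

/-- A shortest walk between two vertices is an induced path. -/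
theorem SimpleGraph.Reachable.exists_induced_path {V : Type*} {H : SimpleGraph V} {a b : V}
    (h : H.Reachable a b) :
    ∃ (m : ℕ) (q : ℕ → V), q 0 = a ∧ q m = b ∧ (∀ i < m, H.Adj (q i) (q (i + 1))) ∧
      (∀ i j, i < j → j ≤ m → q i ≠ q j) ∧
      (∀ i j, i + 1 < j → j ≤ m → ¬ H.Adj (q i) (q j)) := by
  obtain ⟨w, hw⟩ := h.exists_walk_length_eq_dist
  have hdist : ∀ i ≤ w.length, w.length ≤ i + H.dist (w.getVert i) b := by
    intro i hi
    have h1 := SimpleGraph.dist_le (w.take i)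
    have h2 := (w.take i).reachable.dist_triangle_left b
    rw [w.take_length] at h1
    omega
  have hdist' : ∀ j, j ≤ w.length → H.dist (w.getVert j) b ≤ w.length - j := by
    intro j hj
    have h1 := SimpleGraph.dist_le (w.drop j)
    rwa [w.drop_length] at h1
  refine ⟨w.length, w.getVert, w.getVert_zero, w.getVert_length,
    fun i hi => w.adj_getVert_succ hi, ?_, ?_⟩
  · intro i j hij hj heq
    have h1 := hdist i (by omega)
    have h2 := hdist' j hj
    rw [heq] at h1
    omega
  · intro i j hij hj hadj
    have h1 := hdist i (by omega)
    have h2 := hdist' j hj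
    have h3 := hadj.reachable.dist_triangle_left b
    have h4 : H.dist (w.getVert i) (w.getVert j) = 1 := SimpleGraph.dist_eq_one_iff_adj.2 hadj
    omega

open Classical in
/-- An induced path whose ends are joined by a walk that avoids the closed neighbourhoods of its
inner vertices closes up to a hole. -/
theorem exists_hasInducedCycle_of_path {V : Type*} [Fintype V] {G : SimpleGraph V} {l : ℕ}
    (hl : 2 ≤ l) (p : ℕ → V) (hp : ∀ i < l, G.Adj (p i) (p (i + 1)))
    (hne : ∀ i j, i < j → j ≤ l → p i ≠ p j)
    (hind : ∀ i j, i + 1 < j → j ≤ l → ¬ G.Adj (p i) (p j))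
    (hreach : (G.avoid ((Finset.Ioo 0 l).biUnion (fun i => closedNbhd G (p i)) \
      {p 0, p l})).Reachable (p l) (p 0)) :
    ∃ N, l ≤ N ∧ HasInducedCycle G N := by
  set Z := (Finset.Ioo 0 l).biUnion (fun i => closedNbhd G (p i)) \ {p 0, p l} with hZ
  obtain ⟨m, q, hq0, hqm, hq, hqne, hqind⟩ := hreach.exists_induced_path
  have hm0 : m ≠ 0 := by
    rintro rfl
    exact hne 0 l (by omega) le_rfl (by rw [← hq0, ← hqm])
  have hm1 : m ≠ 1 := by
    rintro rfl
    have h := (hq 0 (by omega)).1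
    rw [zero_add, hq0, hqm] at h
    exact hind 0 l (by omega) le_rfl h.symm
  have hqZ : ∀ i ≤ m, q i ∉ Z := by
    intro i hi
    rcases hi.lt_or_eq with h | rfl
    · exact (hq i h).2.1
    · rw [hqm, hZ]
      simp
  have hqind' : ∀ i j, i + 1 < j → j ≤ m → ¬ G.Adj (q i) (q j) := fun i j hij hj h =>
    hqind i j hij hj ⟨h, hqZ i (by omega), hqZ j hj⟩
  have hcross : ∀ i j, 0 < i → i < l → 0 < j → j < m → p i ≠ q j ∧ ¬ G.Adj (p i) (q j) := by
    intro i j hi hil hj hjm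
    have h := hqZ j hjm.le
    have h0 : q j ≠ p 0 := hqm ▸ hqne j m hjm le_rfl
    have h1 : q j ≠ p l := hq0 ▸ (hqne 0 j hj hjm.le).symm
    have h2 : q j ∉ closedNbhd G (p i) := fun hmem => h (by
      rw [hZ, Finset.mem_sdiff]
      exact ⟨Finset.mem_biUnion.2 ⟨i, Finset.mem_Ioo.2 ⟨hi, hil⟩, hmem⟩, by simp [h0, h1]⟩)
    rw [mem_closedNbhd, not_or] at h2
    exact ⟨fun h => h2.1 h.symm, h2.2⟩
  refine ⟨l + m, by omega,
    hasInducedCycle_of_nat (by omega) (fun t => if t ≤ l then p t else q (t - l)) ?_ ?_⟩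
  · intro i j hij hj
    by_cases hjl : j ≤ l
    · rw [if_pos (by omega), if_pos hjl]
      exact hne i j hij hjl
    rw [if_neg hjl]
    by_cases hil : i ≤ l
    · rw [if_pos hil]
      rcases Nat.eq_zero_or_pos i with rfl | hi
      · rw [← hqm]
        exact (hqne _ m (by omega) le_rfl).symm
      rcases hil.lt_or_eq with h | rfl
      · exact (hcross i _ hi h (by omega) (by omega)).1
      · rw [← hq0]
        exact hqne 0 _ (by omega) (by omega)
    · rw [if_neg hil]
      exact hqne _ _ (by omega) (by omega)
  · intro i j hij hj
    by_cases hjl : j ≤ l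
    · rw [if_pos (by omega), if_pos hjl]
      by_cases h : j = i + 1
      · subst h
        simp [hp i (by omega)]
      · have := hind i j (by omega) hjl
        simp only [this, false_iff]
        omega
    rw [if_neg hjl]
    by_cases hil : i ≤ l
    · rw [if_pos hil]
      rcases Nat.eq_zero_or_pos i with rfl | hi
      · rw [← hqm, G.adj_comm]
        by_cases h : j + 1 = l + m
        · have h' := (hq (j - l) (by omega)).1
          rw [show j - l + 1 = m by omega] at h'
          simp [h', h]
        · have := hqind' (j - l) m (by omega) le_rfl
          simp only [this, false_iff]
          omega
      rcases hil.lt_or_eq with h | rfl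
      · have := (hcross i (j - l) hi h (by omega) (by omega)).2
        simp only [this, false_iff]
        omega
      · rw [← hq0]
        by_cases h : j = i + 1
        · subst h
          have h' := (hq 0 (by omega)).1
          simpa using h'
        · have := hqind' 0 (j - i) (by omega) (by omega)
          simp only [this, false_iff]
          omega
    · rw [if_neg hil]
      by_cases h : j = i + 1
      · subst h
        have h' := (hq (i - l) (by omega)).1
        rw [show i - l + 1 = i + 1 - l by omega] at h'
        simp [h']
      · have := hqind' (i - l) (j - l) (by omega) (by omega)
        simp only [this, false_iff]
        omega

open Classical in
theorem LargeSetsAdjacent.exists_hole {V : Type*} [Fintype V] {G : SimpleGraph V}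
    (hG : LargeSetsAdjacent G) (hV : 0 < Fintype.card V) {d : ℕ} (hd : 0 < d)
    (hdn : 64 * d ≤ Fintype.card V) (hdeg : ∀ v, ∃ w, G.Adj v w)
    (hnbhd : ∀ v, #(closedNbhd G v) ≤ d + 1) :
    ∃ N, Fintype.card V ≤ 64 * (d * N) ∧ HasInducedCycle G N := by
  set n := Fintype.card V with hn
  obtain ⟨p, X, hX0, hXs, hgood⟩ := hG.exists_greedy hV hdeg
  have hmono : Monotone X := monotone_nat_of_le_succ fun j => by
    rw [hXs]
    exact Finset.subset_union_left
  have hsub : ∀ {i j}, i < j → closedNbhd G (p i) ⊆ X j := fun {i j} hij =>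
    (by rw [hXs]; exact Finset.subset_union_right : closedNbhd G (p i) ⊆ X (i + 1)).trans
      (hmono hij)
  have hself : ∀ i, p i ∈ closedNbhd G (p i) := fun i => by simp
  have hgrow : ∀ j, #(X (j + 1)) ≤ #(X j) + (d + 1) := fun j => by
    rw [hXs]
    exact (Finset.card_union_le _ _).trans (Nat.add_le_add_left (hnbhd _) _)
  have hex : ∃ k, n ≤ 8 * #(X k) := by
    by_contra! hsmall
    have hlt : ∀ j, j ≤ #(X (2 * j)) := by
      intro j
      induction j with
      | zero => exact Nat.zero_le _
      | succ j ih =>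
        have h := (hgood (2 * j) (by have := hsmall (2 * j + 1); omega)).2.1
        have : X (2 * j) ⊂ X (2 * (j + 1)) :=
          Finset.ssubset_iff_of_subset (hmono (by omega)) |>.2
            ⟨_, hsub (by omega) (hself (2 * j + 1)), h⟩
        have := Finset.card_lt_card this
        omega
    have := hlt n
    have := hsmall (2 * n)
    omega
  obtain ⟨k, hk, hkmin⟩ : ∃ k, n ≤ 8 * #(X k) ∧ ∀ j < k, 8 * #(X j) < n :=
    ⟨Nat.find hex, Nat.find_spec hex, fun j hj => not_le.1 (Nat.find_min hex hj)⟩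
  have hk0 : k ≠ 0 := by
    rintro rfl
    rw [hX0, Finset.card_empty] at hk
    omega
  have hkcard : 8 * #(X k) ≤ n + 8 * (d + 1) := by
    have h1 := hkmin (k - 1) (by omega)
    have h2 := hgrow (k - 1)
    rw [show k - 1 + 1 = k by omega] at h2
    omega
  obtain ⟨l, hl1, hl2⟩ : ∃ l, 32 * (d * l) ≤ n ∧ n < 32 * (d * (l + 1)) := by
    refine ⟨n / (32 * d), ?_, ?_⟩
    · have := Nat.mul_div_le n (32 * d)
      linarith
    · have := Nat.lt_mul_div_succ n (b := 32 * d) (by omega)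
      linarith
  have hl : 2 ≤ l := by
    by_contra! h
    have : d * (l + 1) ≤ d * 2 := Nat.mul_le_mul_left _ (by omega)
    have : d * (l + 1) < d * 2 ∨ l + 1 = 2 := by
      rcases Nat.lt_or_ge (l + 1) 2 with h' | h'
      · exact Or.inl (Nat.mul_lt_mul_of_pos_left h' hd)
      · exact Or.inr (by omega)
    omega
  have hld : l * (d + 1) ≤ 2 * (d * l) := by nlinarith
  have hcard : ∀ j, #(X (k + j)) ≤ #(X k) + j * (d + 1) := by
    intro j
    induction j with
    | zero => simp
    | succ j ih =>
      have := hgrow (k + j)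
      rw [add_assoc] at this
      rw [add_mul, one_mul]
      omega
  have hcardL : 4 * #(X (k + l)) ≤ n := by
    have := hcard l
    omega
  have hgood' : ∀ j < k + l, G.Adj (p j) (p (j + 1)) ∧ p (j + 1) ∉ X j ∧
      AttachedToGiant G (X (j + 1)) (p (j + 1)) := by
    intro j hj
    refine hgood j ?_
    have := Finset.card_le_card (hmono (show j + 1 ≤ k + l by omega))
    omega
  have hfar : ∀ i j, i + 1 < j → j ≤ k + l → p j ∉ closedNbhd G (p i) := by
    intro i j hij hj hmem
    have h := (hgood' (j - 1) (by omega)).2.1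
    rw [show j - 1 + 1 = j by omega] at h
    exact h (hsub (by omega) hmem)
  have hatt := (hgood' (k + l - 1) (by omega)).2.2
  rw [show k + l - 1 + 1 = k + l by omega] at hatt
  obtain ⟨a, c, ha, hbig, hac, hpc⟩ := hatt
  set Y := (Finset.Ioo 0 l).biUnion (fun i => closedNbhd G (p (k + i))) with hY
  have hYX : Y ⊆ X (k + l) := Finset.biUnion_subset.2 fun i hi =>
    hsub (by have := Finset.mem_Ioo.1 hi; omega)
  have hYcard : #Y ≤ l * (d + 1) := by
    have := Finset.card_biUnion_le_card_mul (Finset.Ioo 0 l)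
      (fun i => closedNbhd G (p (k + i))) (d + 1) fun i _ => hnbhd _
    rw [Nat.card_Ioo] at this
    exact this.trans (Nat.mul_le_mul_right _ (by omega))
  have hBcard := Finset.le_card_sdiff Y (X k)
  have houtside : ∀ z ∈ reachSet G (X (k + l)) a, z ∉ X (k + l) := fun z hz =>
    (mem_reachSet.1 hz).notMem_of_avoid ha
  obtain ⟨x, hx, z, hz, hxz⟩ := hG (X k \ Y) (reachSet G (X (k + l)) a)
    (Finset.disjoint_left.2 fun x hx hx' =>
      houtside x hx' (hmono (Nat.le_add_right _ _) (Finset.mem_sdiff.1 hx).1))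
    (by omega) (by omega)
  rw [Finset.mem_sdiff] at hx
  obtain ⟨i, hik, hxi⟩ : ∃ i < k, x ∈ closedNbhd G (p i) := by
    have hcover : ∀ j, x ∈ X j → ∃ i < j, x ∈ closedNbhd G (p i) := by
      intro j
      induction j with
      | zero => simp [hX0]
      | succ j ih =>
        intro hj
        rw [hXs, Finset.mem_union] at hj
        rcases hj with hj | hj
        · obtain ⟨i, hi, h⟩ := ih hj
          exact ⟨i, by omega, h⟩
        · exact ⟨j, by omega, hj⟩
    exact hcover k hx.1
  have hpY : ∀ j < k, p j ∉ Y := by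
    intro j hj hmem
    obtain ⟨t, ht, hmem⟩ := Finset.mem_biUnion.1 hmem
    rw [Finset.mem_Ioo] at ht
    refine hfar j (k + t) (by omega) (by omega) ?_
    rw [mem_closedNbhd] at hmem ⊢
    exact hmem.imp Eq.symm SimpleGraph.Adj.symm
  set Z := Y \ {p (k + 0), p (k + l)} with hZ
  have hZY : Z ⊆ Y := Finset.sdiff_subset
  have hzY : z ∉ Y := fun h => houtside z hz (hYX h)
  have hcY : c ∉ Y := fun h => hac.notMem_of_avoid ha (hYX h)
  have hpZ : ∀ j ≤ k, p j ∉ Z := by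
    intro j hj
    rcases hj.lt_or_eq with h | rfl
    · exact fun h' => hpY j h (hZY h')
    · simp [hZ]
  have hpath : ∀ j, i ≤ j → j ≤ k → (G.avoid Z).Reachable (p i) (p j) := by
    intro j hij
    induction j, hij using Nat.le_induction with
    | base => exact fun _ => SimpleGraph.Reachable.refl _
    | succ j hij ih =>
      intro hj
      have : (G.avoid Z).Adj (p j) (p (j + 1)) :=
        ⟨(hgood' j (by omega)).1, hpZ j (by omega), hpZ (j + 1) hj⟩
      exact (ih (by omega)).trans this.reachable
  have hpx : (G.avoid Z).Reachable (p i) x := by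
    rcases mem_closedNbhd.1 hxi with rfl | h
    · exact SimpleGraph.Reachable.refl _
    · have : (G.avoid Z).Adj (p i) x := ⟨h, hpZ i hik.le, fun h => hx.2 (hZY h)⟩
      exact this.reachable
  have hxz' : (G.avoid Z).Adj x z := ⟨hxz, fun h => hx.2 (hZY h), fun h => hzY (hZY h)⟩
  have hzc : (G.avoid Z).Reachable z c :=
    ((mem_reachSet.1 hz).symm.trans hac).mono (SimpleGraph.avoid_anti (hZY.trans hYX))
  have hpc' : (G.avoid Z).Adj (p (k + l)) c :=
    ⟨hpc, by simp [hZ], fun h => hcY (hZY h)⟩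
  obtain ⟨N, hN, hcycle⟩ := exists_hasInducedCycle_of_path (G := G) hl (fun t => p (k + t))
    (fun t ht => (hgood' (k + t) (by omega)).1)
    (fun s t hst ht => by
      rcases Nat.lt_or_ge (s + 1) t with h | h
      · exact fun heq => hfar (k + s) (k + t) (by omega) (by omega) (by simp [heq])
      · obtain rfl : t = s + 1 := by omega
        exact (hgood' (k + s) (by omega)).1.ne)
    (fun s t hst ht hadj => hfar (k + s) (k + t) (by omega) (by omega) (by simp [hadj]))
    (hpc'.reachable.trans (hzc.symm.trans (hxz'.symm.reachable.trans
      (hpx.symm.trans (hpath k hik.le le_rfl)))))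
  refine ⟨N, hl2.le.trans ?_, hcycle⟩
  have h1 : d * (l + 1) ≤ d * (2 * N) := Nat.mul_le_mul_left _ (by omega)
  linarith

open Matrix in
theorem IsNDLGraph.largeSetsAdjacent {n d : ℕ} {lam : ℝ} {G : SimpleGraph (Fin n)}
    (h : IsNDLGraph n d lam G) (hd : 0 < d) (hlam : lam ≤ d / 400) : LargeSetsAdjacent G := by
  classical
  let := Classical.decRel G.Adj
  obtain ⟨hreg, i₀, hi₀, hi⟩ := h
  intro A B hAB hA hB
  by_contra! hno
  rw [Fintype.card_fin] at hA hB
  have hdpos : (0 : ℝ) < d := Nat.cast_pos.2 hd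
  have hnpos : (0 : ℝ) < n := Nat.cast_pos.2 i₀.pos
  set M := G.adjMatrix ℝ
  set ev := G.adjHermitian.eigenvalues
  let u : Fin n → Fin n → ℝ := fun i => (G.adjHermitian.eigenvectorBasis i).ofLp
  have hu : ∀ i, M *ᵥ u i = ev i • u i := fun i => G.adjHermitian.mulVec_eigenvectorBasis i
  have hparseval : ∀ x y : Fin n → ℝ, x ⬝ᵥ y = ∑ i, (u i ⬝ᵥ x) * (u i ⬝ᵥ y) := by
    intro x y
    have := G.adjHermitian.eigenvectorBasis.sum_inner_mul_inner (WithLp.toLp 2 x)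
      (WithLp.toLp 2 y)
    simp only [EuclideanSpace.inner_eq_star_dotProduct, star_trivial] at this
    rw [dotProduct_comm x y, ← this]
    refine Finset.sum_congr rfl fun i _ => ?_
    rw [dotProduct_comm (u i) y]
  have hsymm : ∀ i y, u i ⬝ᵥ (M *ᵥ y) = ev i * (u i ⬝ᵥ y) := by
    intro i y
    rw [dotProduct_mulVec, ← mulVec_transpose, G.transpose_adjMatrix, hu, smul_dotProduct,
      smul_eq_mul]
  let ind : Finset (Fin n) → Fin n → ℝ := fun S v => if v ∈ S then 1 else 0
  have hind : ∀ S (y : Fin n → ℝ), ind S ⬝ᵥ y = ∑ v ∈ S, y v := by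
    intro S y
    simp [ind, dotProduct]
  have hone : M *ᵥ ind Finset.univ = (d : ℝ) • ind Finset.univ := by
    ext v
    have h1 : ind Finset.univ = Function.const _ (1 : ℝ) := by
      ext v
      simp [ind]
    rw [h1, SimpleGraph.adjMatrix_mulVec_const_apply_of_regular hreg]
    simp
  have horth : ∀ i, i ≠ i₀ → u i ⬝ᵥ ind Finset.univ = 0 := by
    intro i hii
    have h1 := hsymm i (ind Finset.univ)
    rw [hone, dotProduct_smul, smul_eq_mul] at h1
    have h2 : ev i ≤ d / 400 := (le_abs_self _).trans ((hi i hii).trans hlam)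
    have h3 : ((d : ℝ) - ev i) * (u i ⬝ᵥ ind Finset.univ) = 0 := by linarith
    rcases mul_eq_zero.1 h3 with h4 | h4
    · linarith
    · exact h4
  have hcard : ∀ S : Finset (Fin n), (#S : ℝ) =
      (u i₀ ⬝ᵥ ind S) * (u i₀ ⬝ᵥ ind Finset.univ) := by
    intro S
    have h1 := hparseval (ind S) (ind Finset.univ)
    rw [Finset.sum_eq_single i₀ (fun i _ hii => by rw [horth i hii, mul_zero]) (by simp)] at h1
    rw [← h1, hind]
    simp [ind]
  have hsq : ∀ S : Finset (Fin n), ∑ i, (u i ⬝ᵥ ind S) ^ 2 = #S := by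
    intro S
    have h1 := hparseval (ind S) (ind S)
    rw [hind] at h1
    simp only [pow_two]
    rw [← h1]
    simp [ind]
  have hzero : ∑ i, ev i * ((u i ⬝ᵥ ind A) * (u i ⬝ᵥ ind B)) = 0 := by
    have h1 := hparseval (ind A) (M *ᵥ ind B)
    have h2 : ind A ⬝ᵥ (M *ᵥ ind B) = 0 := by
      rw [hind]
      refine Finset.sum_eq_zero fun a ha => ?_
      rw [SimpleGraph.adjMatrix_mulVec_apply]
      refine Finset.sum_eq_zero fun b hb => ?_
      rw [SimpleGraph.mem_neighborFinset] at hb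
      exact if_neg fun hbB => hno a ha b hbB hb
    rw [h2] at h1
    rw [h1]
    exact Finset.sum_congr rfl fun i _ => by rw [hsymm]; ring
  have hbound : ∀ i, i ≠ i₀ → -(ev i * ((u i ⬝ᵥ ind A) * (u i ⬝ᵥ ind B))) ≤
      d / 800 * ((u i ⬝ᵥ ind A) ^ 2 + (u i ⬝ᵥ ind B) ^ 2) := by
    intro i hii
    have h1 : |ev i| ≤ d / 400 := (hi i hii).trans hlam
    generalize u i ⬝ᵥ ind A = s
    generalize u i ⬝ᵥ ind B = t
    have h2 : |s * t| ≤ (s ^ 2 + t ^ 2) / 2 :=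
      abs_le.2 ⟨by nlinarith [sq_nonneg (s + t)], by nlinarith [sq_nonneg (s - t)]⟩
    calc -(ev i * (s * t)) ≤ |ev i * (s * t)| := neg_le_abs _
      _ = |ev i| * |s * t| := abs_mul _ _
      _ ≤ d / 400 * ((s ^ 2 + t ^ 2) / 2) := by gcongr
      _ = d / 800 * (s ^ 2 + t ^ 2) := by ring
  have hmain : d * ((u i₀ ⬝ᵥ ind A) * (u i₀ ⬝ᵥ ind B)) ≤ d / 800 * ((#A : ℝ) + #B) := by
    rw [← Finset.add_sum_erase _ _ (Finset.mem_univ i₀)] at hzero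
    have hi₀' : ev i₀ = d := hi₀
    rw [hi₀'] at hzero
    have h1 := Finset.sum_le_sum fun i (hmem : i ∈ Finset.univ.erase i₀) =>
      hbound i (Finset.ne_of_mem_erase hmem)
    have h2 : ∑ i ∈ Finset.univ.erase i₀, d / 800 *
        ((u i ⬝ᵥ ind A) ^ 2 + (u i ⬝ᵥ ind B) ^ 2) ≤ d / 800 * ((#A : ℝ) + #B) := by
      rw [← hsq A, ← hsq B, ← Finset.sum_add_distrib, Finset.mul_sum]
      exact Finset.sum_le_sum_of_subset_of_nonneg (Finset.erase_subset _ _)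
        fun _ _ _ => by positivity
    rw [Finset.sum_neg_distrib] at h1
    linarith
  have hprod : (#A : ℝ) * #B = (u i₀ ⬝ᵥ ind A) * (u i₀ ⬝ᵥ ind B) * n := by
    have h1 := hcard Finset.univ
    rw [Finset.card_univ, Fintype.card_fin] at h1
    rw [hcard A, hcard B, h1]
    ring
  have hsum : (#A : ℝ) + #B ≤ n := by
    have h1 := Finset.card_le_univ (A ∪ B)
    rw [Finset.card_union_of_disjoint hAB, Fintype.card_fin] at h1
    exact_mod_cast h1
  have hA' : (n : ℝ) ≤ 20 * #A := by exact_mod_cast hA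
  have hB' : (n : ℝ) ≤ 20 * #B := by exact_mod_cast hB
  have hαβ : (u i₀ ⬝ᵥ ind A) * (u i₀ ⬝ᵥ ind B) ≤ n / 800 := by
    refine le_of_mul_le_mul_left (hmain.trans ?_) hdpos
    calc d / 800 * ((#A : ℝ) + #B) ≤ d / 800 * n := by gcongr
      _ = d * (n / 800) := by ring
  have h1 : (#A : ℝ) * #B ≤ n / 800 * n := by
    rw [hprod]
    gcongr
  have h2 : (n : ℝ) * n ≤ (20 * #A) * (20 * #B) :=
    mul_le_mul hA' hB' hnpos.le (hnpos.le.trans hA')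
  nlinarith [mul_pos hnpos hnpos]

/-- There exist constants `δ₁, δ₂, δ₃ > 0` such that every `(n,d,λ)`-graph `G`
with `d ≤ δ₃ n` and `λ/d ≤ δ₁` contains an induced cycle of length at least `δ₂ n / d`. -/
theorem large_hole_in_ndl_graph :
    ∃ δ₁ > (0 : ℝ), ∃ δ₂ > (0 : ℝ), ∃ δ₃ > (0 : ℝ),
      ∀ (n d : ℕ), 0 < n → 0 < d →
        ∀ (lam : ℝ) (G : SimpleGraph (Fin n)),
          IsNDLGraph n d lam G → (d : ℝ) ≤ δ₃ * n → lam / d ≤ δ₁ →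
            ∃ k : ℕ, δ₂ * n / d ≤ (k : ℝ) ∧ HasInducedCycle G k := by
  classical
  refine ⟨1 / 400, by norm_num, 1 / 64, by norm_num, 1 / 64, by norm_num, ?_⟩
  intro n d hn hd lam G hG hdn hlam
  have hdpos : (0 : ℝ) < d := Nat.cast_pos.2 hd
  have hlam' : lam ≤ d / 400 := by
    rw [div_le_iff₀ hdpos] at hlam
    linarith
  let := Classical.decRel G.Adj
  have hreg : G.IsRegularOfDegree d := hG.1
  obtain ⟨N, hN, hcycle⟩ := (hG.largeSetsAdjacent hd hlam').exists_hole (d := d)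
    (by simpa using hn) hd
    (by
      rw [Fintype.card_fin]
      have : (64 * d : ℝ) ≤ n := by linarith
      exact_mod_cast this)
    (fun v => (G.degree_pos_iff_exists_adj v).1 (by rw [hreg v]; exact hd))
    (fun v => by
      have h : closedNbhd G v = insert v (G.neighborFinset v) := by
        ext w
        simp
      rw [h, ← hreg v]
      exact Finset.card_insert_le _ _)
  refine ⟨N, ?_, hcycle⟩
  rw [Fintype.card_fin] at hN
  have hN' : (n : ℝ) ≤ 64 * (d * N) := by exact_mod_cast hN
  rw [div_le_iff₀ hdpos]
  linarith
end

section
/- There exists ε₀ > 0 such that for every ε ∈ (0, ε₀) there exists a constant δ(ε) > 0 with the following property. For every γ > 0 there exist β > 0 and n₀ ∈ ℕ such that for all n ≥ n₀, all d with 1 + ε ≤ d ≤ β·n, and every (n,d,λ)-graph G with λ/d ≤ δ: setting p = (1+ε)/d, the probability that the p-site-percolated subgraph G_p contains an induced path on at least ε²n/(3d) vertices is at least 1 − γ. -/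
open Finset

open MeasureTheory in
/-- The Bernoulli measure on `Bool` with success probability `p`. -/
noncomputable def bernoulliMeasure (p : ℝ) : Measure Bool :=
  (ENNReal.ofReal p) • Measure.dirac true + (ENNReal.ofReal (1 - p)) • Measure.dirac false

open MeasureTheory in
/-- The site-percolation measure on subsets of `V` (encoded as functions `V → Bool`):
every vertex is retained independently with probability `p`. -/
noncomputable def percolationMeasure (V : Type*) [Fintype V] (p : ℝ) :
    Measure (V → Bool) :=
  Measure.pi fun _ : V => bernoulliMeasure p

/-- The vertex set retained by the percolation outcome `ω`. -/
def percSet {V : Type*} (ω : V → Bool) : Set V := {v : V | ω v = true}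

section Percolation

open MeasureTheory

instance (p : ℝ) : IsFiniteMeasure (bernoulliMeasure p) := by
  unfold bernoulliMeasure
  constructor
  simp [ENNReal.add_lt_top]

theorem isProbabilityMeasure_bernoulliMeasure {p : ℝ} (h0 : 0 ≤ p) (h1 : p ≤ 1) :
    IsProbabilityMeasure (bernoulliMeasure p) := by
  constructor
  simp only [bernoulliMeasure, Measure.coe_add, Measure.coe_smul, Pi.add_apply, Pi.smul_apply,
    measure_univ, smul_eq_mul, mul_one]
  rw [← ENNReal.ofReal_add h0 (by linarith)]
  simp

theorem isProbabilityMeasure_percolationMeasure (V : Type*) [Fintype V] {p : ℝ} (h0 : 0 ≤ p)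
    (h1 : p ≤ 1) : IsProbabilityMeasure (percolationMeasure V p) := by
  have := isProbabilityMeasure_bernoulliMeasure h0 h1
  unfold percolationMeasure
  infer_instance

theorem integral_bernoulliMeasure {p : ℝ} (h0 : 0 ≤ p) (h1 : p ≤ 1) (f : Bool → ℝ) :
    ∫ b, f b ∂(bernoulliMeasure p) = p * f true + (1 - p) * f false := by
  have := (Measure.dirac true).smul_finite (c := ENNReal.ofReal p) ENNReal.ofReal_ne_top
  have := (Measure.dirac false).smul_finite (c := ENNReal.ofReal (1 - p)) ENNReal.ofReal_ne_top
  unfold bernoulliMeasure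
  rw [integral_add_measure (Integrable.of_finite) (Integrable.of_finite),
    integral_smul_measure, integral_smul_measure, integral_dirac, integral_dirac,
    ENNReal.toReal_ofReal h0, ENNReal.toReal_ofReal (by linarith)]
  simp

variable {V : Type*} [Fintype V] [DecidableEq V]

/-- Resampling one coordinate preserves the percolation measure. -/
theorem measurePreserving_update {p : ℝ} (h0 : 0 ≤ p) (h1 : p ≤ 1) (q : V) :
    MeasurePreserving (fun x : Bool × (V → Bool) => Function.update x.2 q x.1)
      ((bernoulliMeasure p).prod (percolationMeasure V p)) (percolationMeasure V p) := by
  have := isProbabilityMeasure_bernoulliMeasure h0 h1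
  have := isProbabilityMeasure_percolationMeasure V h0 h1
  have hm : Measurable (fun x : Bool × (V → Bool) => Function.update x.2 q x.1) :=
    measurable_of_countable _
  refine ⟨hm, ?_⟩
  symm
  refine Measure.pi_eq fun s hs => ?_
  rw [Measure.map_apply hm (MeasurableSet.univ_pi hs)]
  have hpre : (fun x : Bool × (V → Bool) => Function.update x.2 q x.1) ⁻¹' (Set.univ.pi s)
      = s q ×ˢ Set.univ.pi (Function.update s q Set.univ) := by
    ext ⟨b, ω⟩
    simp only [Set.mem_preimage, Set.mem_pi, Set.mem_univ, true_imp_iff, Set.mem_prod]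
    constructor
    · intro h
      refine ⟨by simpa using h q, fun i => ?_⟩
      by_cases hi : i = q
      · subst hi; simp
      · simpa [hi] using h i
    · rintro ⟨hq, h⟩ i
      by_cases hi : i = q
      · subst hi; simpa using hq
      · simpa [hi] using h i
  rw [hpre, Measure.prod_prod, percolationMeasure, Measure.pi_pi,
    ← Finset.mul_prod_erase univ (fun i => bernoulliMeasure p (s i)) (mem_univ q),
    ← Finset.mul_prod_erase univ (fun i => bernoulliMeasure p (Function.update s q Set.univ i))
      (mem_univ q)]
  simp only [Function.update_self, measure_univ, one_mul]
  congr 1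
  refine Finset.prod_congr rfl fun i hi => ?_
  rw [Function.update_of_ne (Finset.ne_of_mem_erase hi)]

theorem integral_percolationMeasure_coord {p : ℝ} (h0 : 0 ≤ p) (h1 : p ≤ 1) (q : V)
    (F : Bool → (V → Bool) → ℝ) (hF : ∀ b b' ω, F b (Function.update ω q b') = F b ω) :
    ∫ ω, F (ω q) ω ∂(percolationMeasure V p) =
      p * ∫ ω, F true ω ∂(percolationMeasure V p)
        + (1 - p) * ∫ ω, F false ω ∂(percolationMeasure V p) := by
  have := isProbabilityMeasure_bernoulliMeasure h0 h1
  have := isProbabilityMeasure_percolationMeasure V h0 h1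
  rw [← (measurePreserving_update h0 h1 q).map_eq,
    integral_map (measurable_of_countable _).aemeasurable
      (measurable_of_countable _).aestronglyMeasurable,
    (measurePreserving_update h0 h1 q).map_eq]
  simp only [Function.update_self, hF]
  rw [integral_prod (fun x : Bool × (V → Bool) => F x.1 x.2) Integrable.of_finite,
    integral_bernoulliMeasure h0 h1]

end Percolation

section Mixing

open Matrix in
/-- The expander mixing lemma, for vectors: a symmetric matrix with constant row sums `d`, all of
whose eigenvalues but one are at most `l < d` in absolute value, is `d / n` times the all-ones
matrix up to an error of operator norm at most `l`. -/
theorem Matrix.IsHermitian.dotProduct_mulVec_le {ι : Type*} [Fintype ι] [DecidableEq ι]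
    {A : Matrix ι ι ℝ} (hA : A.IsHermitian) {d l : ℝ} (hl : 0 ≤ l) (hld : l < d)
    (hone : A *ᵥ 1 = d • 1) (i₀ : ι) (h₀ : hA.eigenvalues i₀ = d)
    (h : ∀ i, i ≠ i₀ → |hA.eigenvalues i| ≤ l) (x y : ι → ℝ) :
    x ⬝ᵥ A *ᵥ y ≤ d * (∑ i, x i) * (∑ i, y i) / Fintype.card ι
      + l * (√(∑ i, x i ^ 2) * √(∑ i, y i ^ 2)) := by
  set b := hA.eigenvectorBasis with hb
  let E : (ι → ℝ) → EuclideanSpace ℝ ι := WithLp.toLp 2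
  have hin : ∀ u v : ι → ℝ, inner ℝ (E u) (E v) = u ⬝ᵥ v := fun u v => by
    simp [E, PiLp.inner_apply, dotProduct, mul_comm]
  have hE : ∀ i, b i = E (b i).ofLp := fun i => rfl
  have hmv : ∀ i (v : ι → ℝ), inner ℝ (b i) (E (A *ᵥ v)) =
      hA.eigenvalues i * inner ℝ (b i) (E v) := fun i v => by
    have h1 := hA.mulVec_eigenvectorBasis i
    have hT : Aᵀ = A := by rw [← Matrix.conjTranspose_eq_transpose_of_trivial]; exact hA
    rw [hE, hin, hin, dotProduct_mulVec, ← mulVec_transpose, hT, ← hb] at *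
    rw [h1, smul_dotProduct, smul_eq_mul]
  have horth : ∀ i, i ≠ i₀ → inner ℝ (b i) (E 1) = 0 := fun i hi => by
    have h1 := hmv i 1
    have h2 : E (d • 1) = d • E 1 := rfl
    rw [hone, h2, inner_smul_right] at h1
    have h3 : hA.eigenvalues i < d := lt_of_le_of_lt ((le_abs_self _).trans (h i hi)) hld
    have h4 : (d - hA.eigenvalues i) * inner ℝ (b i) (E 1) = 0 := by linarith
    rcases mul_eq_zero.1 h4 with h5 | h5
    · linarith
    · exact h5
  have hpar : ∀ u v : ι → ℝ, u ⬝ᵥ v = ∑ i, inner ℝ (b i) (E u) * inner ℝ (b i) (E v) :=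
    fun u v => by
      rw [← hin, ← b.sum_inner_mul_inner]
      exact Finset.sum_congr rfl fun i _ => by rw [real_inner_comm (b i) (E u)]
  have hsingle : ∀ u : ι → ℝ, ∑ i, u i = inner ℝ (b i₀) (E 1) * inner ℝ (b i₀) (E u) :=
    fun u => by
      have h1 : ∑ i, u i = 1 ⬝ᵥ u := (one_dotProduct u).symm
      rw [h1, hpar, Finset.sum_eq_single i₀ (fun i _ hi => by rw [horth i hi, zero_mul])
        (by simp)]
  have hcard : (Fintype.card ι : ℝ) = inner ℝ (b i₀) (E 1) ^ 2 := by
    have := hsingle 1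
    simp only [Pi.one_apply, sum_const, card_univ, nsmul_eq_mul, mul_one] at this
    rw [this, sq]
  have hpos : (0 : ℝ) < Fintype.card ι := by
    exact_mod_cast Fintype.card_pos_iff.2 ⟨i₀⟩
  have hmain : d * (∑ i, x i) * (∑ i, y i) / Fintype.card ι =
      d * (inner ℝ (b i₀) (E x) * inner ℝ (b i₀) (E y)) := by
    rw [div_eq_iff hpos.ne', hsingle x, hsingle y, hcard]
    ring
  rw [hpar, ← Finset.add_sum_erase univ _ (mem_univ i₀), hmain, hmv, h₀]
  have hsq : ∀ u : ι → ℝ, ∑ i, u i ^ 2 = ∑ i, |inner ℝ (b i) (E u)| ^ 2 := fun u => by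
    have := hpar u u
    simpa [dotProduct, sq] using this
  have hrest : ∑ i ∈ univ.erase i₀, inner ℝ (b i) (E x) * inner ℝ (b i) (E (A *ᵥ y)) ≤
      l * (√(∑ i, x i ^ 2) * √(∑ i, y i ^ 2)) := by
    calc ∑ i ∈ univ.erase i₀, inner ℝ (b i) (E x) * inner ℝ (b i) (E (A *ᵥ y))
        ≤ ∑ i ∈ univ.erase i₀, l * (|inner ℝ (b i) (E x)| * |inner ℝ (b i) (E y)|) := by
          refine Finset.sum_le_sum fun i hi => ?_
          rw [hmv]
          refine (le_abs_self _).trans ?_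
          rw [abs_mul, abs_mul, mul_left_comm]
          exact mul_le_mul_of_nonneg_right (h i (Finset.ne_of_mem_erase hi)) (by positivity)
      _ ≤ ∑ i, l * (|inner ℝ (b i) (E x)| * |inner ℝ (b i) (E y)|) :=
          Finset.sum_le_sum_of_subset_of_nonneg (Finset.erase_subset _ _)
            fun _ _ _ => by positivity
      _ ≤ l * (√(∑ i, x i ^ 2) * √(∑ i, y i ^ 2)) := by
          rw [← Finset.mul_sum, hsq x, hsq y]
          exact mul_le_mul_of_nonneg_left (Real.sum_mul_le_sqrt_mul_sqrt _ _ _) hl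
  linarith

theorem SimpleGraph.sum_card_neighborFinset_inter_le {V : Type*} [Fintype V] [DecidableEq V]
    (G : SimpleGraph V) [DecidableRel G.Adj] {d : ℕ} {l : ℝ} (hreg : G.IsRegularOfDegree d)
    (hl : 0 ≤ l) (hld : l < d) (hA : (G.adjMatrix ℝ).IsHermitian) (i₀ : V)
    (h₀ : hA.eigenvalues i₀ = d) (h : ∀ i, i ≠ i₀ → |hA.eigenvalues i| ≤ l)
    (S T : Finset V) :
    (∑ v ∈ S, (#(G.neighborFinset v ∩ T) : ℝ)) ≤
      d * #S * #T / Fintype.card V + l * Fintype.card V := by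
  have key := hA.dotProduct_mulVec_le hl hld (by
      ext v
      simp [SimpleGraph.adjMatrix_mulVec_apply, hreg.degree_eq v]) i₀ h₀ h
    (fun v => if v ∈ S then 1 else 0) (fun v => if v ∈ T then 1 else 0)
  have hlhs : (∑ v ∈ S, (#(G.neighborFinset v ∩ T) : ℝ)) =
      dotProduct (fun v => if v ∈ S then (1 : ℝ) else 0)
        (Matrix.mulVec (G.adjMatrix ℝ) (fun v => if v ∈ T then 1 else 0)) := by
    simp [dotProduct, SimpleGraph.adjMatrix_mulVec_apply, Finset.sum_ite_mem]
  rw [hlhs]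
  refine key.trans ?_
  have hsqrt : ∀ S : Finset V,
      √(∑ v, (if v ∈ S then (1 : ℝ) else 0) ^ 2) ≤ √(Fintype.card V) := fun S => by
    apply Real.sqrt_le_sqrt
    simpa using Finset.card_le_univ S
  have hsum : ∀ S : Finset V, ∑ v, (if v ∈ S then (1 : ℝ) else 0) = #S := fun S => by simp
  rw [hsum, hsum]
  gcongr
  calc _ ≤ √(Fintype.card V : ℝ) * √(Fintype.card V) :=
        mul_le_mul (hsqrt S) (hsqrt T) (by positivity) (by positivity)
    _ = Fintype.card V := Real.mul_self_sqrt (by positivity)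

end Mixing

section Exploration

variable {V : Type*}

/-- `f` traces an induced path of `G` inside `X` that dominates every vertex outside `Q` having a
neighbour in `X`. -/
structure IsFrontierPath (G : SimpleGraph V) (Q X : Finset V) {k : ℕ} (f : Fin k → V) : Prop where
  injective : Function.Injective f
  adj_iff : ∀ i j : Fin k,
    G.Adj (f i) (f j) ↔ ((i : ℕ) + 1 = (j : ℕ) ∨ (j : ℕ) + 1 = (i : ℕ))
  mem : ∀ i, f i ∈ X
  dominates : ∀ v ∉ Q, ∀ x ∈ X, G.Adj x v → ∃ i, G.Adj (f i) v

/-- After querying `Q` and finding the retained vertices `X`, some frontier path exists. -/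
def HasFrontierPath (G : SimpleGraph V) (Q X : Finset V) : Prop :=
  ∃ (k : ℕ) (f : Fin k → V), IsFrontierPath G Q X f

theorem hasFrontierPath_empty (G : SimpleGraph V) : HasFrontierPath G ∅ ∅ :=
  ⟨0, Fin.elim0, fun i => i.elim0, fun i => i.elim0, fun i => i.elim0, by simp⟩

theorem IsFrontierPath.insert_queried [DecidableEq V] {G : SimpleGraph V} {Q X : Finset V} {k : ℕ}
    {f : Fin k → V} (hf : IsFrontierPath G Q X f) (v : V) :
    IsFrontierPath G (insert v Q) X f :=
  ⟨hf.injective, hf.adj_iff, hf.mem, fun w hw => hf.dominates w fun h => hw (mem_insert_of_mem h)⟩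

theorem IsFrontierPath.cons [DecidableEq V] {G : SimpleGraph V} {Q X : Finset V} {k : ℕ}
    {f : Fin k → V} (hf : IsFrontierPath G Q X f) {v : V} (hv : v ∉ X)
    (hadj : ∀ i : Fin k, G.Adj v (f i) ↔ (i : ℕ) = 0) :
    IsFrontierPath G (insert v Q) (insert v X) (Fin.cons v f : Fin (k + 1) → V) where
  injective := Fin.cons_injective_iff.2
    ⟨by rintro ⟨i, rfl⟩; exact hv (hf.mem i), hf.injective⟩
  adj_iff i j := by
    refine Fin.cases ?_ (fun i => ?_) i <;> refine Fin.cases ?_ (fun j => ?_) j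
    · simp
    · simp [hadj, eq_comm]
    · simp [G.adj_comm _ v, hadj, eq_comm]
    · simp [hf.adj_iff]
  mem i := by
    refine Fin.cases ?_ (fun i => ?_) i
    · simp
    · simpa using Or.inr (hf.mem i)
  dominates w hw x hx hxw := by
    rcases mem_insert.1 hx with rfl | hx
    · exact ⟨0, by simpa using hxw⟩
    · obtain ⟨i, hi⟩ := hf.dominates w (fun h => hw (mem_insert_of_mem h)) x hx hxw
      exact ⟨i.succ, by simpa using hi⟩

/-- The depth-first search can always be continued while keeping its stack an induced path: prune
the frontier path to minimal length, and query a vertex that only its top vertex dominates. -/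
theorem HasFrontierPath.exists_query [DecidableEq V] {G : SimpleGraph V} {Q X : Finset V}
    (h : HasFrontierPath G Q X) (hXQ : X ⊆ Q) (hQ : ∃ v, v ∉ Q) :
    ∃ v ∉ Q, HasFrontierPath G (insert v Q) (insert v X) ∧ HasFrontierPath G (insert v Q) X := by
  classical
  obtain ⟨f, hf⟩ := Nat.find_spec h
  have hmin := fun m => Nat.find_min h (m := m)
  generalize Nat.find h = k at f hf hmin
  obtain ⟨v, hv, hadj⟩ : ∃ v ∉ Q, ∀ i : Fin k, G.Adj v (f i) ↔ (i : ℕ) = 0 := by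
    cases k with
    | zero =>
      obtain ⟨v, hv⟩ := hQ
      exact ⟨v, hv, fun i => i.elim0⟩
    | succ k =>
      by_contra! hno
      refine hmin k (Nat.lt_succ_self k) ⟨fun i => f i.succ,
        fun i j hij => Fin.succ_injective _ (hf.injective hij),
        fun i j => by simp [hf.adj_iff], fun i => hf.mem _, fun w hw x hx hxw => ?_⟩
      by_contra! hnone
      obtain ⟨i, hi⟩ := hf.dominates w hw x hx hxw
      have h0 : G.Adj (f 0) w := by
        revert hi
        refine Fin.cases (fun hi => hi) (fun i hi => absurd hi (hnone i)) i
      obtain ⟨j, hj⟩ := hno w hw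
      revert hj
      refine Fin.cases ?_ (fun j => ?_) j
      · simp [h0.symm]
      · simp [G.adj_comm w, hnone j]
  exact ⟨v, hv, ⟨k + 1, _, hf.cons (fun h => hv (hXQ h)) hadj⟩, ⟨k, f, hf.insert_queried v⟩⟩

variable [Fintype V] [DecidableEq V] (G : SimpleGraph V) [DecidableRel G.Adj]

/-- The neighbourhood of a set of vertices. -/
def SimpleGraph.setNeighborFinset (X : Finset V) : Finset V := 
  X.biUnion fun v => G.neighborFinset v

variable {G} in
/-- A frontier path is long once `X` has many neighbours outside `Q`. -/
theorem IsFrontierPath.card_setNeighborFinset_le {d : ℕ} (hreg : G.IsRegularOfDegree d)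
    {Q X : Finset V} {k : ℕ} {f : Fin k → V} (hf : IsFrontierPath G Q X f) :
    #(G.setNeighborFinset X) ≤ #Q + k * d := by
  have hsub : G.setNeighborFinset X ⊆ Q ∪ univ.biUnion fun i => G.neighborFinset (f i) := by
    intro v hv
    simp only [SimpleGraph.setNeighborFinset, mem_biUnion, SimpleGraph.mem_neighborFinset,
      mem_union, mem_univ, true_and] at hv ⊢
    obtain ⟨x, hx, hxv⟩ := hv
    by_cases hvQ : v ∈ Q
    · exact Or.inl hvQ
    · exact Or.inr (hf.dominates v hvQ x hx hxv)
  refine (card_le_card hsub).trans ((card_union_le _ _).trans (Nat.add_le_add_left ?_ _))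
  refine card_biUnion_le.trans (le_of_eq ?_)
  simp [hreg.degree_eq]

theorem SimpleGraph.card_setNeighborFinset_insert {d : ℕ} (hreg : G.IsRegularOfDegree d)
    (X : Finset V) (v : V) :
    #(G.setNeighborFinset (insert v X)) + #(G.neighborFinset v ∩ G.setNeighborFinset X) =
      #(G.setNeighborFinset X) + d := by
  have := card_union_add_card_inter (G.neighborFinset v) (G.setNeighborFinset X)
  rw [G.card_neighborFinset_eq_degree, hreg.degree_eq v] at this
  rw [SimpleGraph.setNeighborFinset, biUnion_insert]
  unfold SimpleGraph.setNeighborFinset at this ⊢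
  omega

/-- The state of the depth-first exploration. -/
structure Exploration (V : Type*) where
  /-- the vertices queried so far -/
  queried : Finset V
  /-- the queried vertices that turned out to be retained -/
  retained : Finset V
  /-- the number of edges from queried vertices to the neighbourhood, at the time of the query, of
  the retained set -/
  overlap : ℕ

namespace Exploration

/-- The exploration before any query. -/
def start (V : Type*) : Exploration V := ⟨∅, ∅, 0⟩

/-- The invariants of the exploration. -/
structure Valid (s : Exploration V) : Prop where
  subset : s.retained ⊆ s.queried
  hasFrontierPath : HasFrontierPath G s.queried s.retained

/-- Append the answer `b` to the query `v`. -/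
def answer (s : Exploration V) (v : V) (b : Bool) : Exploration V where
  queried := insert v s.queried
  retained := bif b then insert v s.retained else s.retained
  overlap := s.overlap + #(G.neighborFinset v ∩ G.setNeighborFinset s.retained)

variable {G} in
theorem Valid.exists_query {s : Exploration V} (hs : s.Valid G)
    (hcard : #s.queried < Fintype.card V) :
    ∃ v, v ∉ s.queried ∧ ∀ b, (s.answer G v b).Valid G := by
  obtain ⟨v, hv, h1, h2⟩ := hs.hasFrontierPath.exists_query hs.subset (by
    by_contra! h
    exact hcard.ne (by rw [← card_univ, eq_univ_of_forall h]))
  refine ⟨v, hv, fun b => ?_⟩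
  cases b
  · exact ⟨hs.subset.trans (subset_insert _ _), h2⟩
  · exact ⟨insert_subset_insert _ hs.subset, h1⟩

theorem retained_subset_answer (s : Exploration V) (v : V) (b : Bool) :
    s.retained ⊆ (s.answer G v b).retained := by
  cases b
  · exact Subset.rfl
  · exact subset_insert _ _

variable {G} in
theorem card_queried_answer {s : Exploration V} {v : V} (hv : v ∉ s.queried) (b : Bool) :
    #(s.answer G v b).queried = #s.queried + 1 :=
  card_insert_of_notMem hv

/-- The martingale comparing the neighbourhood of the retained set with its compensator. -/
noncomputable def deviation (d : ℕ) (p : ℝ) (s : Exploration V) : ℝ :=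
  #(G.setNeighborFinset s.retained) - p * (d * #s.queried - s.overlap)

variable {G} in
theorem deviation_answer_sq {d : ℕ} (hreg : G.IsRegularOfDegree d) {p : ℝ} (h0 : 0 ≤ p)
    {s : Exploration V} {v : V} (hv : v ∉ s.queried) :
    p * deviation G d p (s.answer G v true) ^ 2
      + (1 - p) * deviation G d p (s.answer G v false) ^ 2 ≤
      deviation G d p s ^ 2 + p * d ^ 2 := by
  have hins := G.card_setNeighborFinset_insert hreg s.retained v
  have hle : #(G.neighborFinset v ∩ G.setNeighborFinset s.retained) ≤ d := by
    refine (card_le_card inter_subset_left).trans ?_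
    rw [G.card_neighborFinset_eq_degree, hreg.degree_eq v]
  set e := #(G.neighborFinset v ∩ G.setNeighborFinset s.retained) with he
  have hle' : (e : ℝ) ≤ d := by exact_mod_cast hle
  have hins' : (#(G.setNeighborFinset (insert v s.retained)) : ℝ) =
      #(G.setNeighborFinset s.retained) + (d - e) := by
    have : (#(G.setNeighborFinset (insert v s.retained)) : ℝ) + e =
      #(G.setNeighborFinset s.retained) + d := by exact_mod_cast hins
    linarith
  have ht : deviation G d p (s.answer G v true) = deviation G d p s + (1 - p) * (d - e) := by
    simp only [deviation, answer, card_insert_of_notMem hv, cond_true, hins', ← he]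
    push_cast
    ring
  have hf : deviation G d p (s.answer G v false) = deviation G d p s - p * (d - e) := by
    simp only [deviation, answer, card_insert_of_notMem hv, cond_false, ← he]
    push_cast
    ring
  have hg : ((d : ℝ) - e) ^ 2 ≤ d ^ 2 :=
    pow_le_pow_left₀ (by linarith) (by linarith [(Nat.cast_nonneg e : (0 : ℝ) ≤ e)]) 2
  have hp : p * (1 - p) * ((d : ℝ) - e) ^ 2 ≤ p * d ^ 2 := by
    have : p * (1 - p) ≤ p := by nlinarith
    exact mul_le_mul this hg (sq_nonneg _) h0
  rw [ht, hf]
  nlinarith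

variable [Nonempty V]

open Classical in
/-- The next vertex to be queried. -/
noncomputable def query (s : Exploration V) : V :=
  if h : ∃ v, v ∉ s.queried ∧ ∀ b, (s.answer G v b).Valid G then h.choose
  else Classical.arbitrary V

variable {G} in
theorem Valid.query_spec {s : Exploration V} (hs : s.Valid G)
    (hcard : #s.queried < Fintype.card V) :
    s.query G ∉ s.queried ∧ ∀ b, (s.answer G (s.query G) b).Valid G := by
  have h := hs.exists_query hcard
  rw [query, dif_pos h]
  exact h.choose_spec

/-- The exploration with `t` further queries, answered by `ω`. -/
noncomputable def run : ℕ → Exploration V → (V → Bool) → Exploration V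
  | 0, s, _ => s
  | t + 1, s, ω => run t (s.answer G (s.query G) (ω (s.query G))) ω

theorem run_add (a b : ℕ) (s : Exploration V) (ω : V → Bool) :
    run G (a + b) s ω = run G b (run G a s ω) ω := by
  induction a generalizing s with
  | zero => simp [run]
  | succ a ih => rw [Nat.succ_add]; exact ih _

theorem queried_subset_run (t : ℕ) (s : Exploration V) (ω : V → Bool) :
    s.queried ⊆ (run G t s ω).queried := by
  induction t generalizing s with
  | zero => exact Subset.rfl
  | succ t ih =>
    exact (subset_insert (s.query G) s.queried).trans (ih (s.answer G (s.query G) _))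

theorem retained_subset_run (t : ℕ) (s : Exploration V) (ω : V → Bool) :
    s.retained ⊆ (run G t s ω).retained := by
  induction t generalizing s with
  | zero => exact Subset.rfl
  | succ t ih => exact (retained_subset_answer G s _ _).trans (ih _)

theorem eq_true_of_mem_retained_run (t : ℕ) (s : Exploration V) (ω : V → Bool)
    (hs : ∀ v ∈ s.retained, ω v = true) : ∀ v ∈ (run G t s ω).retained, ω v = true := by
  induction t generalizing s with
  | zero => exact hs
  | succ t ih =>
    refine ih _ fun v hv => ?_
    cases hb : ω (s.query G) with
    | false => exact hs v (by simpa [answer, hb] using hv)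
    | true =>
      rcases mem_insert.1 (by simpa [answer, hb] using hv) with rfl | h
      · exact hb
      · exact hs v h

variable {G}

theorem Valid.run {s : Exploration V} (hs : s.Valid G) (t : ℕ) (ω : V → Bool)
    (ht : #s.queried + t ≤ Fintype.card V) :
    (run G t s ω).Valid G ∧ #(run G t s ω).queried = #s.queried + t := by
  induction t generalizing s with
  | zero => exact ⟨hs, rfl⟩
  | succ t ih =>
    obtain ⟨hq, hv⟩ := hs.query_spec (by omega)
    have hc := card_queried_answer (G := G) hq (ω (s.query G))
    have := ih (hv (ω (s.query G))) (by omega)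
    exact ⟨this.1, this.2.trans (by omega)⟩

theorem Valid.run_update {s : Exploration V} (hs : s.Valid G) (t : ℕ) (ω : V → Bool)
    (ht : #s.queried + t ≤ Fintype.card V) {q : V} (hq : q ∈ s.queried) (b : Bool) :
    Exploration.run G t s (Function.update ω q b) = Exploration.run G t s ω := by
  induction t generalizing s with
  | zero => rfl
  | succ t ih =>
    obtain ⟨hn, hv⟩ := hs.query_spec (by omega)
    have hne : s.query G ≠ q := fun h => hn (h ▸ hq)
    have hc := card_queried_answer (G := G) hn (ω (s.query G))
    simp only [Exploration.run, Function.update_of_ne hne]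
    exact ih (hv _) (by omega) (mem_insert_of_mem hq)

/-- The overlap gained during a run is at most the number of edges between the newly queried
vertices and the final neighbourhood of the retained set. -/
theorem Valid.overlap_run_le {s : Exploration V} (hs : s.Valid G) (t : ℕ) (ω : V → Bool)
    (ht : #s.queried + t ≤ Fintype.card V) :
    (Exploration.run G t s ω).overlap ≤ s.overlap +
      ∑ v ∈ (Exploration.run G t s ω).queried \ s.queried,
        #(G.neighborFinset v ∩ G.setNeighborFinset (Exploration.run G t s ω).retained) := by
  induction t generalizing s with
  | zero => simp [Exploration.run]
  | succ t ih =>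
    obtain ⟨hn, hv⟩ := hs.query_spec (by omega)
    have hc := card_queried_answer (G := G) hn (ω (s.query G))
    refine (ih (hv _) (by omega)).trans ?_
    simp only [Exploration.run]
    set s' := s.answer G (s.query G) (ω (s.query G)) with hs'
    set e := Exploration.run G t s' ω with he
    have hsplit : e.queried \ s.queried = insert (s.query G) (e.queried \ s'.queried) := by
      have h1 : s.query G ∈ e.queried := queried_subset_run G t s' ω (mem_insert_self _ _)
      ext w
      simp only [mem_sdiff, mem_insert, hs', answer]
      by_cases hw : w = s.query G
      · subst hw; simp [h1, hn]
      · simp [hw]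
    rw [hsplit, sum_insert (by simp [hs', answer])]
    have hmono : #(G.neighborFinset (s.query G) ∩ G.setNeighborFinset s.retained) ≤
        #(G.neighborFinset (s.query G) ∩ G.setNeighborFinset e.retained) := by
      refine card_le_card (inter_subset_inter_left (biUnion_subset_biUnion_of_subset_left _ ?_))
      exact (retained_subset_answer G s _ _).trans (retained_subset_run G t s' ω)
    have : s'.overlap =
      s.overlap + #(G.neighborFinset (s.query G) ∩ G.setNeighborFinset s.retained) := rfl
    omega

open MeasureTheory in
theorem Valid.integral_deviation_run_sq_le {d : ℕ} (hreg : G.IsRegularOfDegree d) {p : ℝ}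
    (h0 : 0 ≤ p) (h1 : p ≤ 1) {s : Exploration V} (hs : s.Valid G) (t : ℕ)
    (ht : #s.queried + t ≤ Fintype.card V) :
    ∫ ω, deviation G d p (Exploration.run G t s ω) ^ 2 ∂(percolationMeasure V p) ≤
      deviation G d p s ^ 2 + t * (p * d ^ 2) := by
  have := isProbabilityMeasure_percolationMeasure V h0 h1
  induction t generalizing s with
  | zero => simp [Exploration.run]
  | succ t ih =>
    obtain ⟨hn, hv⟩ := hs.query_spec (by omega)
    have hc := fun b => card_queried_answer (G := G) hn b
    simp only [Exploration.run]
    rw [integral_percolationMeasure_coord h0 h1 (s.query G)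
      (fun b ω => deviation G d p (Exploration.run G t (s.answer G (s.query G) b) ω) ^ 2)
      (fun b b' ω => by
        rw [(hv b).run_update t ω (by rw [hc]; omega) (mem_insert_self _ _)])]
    have ht1 := mul_le_mul_of_nonneg_left (ih (hv true) (by rw [hc]; omega)) h0
    have ht2 := mul_le_mul_of_nonneg_left (ih (hv false) (by rw [hc]; omega)) (sub_nonneg.2 h1)
    have := deviation_answer_sq hreg h0 hn
    push_cast
    linarith

end Exploration

end Exploration

section Main

namespace Exploration

theorem valid_start {V : Type*} {G : SimpleGraph V} : (start V).Valid G :=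
  ⟨Subset.rfl, hasFrontierPath_empty G⟩

variable {V : Type*} [Fintype V] [DecidableEq V] {G : SimpleGraph V} [DecidableRel G.Adj]

/-- In a percolation outcome without long induced paths, the neighbourhood of the retained set found
by an exploration is hardly larger than the queried set. -/
theorem Valid.card_setNeighborFinset_le {d : ℕ} (hreg : G.IsRegularOfDegree d)
    {s : Exploration V} (hs : s.Valid G) {ω : V → Bool} (hω : ∀ v ∈ s.retained, ω v = true)
    {L : ℝ} (hno : ∀ k : ℕ, HasInducedPath (G.induce (percSet ω)) k → (k : ℝ) * d ≤ L) :
    (#(G.setNeighborFinset s.retained) : ℝ) ≤ #s.queried + L := by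
  obtain ⟨k, f, hf⟩ := hs.hasFrontierPath
  have hpath : HasInducedPath (G.induce (percSet ω)) k :=
    ⟨fun i => ⟨f i, hω _ (hf.mem i)⟩, fun i j hij => hf.injective (congrArg Subtype.val hij),
      fun i j => by simpa using hf.adj_iff i j⟩
  have h1 : (#(G.setNeighborFinset s.retained) : ℝ) ≤ #s.queried + k * d := by
    exact_mod_cast hf.card_setNeighborFinset_le hreg
  linarith [hno k hpath]

variable [Nonempty V]

/-- If the neighbourhood of the retained set stays small at the ends of blocks of `m` queries each,
then the overlap stays small. -/
theorem overlap_run_start_le {d m K : ℕ} {δ η : ℝ}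
    (hmix : ∀ S T : Finset V, (∑ v ∈ S, (#(G.neighborFinset v ∩ T) : ℝ)) ≤
      d * #S * #T / Fintype.card V + δ * d * Fintype.card V)
    (hKm : K * m ≤ Fintype.card V) (ω : V → Bool)
    (hsmall : ∀ j ≤ K, (#(G.setNeighborFinset (run G (j * m) (start V) ω).retained) : ℝ) ≤
      j * m + η * Fintype.card V) (j : ℕ) (hj : j ≤ K) :
    ((run G (j * m) (start V) ω).overlap : ℝ) ≤
      d * (m ^ 2 * (j * (j + 1) / 2) / Fintype.card V + j * m * η
        + j * δ * Fintype.card V) := by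
  induction j with
  | zero => simp [run, start]
  | succ j ih =>
    have hjm : (j + 1) * m ≤ Fintype.card V := (Nat.mul_le_mul_right m hj).trans hKm
    have hjm' : j * m + m ≤ Fintype.card V := by rwa [← Nat.succ_mul]
    obtain ⟨hv, hq⟩ := valid_start.run (G := G) (j * m) ω (by simp [start]; omega)
    have hsm := hsmall (j + 1) hj
    have hrun : run G ((j + 1) * m) (start V) ω = run G m (run G (j * m) (start V) ω) ω := by
      rw [Nat.succ_mul, run_add]
    have ih' := ih (by omega)
    rw [hrun] at hsm ⊢
    set s := run G (j * m) (start V) ω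
    have hq0 : #s.queried = j * m := by simpa [start] using hq
    have ho := hv.overlap_run_le m ω (by omega)
    have hq' := (hv.run m ω (by omega)).2
    set e := run G m s ω
    have hdiff : #(e.queried \ s.queried) = m := by
      rw [card_sdiff_of_subset (queried_subset_run G m s ω)]
      exact (congrArg (· - #s.queried) hq').trans (Nat.add_sub_cancel_left _ _)
    have ho' : (e.overlap : ℝ) ≤ s.overlap + ∑ v ∈ e.queried \ s.queried,
        (#(G.neighborFinset v ∩ G.setNeighborFinset e.retained) : ℝ) := by exact_mod_cast ho
    have hm := hmix (e.queried \ s.queried) (G.setNeighborFinset e.retained)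
    rw [hdiff] at hm
    have hn : (0 : ℝ) < Fintype.card V := by exact_mod_cast Fintype.card_pos
    have hle : (d : ℝ) * m * #(G.setNeighborFinset e.retained) / Fintype.card V ≤
        d * m * ((j + 1 : ℕ) * m + η * Fintype.card V) / Fintype.card V := by gcongr
    refine ho'.trans ((add_le_add ih' (hm.trans (add_le_add_left hle _))).trans (le_of_eq ?_))
    push_cast
    field_simp
    ring

end Exploration

open MeasureTheory in
/-- The quantitative form of the induced path theorem, for a graph with a mixing property. -/
theorem measureReal_no_long_induced_path_le {V : Type*} [Fintype V] [DecidableEq V] [Nonempty V]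
    {G : SimpleGraph V} [DecidableRel G.Adj] {d : ℕ} (hreg : G.IsRegularOfDegree d) {ε : ℝ}
    (hε : 0 < ε) (hε' : ε < 1 / 100) (hd : 1 + ε ≤ d) (hn : 250 ≤ ε * Fintype.card V)
    (hmix : ∀ S T : Finset V, (∑ v ∈ S, (#(G.neighborFinset v ∩ T) : ℝ)) ≤
      d * #S * #T / Fintype.card V + ε ^ 2 / 1000 * d * Fintype.card V) :
    (percolationMeasure V ((1 + ε) / d)).real
      {ω | ∃ k : ℕ, ε ^ 2 * Fintype.card V / (3 * d) ≤ (k : ℝ) ∧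
        HasInducedPath (G.induce (percSet ω)) k}ᶜ ≤
      800 * d / (ε ^ 4 * Fintype.card V) := by
  set n : ℝ := (Fintype.card V : ℝ) with hn_def
  have hd0 : (0 : ℝ) < d := by linarith
  have hn0 : 0 < n := by
    rw [hn_def]; exact_mod_cast Fintype.card_pos
  set p : ℝ := (1 + ε) / d with hp
  have hpd : p * d = 1 + ε := div_mul_cancel₀ _ hd0.ne'
  have hp0 : 0 ≤ p := by positivity
  have hp1 : p ≤ 1 := (div_le_one hd0).2 hd
  have := isProbabilityMeasure_percolationMeasure V hp0 hp1
  set m : ℕ := ⌊ε * n / 10⌋₊ with hm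
  have hm1 : (m : ℝ) ≤ ε * n / 10 := Nat.floor_le (by positivity)
  have hm2 : ε * n / 10 < m + 1 := Nat.lt_floor_add_one _
  have hKm : 10 * m ≤ Fintype.card V := by
    have : ((10 * m : ℕ) : ℝ) ≤ Fintype.card V := by
      push_cast
      nlinarith
    exact_mod_cast this
  have hsub : {ω | ∃ k : ℕ, ε ^ 2 * n / (3 * d) ≤ (k : ℝ) ∧
      HasInducedPath (G.induce (percSet ω)) k}ᶜ ⊆
      {ω | (ε ^ 2 * n / 20) ^ 2 ≤
        Exploration.deviation G d p (Exploration.run G (10 * m) (Exploration.start V) ω) ^ 2} := by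
    intro ω hω
    simp only [Set.mem_compl_iff, Set.mem_ofPred_eq, not_exists, not_and] at hω ⊢
    have hno : ∀ k : ℕ, HasInducedPath (G.induce (percSet ω)) k → (k : ℝ) * d ≤ ε ^ 2 / 3 * n := by
      intro k hk
      have h1 : (k : ℝ) < ε ^ 2 * n / (3 * d) := not_le.1 fun h => hω k h hk
      rw [lt_div_iff₀ (by positivity)] at h1
      linarith
    have hrun : ∀ j ≤ 10, (Exploration.run G (j * m) (Exploration.start V) ω).Valid G ∧
        #(Exploration.run G (j * m) (Exploration.start V) ω).queried = j * m := fun j hj => by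
      have := Exploration.valid_start.run (G := G) (j * m) ω (by
        have := Nat.mul_le_mul_right m hj
        simp only [Exploration.start, card_empty]
        omega)
      simpa [Exploration.start] using this
    have hsmall : ∀ j ≤ 10, (#(G.setNeighborFinset
        (Exploration.run G (j * m) (Exploration.start V) ω).retained) : ℝ) ≤
        j * m + ε ^ 2 / 3 * n := fun j hj => by
      have := (hrun j hj).1.card_setNeighborFinset_le hreg
        (Exploration.eq_true_of_mem_retained_run G _ _ ω (by simp [Exploration.start])) hno
      rw [(hrun j hj).2] at this
      exact_mod_cast this
    have hov := Exploration.overlap_run_start_le hmix hKm ω hsmall 10 le_rfl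
    have hN := hsmall 10 le_rfl
    have hQ := (hrun 10 le_rfl).2
    rw [← hn_def] at hov
    have hdev : Exploration.deviation G d p
        (Exploration.run G (10 * m) (Exploration.start V) ω) ≤ -(ε ^ 2 * n / 20) := by
      unfold Exploration.deviation
      rw [hQ]
      have hpo := mul_le_mul_of_nonneg_left hov hp0
      rw [← mul_assoc, hpd] at hpo
      have hpQ : p * ((d : ℝ) * ((10 * m : ℕ) : ℝ)) = (1 + ε) * (10 * m) := by
        rw [← mul_assoc, hpd]; push_cast; ring
      rw [mul_sub, hpQ]
      have hsq : (m : ℝ) ^ 2 * (10 * (10 + 1) / 2) / n ≤ 55 / 100 * (ε ^ 2 * n) := by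
        rw [div_le_iff₀ hn0]
        have := pow_le_pow_left₀ (Nat.cast_nonneg m) hm1 2
        nlinarith
      have hlin : (10 : ℝ) * m * (ε ^ 2 / 3) ≤ 1 / 300 * (ε ^ 2 * n) := by
        have : (10 : ℝ) * m ≤ 1 / 100 * n := by nlinarith
        nlinarith [sq_nonneg ε]
      have hε2 : 250 * ε ≤ ε ^ 2 * n := by nlinarith
      push_cast at hpo hN
      have hbound : (1 + ε) * ((m : ℝ) ^ 2 * (10 * (10 + 1) / 2) / n + 10 * m * (ε ^ 2 / 3) +
          10 * (ε ^ 2 / 1000) * n) ≤ 101 / 100 * (57 / 100 * (ε ^ 2 * n)) := by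
        have h0 : 0 ≤ ε ^ 2 * n := by positivity
        refine mul_le_mul (by linarith) (by linarith) (by positivity) (by norm_num)
      have hεm : ε * (ε * n / 10) < ε * (m + 1) := mul_lt_mul_of_pos_left hm2 hε
      nlinarith
    have hpos : 0 ≤ ε ^ 2 * n / 20 := by positivity
    nlinarith
  have hint := Exploration.valid_start.integral_deviation_run_sq_le hreg hp0 hp1 (10 * m)
    (by simpa [Exploration.start] using hKm)
  have hdev0 : Exploration.deviation G d p (Exploration.start V) = 0 := by
    simp [Exploration.deviation, Exploration.start, SimpleGraph.setNeighborFinset]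
  have hmarkov := mul_meas_ge_le_integral_of_nonneg (μ := percolationMeasure V p)
    (f := fun ω => Exploration.deviation G d p
      (Exploration.run G (10 * m) (Exploration.start V) ω) ^ 2)
    (Filter.Eventually.of_forall fun ω => sq_nonneg _) Integrable.of_finite
    ((ε ^ 2 * n / 20) ^ 2)
  have hmono := measureReal_mono (μ := percolationMeasure V p) hsub
  rw [hdev0] at hint
  have hpd2 : p * (d : ℝ) ^ 2 = (1 + ε) * d := by rw [sq, ← mul_assoc, hpd]
  rw [hpd2] at hint
  have hT : ((10 * m : ℕ) : ℝ) * ((1 + ε) * d) ≤ n * (2 * d) := by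
    have : ((10 * m : ℕ) : ℝ) ≤ n := by rw [hn_def]; exact_mod_cast hKm
    gcongr
    linarith
  rw [le_div_iff₀ (by positivity)]
  have hmul := mul_le_mul_of_nonneg_left hmono (sq_nonneg (ε ^ 2 * n / 20))
  refine le_of_mul_le_mul_right ?_ hn0
  nlinarith

end Main

/-- There is `ε₀ > 0` such that for every `ε ∈ (0, ε₀)` there is `δ(ε) > 0` with the
following property: for every `γ > 0` there are `β > 0` and `n₀` such that for all
`n ≥ n₀`, all `d` with `1 + ε ≤ d ≤ β n`, and every `(n,d,λ)`-graph `G` with `λ/d ≤ δ`,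
with probability at least `1 - γ` the `p`-site-percolated subgraph `G_p`, `p = (1+ε)/d`,
contains an induced path on at least `ε² n / (3d)` vertices. -/
theorem induced_path_in_percolated_ndl_graph :
    ∃ ε₀ > (0 : ℝ), ∀ ε : ℝ, 0 < ε → ε < ε₀ →
      ∃ δ > (0 : ℝ), ∀ γ > (0 : ℝ), ∃ β > (0 : ℝ), ∃ n₀ : ℕ,
        ∀ n : ℕ, n₀ ≤ n → ∀ d : ℕ, 1 + ε ≤ (d : ℝ) → (d : ℝ) ≤ β * n →
          ∀ (lam : ℝ) (G : SimpleGraph (Fin n)),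
            IsNDLGraph n d lam G → lam / d ≤ δ →
              ENNReal.ofReal (1 - γ) ≤
                percolationMeasure (Fin n) ((1 + ε) / d)
                  {ω : Fin n → Bool |
                    ∃ k : ℕ, ε ^ 2 * n / (3 * d) ≤ (k : ℝ) ∧
                      HasInducedPath (G.induce (percSet ω)) k} := by
  refine ⟨1 / 100, by norm_num, fun ε hε hε' => ⟨ε ^ 2 / 1000, by positivity, fun γ hγ =>
    ⟨γ * ε ^ 4 / 800, by positivity, ⌈250 / ε⌉₊, ?_⟩⟩⟩
  intro n hn d hd hdn lam G hG hlam
  classical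
  obtain ⟨hreg, i₀, h₀, hother⟩ := hG
  have : Nonempty (Fin n) := ⟨i₀⟩
  have hd0 : (0 : ℝ) < d := by linarith
  have hn' : 250 ≤ ε * n := by
    have h1 : 250 / ε ≤ n := (Nat.le_ceil _).trans (by exact_mod_cast hn)
    rw [div_le_iff₀ hε] at h1
    linarith
  have hn0 : (0 : ℝ) < n := by
    by_contra! h
    nlinarith
  have hlam' : lam ≤ ε ^ 2 / 1000 * d := (div_le_iff₀ hd0).1 hlam
  let := Classical.decRel G.Adj
  have hmix := G.sum_card_neighborFinset_inter_le hreg (l := ε ^ 2 / 1000 * d) (by positivity)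
    (mul_lt_of_lt_one_left hd0 (by nlinarith)) G.adjHermitian i₀ h₀
    (fun i hi => (hother i hi).trans hlam')
  have hd1 : 0 ≤ (1 + ε) / (d : ℝ) := by positivity
  have hd2 : (1 + ε) / (d : ℝ) ≤ 1 := (div_le_one hd0).2 hd
  have hprob := isProbabilityMeasure_percolationMeasure (Fin n) hd1 hd2
  have hmain := measureReal_no_long_induced_path_le hreg hε hε' hd (by simpa using hn') hmix
  rw [MeasureTheory.probReal_compl_eq_one_sub (Set.toFinite _).measurableSet] at hmain
  rw [Fintype.card_fin] at hmain
  have hsmall : 800 * (d : ℝ) / (ε ^ 4 * n) ≤ γ := by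
    rw [div_le_iff₀ (by positivity)]
    linarith
  refine ENNReal.ofReal_le_of_le_toReal ?_
  change _ ≤ MeasureTheory.Measure.real _ _
  linarith
end

section
/- For every constant δ > 0 there exists a constant C = C(δ) > 0 such that the following holds. For every sufficiently large integer d, there exist infinitely many integers n for which there exists an (n,d,λ)-graph G with λ/d ≤ δ in which every induced path has at most C·n/d vertices. -/
open Finset

/-- A rotation map of a `U`-labelled regular multigraph on `V`: an involution of the darts
`V × U` such that the adjacency quadratic form is at most `c * |U|` times the squared norm on
functions of sum zero. -/
def IsExpandingRotation {V U : Type} [Fintype V] [Fintype U] (r : V × U → V × U) (c : ℝ) : Prop :=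
  Function.Involutive r ∧ ∀ f : V → ℝ, ∑ v, f v = 0 →
    |∑ v, ∑ u, f v * f (r (v, u)).1| ≤ c * Fintype.card U * ∑ v, f v ^ 2

/-- There is a `D`-regular multigraph on `n` vertices whose nontrivial normalized eigenvalues
are at most `c` in absolute value. -/
def ExistsExpandingRotation (n D : ℕ) (c : ℝ) : Prop :=
  ∃ r : Fin n × Fin D → Fin n × Fin D, IsExpandingRotation r c

lemma abs_sum_mul_le {ι : Type*} [Fintype ι] (a b : ι → ℝ) {A B c : ℝ} (hA : 0 ≤ A) (hB : 0 ≤ B)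
    (hc : 0 ≤ c) (ha : ∑ i, a i ^ 2 ≤ A) (hb : ∑ i, b i ^ 2 ≤ c ^ 2 * B) :
    |∑ i, a i * b i| ≤ c * (A + B) / 2 := by
  refine abs_le_of_sq_le_sq ?_ (by positivity)
  calc (∑ i, a i * b i) ^ 2 ≤ (∑ i, a i ^ 2) * ∑ i, b i ^ 2 := Finset.sum_mul_sq_le_sq_mul_sq ..
    _ ≤ A * (c ^ 2 * B) := mul_le_mul ha hb (Finset.sum_nonneg fun i _ => sq_nonneg _) hA
    _ ≤ (c * (A + B) / 2) ^ 2 := by nlinarith [mul_nonneg (sq_nonneg c) (sq_nonneg (A - B))]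

section Rotation

variable {V U W E : Type} [Fintype V] [Fintype U] [Fintype W] [Fintype E]

lemma IsExpandingRotation.mono {r : V × U → V × U} {c c' : ℝ} (h : IsExpandingRotation r c)
    (hc : c ≤ c') : IsExpandingRotation r c' := by
  refine ⟨h.1, fun f hf => (h.2 f hf).trans ?_⟩
  gcongr

lemma IsExpandingRotation.exists_fin {r : V × U → V × U} {c : ℝ} (h : IsExpandingRotation r c) :
    ExistsExpandingRotation (Fintype.card V) (Fintype.card U) c := by
  let e := (Fintype.equivFin V).prodCongr (Fintype.equivFin U)
  refine ⟨fun x => e (r (e.symm x)), fun x => by simp [h.1 _], fun f hf => ?_⟩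
  have key := h.2 (fun v => f (Fintype.equivFin V v))
    (by rw [← hf]; exact Equiv.sum_comp (Fintype.equivFin V) f)
  rw [Equiv.sum_comp (Fintype.equivFin V) (fun v => f v ^ 2)] at key
  rw [Fintype.card_fin]
  convert key using 2
  rw [← Equiv.sum_comp (Fintype.equivFin V)]
  refine Finset.sum_congr rfl fun v _ => ?_
  rw [← Equiv.sum_comp (Fintype.equivFin U)]
  refine Finset.sum_congr rfl fun u _ => ?_
  simp [e]

lemma sum_rotation_symm {r : V × U → V × U} (hr : Function.Involutive r) (f g : V → ℝ) :
    ∑ v, ∑ u, f v * g (r (v, u)).1 = ∑ v, (∑ u, f (r (v, u)).1) * g v := by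
  simp_rw [Finset.sum_mul]
  rw [← Fintype.sum_prod_type' (f := fun v u => f v * g (r (v, u)).1),
    ← Fintype.sum_prod_type' (f := fun v u => f (r (v, u)).1 * g v),
    ← Equiv.sum_comp hr.toPerm]
  simp [hr _]

lemma IsExpandingRotation.sum_sq_le {r : V × U → V × U} {c : ℝ} (h : IsExpandingRotation r c)
    (hc : 0 ≤ c) (f : V → ℝ) (hf : ∑ v, f v = 0) :
    ∑ v, (∑ u, f (r (v, u)).1) ^ 2 ≤ (c * Fintype.card U) ^ 2 * ∑ v, f v ^ 2 := by
  set g : V → ℝ := fun v => ∑ u, f (r (v, u)).1 with hg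
  set C : ℝ := c * Fintype.card U
  have hC : 0 ≤ C := by positivity
  have hg0 : ∑ v, g v = 0 := by
    have := sum_rotation_symm h.1 f (fun _ => 1)
    simp only [mul_one, Finset.sum_const, nsmul_eq_mul, ← Finset.mul_sum, hf,
      mul_zero] at this
    exact this.symm
  have hfg : ∑ v, ∑ u, f v * g (r (v, u)).1 = ∑ v, g v ^ 2 := by
    rw [sum_rotation_symm h.1]; simp [hg, sq]
  have hgf : ∑ v, ∑ u, g v * f (r (v, u)).1 = ∑ v, g v ^ 2 := by
    simp only [← Finset.mul_sum, sq]; rfl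
  have key (t : ℝ) : 2 * t * ∑ v, g v ^ 2 ≤ C * (∑ v, f v ^ 2 + t ^ 2 * ∑ v, g v ^ 2) := by
    have h1 := (le_abs_self _).trans (h.2 (fun v => f v + t * g v)
      (by simp [Finset.sum_add_distrib, ← Finset.mul_sum, hf, hg0]))
    have h2 := (neg_le_abs _).trans (h.2 (fun v => f v - t * g v)
      (by simp [Finset.sum_sub_distrib, ← Finset.mul_sum, hf, hg0]))
    have e1 : ∑ v, ∑ u, (f v + t * g v) * (f (r (v, u)).1 + t * g (r (v, u)).1)
        - ∑ v, ∑ u, (f v - t * g v) * (f (r (v, u)).1 - t * g (r (v, u)).1)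
        = 2 * t * (∑ v, ∑ u, f v * g (r (v, u)).1) + 2 * t * ∑ v, ∑ u, g v * f (r (v, u)).1 := by
      simp only [Finset.mul_sum, ← Finset.sum_sub_distrib, ← Finset.sum_add_distrib]
      exact Finset.sum_congr rfl fun v _ => Finset.sum_congr rfl fun u _ => by ring
    have e2 : ∑ v, (f v + t * g v) ^ 2 + ∑ v, (f v - t * g v) ^ 2
        = 2 * (∑ v, f v ^ 2 + t ^ 2 * ∑ v, g v ^ 2) := by
      simp only [Finset.mul_sum, ← Finset.sum_add_distrib]
      exact Finset.sum_congr rfl fun v _ => by ring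
    rw [hfg, hgf] at e1
    have := congrArg (C * ·) e2
    linarith
  have hG : 0 ≤ ∑ v, g v ^ 2 := Finset.sum_nonneg fun i _ => sq_nonneg _
  have hF : 0 ≤ ∑ v, f v ^ 2 := Finset.sum_nonneg fun i _ => sq_nonneg _
  rcases hC.eq_or_lt with h0 | h0
  · have := key 1
    rw [← h0] at this ⊢
    linarith
  · have := key C⁻¹
    field_simp at this
    linarith

lemma IsExpandingRotation.square {r : V × U → V × U} {c : ℝ} (h : IsExpandingRotation r c)
    (hc : 0 ≤ c) :
    IsExpandingRotation (fun x : V × (U × U) =>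
      ((r ((r (x.1, x.2.1)).1, x.2.2)).1,
        ((r ((r (x.1, x.2.1)).1, x.2.2)).2, (r (x.1, x.2.1)).2))) (c ^ 2) := by
  refine ⟨fun x => by simp [h.1 _], fun f hf => ?_⟩
  have e : ∑ v, ∑ u : U × U, f v * f (r ((r (v, u.1)).1, u.2)).1
      = ∑ v, (∑ u, f (r (v, u)).1) ^ 2 := by
    have := sum_rotation_symm h.1 f (fun v => ∑ u, f (r (v, u)).1)
    simp only [← sq] at this
    rw [← this]
    refine Finset.sum_congr rfl fun v _ => ?_
    rw [Fintype.sum_prod_type]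
    exact Finset.sum_congr rfl fun u _ => by simp only [Finset.mul_sum]
  simp only [e]
  rw [abs_of_nonneg (Finset.sum_nonneg fun i _ => sq_nonneg _)]
  refine (h.sum_sq_le hc f hf).trans (le_of_eq ?_)
  simp only [Fintype.card_prod]
  push_cast
  ring

/-- The zig-zag product of two rotation maps. -/
def zigzag (π : V × W → V × W) (ρ : W × E → W × E) (x : (V × W) × (E × E)) :
    (V × W) × (E × E) :=
  let a := ρ (x.1.2, x.2.1)
  let b := π (x.1.1, a.1)
  let c := ρ (b.2, x.2.2)
  ((b.1, c.1), (c.2, a.2))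

lemma IsExpandingRotation.zigzag [Nonempty W] {π : V × W → V × W} {ρ : W × E → W × E} {c μ : ℝ}
    (hπ : IsExpandingRotation π c) (hρ : IsExpandingRotation ρ μ) (hc : 0 ≤ c) (hμ : 0 ≤ μ) :
    IsExpandingRotation (zigzag π ρ) (c + μ + μ ^ 2) := by
  refine ⟨fun x => by simp [_root_.zigzag, hπ.1 _, hρ.1 _], fun f hf => ?_⟩
  set B : (V × W → ℝ) → V × W → ℝ := fun f x => ∑ e, f (x.1, (ρ (x.2, e)).1) with hB
  have hquad : ∑ x, ∑ u, f x * f (_root_.zigzag π ρ (x, u)).1 = ∑ x, B f x * B f (π x) := by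
    rw [Fintype.sum_prod_type, Fintype.sum_prod_type]
    refine Finset.sum_congr rfl fun v _ => ?_
    have := sum_rotation_symm hρ.1 (fun w => f (v, w)) (fun w => B f (π (v, w)))
    rw [hB] at this ⊢
    refine Eq.trans ?_ this
    refine Finset.sum_congr rfl fun w _ => ?_
    rw [Fintype.sum_prod_type]
    refine Finset.sum_congr rfl fun e _ => ?_
    rw [Finset.mul_sum]
    rfl
  have hW : (0 : ℝ) < Fintype.card W := by exact_mod_cast Fintype.card_pos
  set w : ℝ := (Fintype.card W : ℝ) with hw
  set ε : ℝ := (Fintype.card E : ℝ) with hε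
  set F : V → ℝ := fun v => (∑ y, f (v, y)) / w with hF
  set g : V × W → ℝ := fun x => f x - F x.1 with hg
  have hg0 (v : V) : ∑ y, g (v, y) = 0 := by
    simp only [hg, Finset.sum_sub_distrib, Finset.sum_const, Finset.card_univ, nsmul_eq_mul, hF]
    field_simp
    simp [hw]
  have hF0 : ∑ v, F v = 0 := by
    rw [Fintype.sum_prod_type] at hf
    rw [hF, ← Finset.sum_div, hf, zero_div]
  have hBf (x) : B f x = ε * F x.1 + B g x := by
    simp [hB, hg, hε]
  have hnorm : ∑ x, f x ^ 2 = w * ∑ v, F v ^ 2 + ∑ x, g x ^ 2 := by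
    rw [Fintype.sum_prod_type, Fintype.sum_prod_type, Finset.mul_sum, ← Finset.sum_add_distrib]
    refine Finset.sum_congr rfl fun v _ => ?_
    have : ∑ y, f (v, y) ^ 2 = ∑ y, (F v ^ 2 + 2 * F v * g (v, y) + g (v, y) ^ 2) :=
      Finset.sum_congr rfl fun y _ => by simp only [hg]; ring
    rw [this, Finset.sum_add_distrib, Finset.sum_add_distrib, ← Finset.mul_sum, hg0]
    simp [hw]
  have ha : 0 ≤ w * ∑ v, F v ^ 2 := mul_nonneg hW.le (Finset.sum_nonneg fun i _ => sq_nonneg _)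
  have hb : 0 ≤ ∑ x, g x ^ 2 := Finset.sum_nonneg fun i _ => sq_nonneg _
  set a := w * ∑ v, F v ^ 2 with ha'
  set b := ∑ x, g x ^ 2 with hb'
  have hBg : ∑ x, B g x ^ 2 ≤ μ ^ 2 * (ε ^ 2 * b) := by
    rw [hb', Fintype.sum_prod_type, Fintype.sum_prod_type, Finset.mul_sum, Finset.mul_sum]
    refine Finset.sum_le_sum fun v _ => ?_
    refine (hρ.sum_sq_le hμ (fun y => g (v, y)) (hg0 v)).trans (le_of_eq ?_)
    rw [mul_pow]; ring
  have hperm (k : V × W → ℝ) : ∑ x, k (π x) = ∑ x, k x := Equiv.sum_comp hπ.1.toPerm k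
  have hFn : ∑ x : V × W, (ε * F x.1) ^ 2 ≤ ε ^ 2 * a := by
    rw [Fintype.sum_prod_type]
    simp only [mul_pow, Finset.sum_const, Finset.card_univ, nsmul_eq_mul, ha', Finset.mul_sum]
    exact le_of_eq (Finset.sum_congr rfl fun v _ => by ring)
  have t1 : |∑ x : V × W, (ε * F x.1) * (ε * F (π x).1)| ≤ c * (ε ^ 2 * a) := by
    have := mul_le_mul_of_nonneg_left (hπ.2 F hF0) (sq_nonneg ε)
    rw [← abs_of_nonneg (sq_nonneg ε), ← abs_mul, abs_of_nonneg (sq_nonneg ε)] at this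
    refine (le_of_eq ?_).trans (this.trans_eq ?_)
    · rw [Fintype.sum_prod_type]
      simp only [Finset.mul_sum]
      congr 1
      exact Finset.sum_congr rfl fun v _ => Finset.sum_congr rfl fun u _ => by ring
    · rw [ha']; ring
  have t2 : |∑ x : V × W, (ε * F x.1) * B g (π x)| ≤ μ * (ε ^ 2 * a + ε ^ 2 * b) / 2 :=
    abs_sum_mul_le _ _ (by positivity) (by positivity) hμ hFn
      (by rw [hperm (fun x => B g x ^ 2)]; exact hBg)
  have t3 : |∑ x : V × W, (ε * F (π x).1) * B g x| ≤ μ * (ε ^ 2 * a + ε ^ 2 * b) / 2 :=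
    abs_sum_mul_le _ _ (by positivity) (by positivity) hμ
      (by rw [hperm (fun x => (ε * F x.1) ^ 2)]; exact hFn) hBg
  have t4 : |∑ x : V × W, B g x * B g (π x)|
      ≤ 1 * (μ ^ 2 * (ε ^ 2 * b) + μ ^ 2 * (ε ^ 2 * b)) / 2 :=
    abs_sum_mul_le _ _ (by positivity) (by positivity) zero_le_one hBg
      (by rw [hperm (fun x => B g x ^ 2)]; linarith)
  have hsplit : ∑ x, B f x * B f (π x) = ∑ x : V × W, (ε * F x.1) * (ε * F (π x).1)
      + ∑ x : V × W, (ε * F x.1) * B g (π x) + ∑ x : V × W, (ε * F (π x).1) * B g x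
      + ∑ x : V × W, B g x * B g (π x) := by
    simp only [← Finset.sum_add_distrib, hBf]
    exact Finset.sum_congr rfl fun x _ => by ring
  rw [hquad, hsplit, hnorm, Fintype.card_prod]
  push_cast
  have p1 : 0 ≤ c * (ε ^ 2 * b) := by positivity
  have p2 : 0 ≤ μ ^ 2 * (ε ^ 2 * a) := by positivity
  rw [abs_le] at *
  constructor <;> linarith [t1.1, t1.2, t2.1, t2.2, t3.1, t3.2, t4.1, t4.2]

end Rotation

lemma ExistsExpandingRotation.mono {n D : ℕ} {c c' : ℝ} (h : ExistsExpandingRotation n D c)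
    (hc : c ≤ c') : ExistsExpandingRotation n D c' :=
  let ⟨r, hr⟩ := h
  ⟨r, hr.mono hc⟩

lemma ExistsExpandingRotation.square {n D : ℕ} {c : ℝ} (h : ExistsExpandingRotation n D c)
    (hc : 0 ≤ c) : ExistsExpandingRotation n (D * D) (c ^ 2) := by
  obtain ⟨r, hr⟩ := h
  simpa using (hr.square hc).exists_fin

lemma ExistsExpandingRotation.zigzag {n D e : ℕ} {c μ : ℝ} (hD : D ≠ 0)
    (h : ExistsExpandingRotation n D c) (h' : ExistsExpandingRotation D e μ)
    (hc : 0 ≤ c) (hμ : 0 ≤ μ) :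
    ExistsExpandingRotation (n * D) (e * e) (c + μ + μ ^ 2) := by
  obtain ⟨r, hr⟩ := h
  obtain ⟨s, hs⟩ := h'
  have : Nonempty (Fin D) := ⟨⟨0, Nat.pos_of_ne_zero hD⟩⟩
  simpa using (hr.zigzag hs hc hμ).exists_fin

lemma existsExpandingRotation_one (D : ℕ) : ExistsExpandingRotation 1 D 0 := by
  refine ⟨id, fun _ => rfl, fun f hf => ?_⟩
  have : f 0 = 0 := by simpa using hf
  simp [this]

/-- The point-line incidence rotation on the affine plane of order `p`. -/
lemma existsExpandingRotation_affinePlane (p : ℕ) [Fact p.Prime] :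
    ExistsExpandingRotation (p * p) p (1 / √p) := by
  let r : (ZMod p × ZMod p) × ZMod p → (ZMod p × ZMod p) × ZMod p :=
    fun x => ((x.2, x.2 * x.1.1 - x.1.2), x.1.1)
  suffices h : IsExpandingRotation r (1 / √p) by simpa using h.exists_fin
  have hp : (0 : ℝ) < p := by exact_mod_cast (Fact.out : p.Prime).pos
  refine ⟨fun x => by ext <;> simp [r, mul_comm], fun f hf => ?_⟩
  have hsq : ∑ x : ZMod p × ZMod p, (∑ e, f (e, e * x.1 - x.2)) ^ 2 ≤ p * ∑ x, f x ^ 2 := by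
    have hdiag (e : ZMod p) : ∑ x : ZMod p × ZMod p, f (e, e * x.1 - x.2) * f (e, e * x.1 - x.2)
        = p * ∑ y, f (e, y) ^ 2 := by
      rw [Fintype.sum_prod_type]
      have (a : ZMod p) : ∑ b, f (e, e * a - b) * f (e, e * a - b) = ∑ y, f (e, y) ^ 2 := by
        rw [← Equiv.sum_comp (Equiv.subLeft (e * a))]
        exact Finset.sum_congr rfl fun b _ => by simp [sq]
      simp [this]
    have hoff (e e' : ZMod p) (he : e ≠ e') :
        ∑ x : ZMod p × ZMod p, f (e, e * x.1 - x.2) * f (e', e' * x.1 - x.2)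
        = (∑ y, f (e, y)) * ∑ y, f (e', y) := by
      have h0 : e - e' ≠ 0 := sub_ne_zero.2 he
      rw [Fintype.sum_mul_sum, ← Fintype.sum_prod_type']
      refine Fintype.sum_bijective (fun x : ZMod p × ZMod p => (e * x.1 - x.2, e' * x.1 - x.2))
        ?_ _ _ fun x => rfl
      rw [← Finite.injective_iff_bijective]
      rintro ⟨a, b⟩ ⟨a', b'⟩ h
      simp only [Prod.mk.injEq] at h
      have : a = a' := mul_left_cancel₀ h0 (by linear_combination h.1 - h.2)
      subst this
      simpa using h.1
    set R : ZMod p → ℝ := fun e => ∑ y, f (e, y) with hR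
    have hR0 : ∑ e, R e = 0 := by rw [← hf, Fintype.sum_prod_type]
    have expand : ∑ x : ZMod p × ZMod p, (∑ e, f (e, e * x.1 - x.2)) ^ 2
        = ∑ e, ∑ e', ∑ x : ZMod p × ZMod p,
          f (e, e * x.1 - x.2) * f (e', e' * x.1 - x.2) := by
      simp only [sq, Fintype.sum_mul_sum]
      rw [Finset.sum_comm]
      exact Finset.sum_congr rfl fun e _ => Finset.sum_comm
    have hpt (e e' : ZMod p) : ∑ x : ZMod p × ZMod p,
          f (e, e * x.1 - x.2) * f (e', e' * x.1 - x.2)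
        = R e * R e' + if e = e' then p * ∑ y, f (e, y) ^ 2 - R e ^ 2 else 0 := by
      split_ifs with h
      · subst h; rw [hdiag]; ring
      · rw [hoff e e' h, add_zero]
    rw [expand]
    simp only [hpt, Finset.sum_add_distrib, ← Finset.mul_sum, hR0, Finset.sum_ite_eq,
      Finset.mem_univ, if_true, Finset.sum_sub_distrib, mul_zero, zero_add]
    rw [Fintype.sum_prod_type]
    linarith [Finset.sum_nonneg fun (i : ZMod p) (_ : i ∈ Finset.univ) => sq_nonneg (R i)]
  have hs : 0 ≤ ∑ x, f x ^ 2 := Finset.sum_nonneg fun i _ => sq_nonneg _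
  simp only [← Finset.mul_sum, r, ZMod.card]
  refine (abs_sum_mul_le f _ hs hs (Real.sqrt_nonneg p) le_rfl
    (by rwa [Real.sq_sqrt hp.le])).trans (le_of_eq ?_)
  have : (1 / √(p : ℝ)) * p = √p := by rw [one_div_mul_eq_div, Real.div_sqrt]
  rw [this]; ring

lemma existsExpandingRotation_iterate (p : ℕ) [Fact p.Prime] (k : ℕ) :
    ExistsExpandingRotation ((p * p) ^ k) (p * p) (k * (1 / √p + (1 / √p) ^ 2)) := by
  induction k with
  | zero => simpa using existsExpandingRotation_one (p * p)
  | succ k ih =>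
    have hp : p ≠ 0 := (Fact.out : p.Prime).ne_zero
    have := ih.zigzag (mul_ne_zero hp hp) (existsExpandingRotation_affinePlane p)
      (by positivity) (by positivity)
    rw [pow_succ]
    refine this.mono (le_of_eq ?_)
    push_cast
    ring

/-- Bounded-degree multigraph expanders of arbitrarily small normalized second eigenvalue. -/
lemma exists_expandingRotation_family {ε : ℝ} (hε : 0 < ε) :
    ∃ D : ℕ, 0 < D ∧ ∀ N : ℕ, ∃ n ≥ N, ExistsExpandingRotation n D ε := by
  wlog h2 : ε ≤ 1 / 2 generalizing ε
  · obtain ⟨D, hD, h⟩ := this (ε := 1 / 2) (by norm_num) le_rfl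
    refine ⟨D, hD, fun N => ?_⟩
    obtain ⟨n, hn, h'⟩ := h N
    exact ⟨n, hn, h'.mono (by linarith)⟩
  obtain ⟨p, hpN, hp⟩ := Nat.exists_infinite_primes (⌈(32 / ε) ^ 2⌉₊)
  have : Fact p.Prime := ⟨hp⟩
  have hpos : 0 < p := hp.pos
  have hp0 : (0 : ℝ) < p := by exact_mod_cast hp.pos
  have hroot : 32 / ε ≤ √p := Real.le_sqrt_of_sq_le (Nat.ceil_le.1 hpN)
  set μ : ℝ := 1 / √p with hμ
  have hμ0 : 0 ≤ μ := by positivity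
  have hμ1 : μ ≤ ε / 32 := by
    rw [hμ, div_le_iff₀ (by positivity)]
    rw [div_le_iff₀ hε] at hroot
    linarith
  have hH : ExistsExpandingRotation ((p * p) ^ 4) (p * p) (ε / 4) :=
    (existsExpandingRotation_iterate p 4).mono (by push_cast; nlinarith)
  have hfam (i : ℕ) :
      ExistsExpandingRotation (((p * p) ^ 4) ^ i) ((p * p) * (p * p)) ε := by
    induction i with
    | zero => simpa using (existsExpandingRotation_one _).mono hε.le
    | succ i ih =>
      have hsq := ih.square hε.le
      rw [show p * p * (p * p) * (p * p * (p * p)) = (p * p) ^ 4 by ring] at hsq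
      have := hsq.zigzag (by positivity) hH (by positivity) (by positivity)
      rw [pow_succ]
      exact this.mono (by nlinarith)
  refine ⟨(p * p) * (p * p), by positivity, fun N => ⟨_, ?_, hfam N⟩⟩
  have h1 : 1 < (p * p) ^ 4 := Nat.one_lt_pow (by norm_num) (Nat.one_lt_mul_iff.2
    ⟨hp.pos, hp.pos, Or.inl hp.one_lt⟩)
  exact (Nat.lt_pow_self h1).le

open Classical in
/-- The adjacency kernel of a graph. -/
noncomputable def SimpleGraph.adjKernel {V : Type} (G : SimpleGraph V) (v w : V) : ℝ :=
  if G.Adj v w then 1 else 0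

/-- `G` is `D`-regular and its adjacency quadratic form is at most `c` times the squared norm on
functions of sum zero. -/
def SimpleGraph.IsQuadraticExpander {V : Type} [Fintype V] (G : SimpleGraph V) (D : ℕ) (c : ℝ) :
    Prop :=
  (∀ v, ∑ w, G.adjKernel v w = D) ∧ ∀ f : V → ℝ, ∑ v, f v = 0 →
    |∑ v, ∑ w, G.adjKernel v w * (f v * f w)| ≤ c * ∑ v, f v ^ 2

section Heisenberg

variable {p : ℕ}

lemma exists_symmetric_finset_zmod {k : ℕ} (hk : 2 * k < p) :
    ∃ S : Finset (ZMod p), #S = 2 * k ∧ 0 ∉ S ∧ ∀ z ∈ S, -z ∈ S := by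
  let T := Finset.Icc 1 k ∪ Finset.Icc (p - k) (p - 1)
  have hT (t : ℕ) : t ∈ T ↔ (1 ≤ t ∧ t ≤ k) ∨ (p - k ≤ t ∧ t ≤ p - 1) := by simp [T]
  have hlt (t : ℕ) (ht : t ∈ T) : 0 < t ∧ t < p := by rw [hT] at ht; omega
  refine ⟨T.image (Nat.cast : ℕ → ZMod p), ?_, ?_, ?_⟩
  · rw [Finset.card_image_of_injOn, Finset.card_union_of_disjoint]
    · simp only [Nat.card_Icc]; omega
    · rw [Finset.disjoint_left]
      intro t
      simp only [Finset.mem_Icc]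
      omega
    · intro a ha b hb hab
      rw [ZMod.natCast_eq_natCast_iff'] at hab
      rwa [Nat.mod_eq_of_lt (hlt a ha).2, Nat.mod_eq_of_lt (hlt b hb).2] at hab
  · simp only [Finset.mem_image, not_exists, not_and]
    intro t ht h
    rw [ZMod.natCast_eq_zero_iff] at h
    exact absurd (Nat.le_of_dvd (hlt t ht).1 h) (not_le.2 (hlt t ht).2)
  · simp only [Finset.mem_image]
    rintro _ ⟨t, ht, rfl⟩
    refine ⟨p - t, ?_, ?_⟩
    · have := hlt t ht
      rw [hT] at ht ⊢
      omega
    · rw [Nat.cast_sub (hlt t ht).2.le]; simp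

/-- The central coordinate of `y⁻¹ x` in the Heisenberg group. -/
def heisenbergForm (x y : (ZMod p × ZMod p) × ZMod p) : ZMod p :=
  x.1.1 * y.1.2 - x.1.2 * y.1.1 + x.2 - y.2

lemma heisenbergForm_swap (x y : (ZMod p × ZMod p) × ZMod p) :
    heisenbergForm y x = -heisenbergForm x y := by
  simp only [heisenbergForm]; ring

lemma heisenbergForm_self (x : (ZMod p × ZMod p) × ZMod p) : heisenbergForm x x = 0 := by
  simp only [heisenbergForm]; ring

variable [Fact p.Prime]

lemma sum_heisenbergForm (φ : ZMod p → ℝ) (x : (ZMod p × ZMod p) × ZMod p) :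
    ∑ y, φ (heisenbergForm x y) = p ^ 2 * ∑ z, φ z := by
  rw [Fintype.sum_prod_type]
  have (β : ZMod p × ZMod p) : ∑ c, φ (heisenbergForm x (β, c)) = ∑ z, φ z :=
    Equiv.sum_comp (Equiv.subLeft (x.1.1 * β.2 - x.1.2 * β.1 + x.2)) φ
  simp [this, sq]

lemma sum_mul_eq_zero_of_injective {F : Type*} [Fintype F] {g : F → ℝ} (hg : ∑ z, g z = 0)
    {φ : F × F → F × F} (hφ : Function.Injective φ) : ∑ x, g (φ x).1 * g (φ x).2 = 0 := by
  rw [Function.Bijective.sum_comp (Finite.injective_iff_bijective.1 hφ)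
    (fun x : F × F => g x.1 * g x.2), Fintype.sum_prod_type, ← Fintype.sum_mul_sum, hg, zero_mul]

lemma sum_heisenbergForm_mul_eq_zero {g : ZMod p → ℝ} (hg : ∑ z, g z = 0)
    {y y' : (ZMod p × ZMod p) × ZMod p} (h : y.1 ≠ y'.1) :
    ∑ x, g (heisenbergForm x y) * g (heisenbergForm x y') = 0 := by
  have hcases : y.1.1 ≠ y'.1.1 ∨ y.1.2 ≠ y'.1.2 := by
    by_contra! hh
    exact h (Prod.ext hh.1 hh.2)
  rw [Fintype.sum_prod_type, Fintype.sum_prod_type]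
  rcases hcases with h1 | h1 <;> replace h1 := sub_ne_zero.2 h1
  · refine Finset.sum_eq_zero fun a _ => ?_
    rw [← Fintype.sum_prod_type' (f := fun t c => g (heisenbergForm ((a, t), c) y) *
      g (heisenbergForm ((a, t), c) y'))]
    refine sum_mul_eq_zero_of_injective hg (φ := fun x =>
      (heisenbergForm ((a, x.1), x.2) y, heisenbergForm ((a, x.1), x.2) y')) ?_
    rintro ⟨t, c⟩ ⟨t', c'⟩ h
    simp only [Prod.mk.injEq, heisenbergForm] at h
    have : t = t' := mul_left_cancel₀ h1 (by linear_combination h.2 - h.1)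
    subst this
    simpa using h.1
  · rw [Finset.sum_comm]
    refine Finset.sum_eq_zero fun a _ => ?_
    rw [← Fintype.sum_prod_type' (f := fun t c => g (heisenbergForm ((t, a), c) y) *
      g (heisenbergForm ((t, a), c) y'))]
    refine sum_mul_eq_zero_of_injective hg (φ := fun x =>
      (heisenbergForm ((x.1, a), x.2) y, heisenbergForm ((x.1, a), x.2) y')) ?_
    rintro ⟨t, c⟩ ⟨t', c'⟩ h
    simp only [Prod.mk.injEq, heisenbergForm] at h
    have : t = t' := mul_left_cancel₀ h1 (by linear_combination h.1 - h.2)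
    subst this
    simpa using h.1

lemma abs_sum_heisenbergForm_le {g : ZMod p → ℝ} (hg : ∑ z, g z = 0) (hg1 : ∀ z, |g z| ≤ 1)
    (a b : (ZMod p × ZMod p) × ZMod p → ℝ) :
    |∑ x, ∑ y, g (heisenbergForm x y) * (a x * b y)|
      ≤ p ^ 2 * (∑ x, a x ^ 2 + ∑ x, b x ^ 2) / 2 := by
  have hcorr (y y' : (ZMod p × ZMod p) × ZMod p) :
      |∑ x, g (heisenbergForm x y) * g (heisenbergForm x y')| ≤ p ^ 3 := by
    refine (Finset.abs_sum_le_sum_abs _ _).trans ?_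
    calc _ ≤ ∑ _x : (ZMod p × ZMod p) × ZMod p, (1 : ℝ) := by
          refine Finset.sum_le_sum fun x _ => ?_
          rw [abs_mul]
          exact mul_le_one₀ (hg1 _) (abs_nonneg _) (hg1 _)
      _ = p ^ 3 := by simp; ring
  have hpt (y y' : (ZMod p × ZMod p) × ZMod p) :
      b y * b y' * ∑ x, g (heisenbergForm x y) * g (heisenbergForm x y')
        ≤ if y.1 = y'.1 then (p : ℝ) ^ 3 * ((b y ^ 2 + b y' ^ 2) / 2) else 0 := by
    split_ifs with h
    · refine (le_abs_self _).trans ?_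
      rw [abs_mul, mul_comm]
      refine mul_le_mul (hcorr y y') ?_ (abs_nonneg _) (by positivity)
      rw [abs_mul, ← sq_abs (b y), ← sq_abs (b y')]
      nlinarith [sq_nonneg (|b y| - |b y'|)]
    · rw [sum_heisenbergForm_mul_eq_zero hg h, mul_zero]
  have hdiag : ∑ y : (ZMod p × ZMod p) × ZMod p, ∑ y' : (ZMod p × ZMod p) × ZMod p,
      (if y.1 = y'.1 then (p : ℝ) ^ 3 * ((b y ^ 2 + b y' ^ 2) / 2) else 0)
      = p ^ 4 * ∑ y, b y ^ 2 := by
    have (y : (ZMod p × ZMod p) × ZMod p) : ∑ y' : (ZMod p × ZMod p) × ZMod p,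
        (if y.1 = y'.1 then (p : ℝ) ^ 3 * ((b y ^ 2 + b y' ^ 2) / 2) else 0)
        = p ^ 3 * ((p * b y ^ 2 + ∑ c, b (y.1, c) ^ 2) / 2) := by
      rw [Fintype.sum_prod_type, Finset.sum_eq_single y.1]
      · simp [← Finset.mul_sum, ← Finset.sum_div, Finset.sum_add_distrib]
      · intro β _ hβ
        simp [hβ.symm]
      · simp
    simp only [this]
    have hprod (φ : (ZMod p × ZMod p) × ZMod p → ℝ) : ∑ y, φ y = ∑ β, ∑ c, φ (β, c) :=
      Fintype.sum_prod_type φ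
    rw [hprod, hprod, Finset.mul_sum]
    refine Finset.sum_congr rfl fun β _ => ?_
    rw [← Finset.mul_sum, ← Finset.sum_div, Finset.sum_add_distrib, ← Finset.mul_sum]
    simp only [Finset.sum_const, Finset.card_univ, ZMod.card, nsmul_eq_mul]
    ring
  have hsq : ∑ x, (∑ y, g (heisenbergForm x y) * b y) ^ 2
      ≤ ((p : ℝ) ^ 2) ^ 2 * ∑ x, b x ^ 2 := by
    have expand : ∑ x, (∑ y, g (heisenbergForm x y) * b y) ^ 2
        = ∑ y, ∑ y', b y * b y' * ∑ x, g (heisenbergForm x y) * g (heisenbergForm x y') := by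
      simp only [sq, Fintype.sum_mul_sum]
      rw [Finset.sum_comm]
      refine Finset.sum_congr rfl fun y _ => ?_
      rw [Finset.sum_comm]
      refine Finset.sum_congr rfl fun y' _ => ?_
      rw [Finset.mul_sum]
      exact Finset.sum_congr rfl fun x _ => by ring
    rw [expand]
    refine (Finset.sum_le_sum fun y _ => Finset.sum_le_sum fun y' _ => hpt y y').trans ?_
    rw [hdiag]
    exact le_of_eq (by ring)
  have := abs_sum_mul_le a _ (Finset.sum_nonneg fun i _ => sq_nonneg _)
    (Finset.sum_nonneg fun i _ => sq_nonneg _) (by positivity) le_rfl hsq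
  convert this using 2
  refine Finset.sum_congr rfl fun x _ => ?_
  rw [Finset.mul_sum]
  exact Finset.sum_congr rfl fun y _ => by ring

end Heisenberg

/-- Replacing vertices of a multigraph by copies of a Heisenberg group turns it into a simple
graph, at a small cost in the eigenvalues. -/
lemma exists_isQuadraticExpander_of_rotation {V U : Type} [Fintype V] [Fintype U]
    {r : V × U → V × U} {c : ℝ} (h : IsExpandingRotation r c) (hc : 0 ≤ c)
    {p s : ℕ} [Fact p.Prime] (hp : 2 * (Fintype.card U * s) < p) :
    ∃ G : SimpleGraph (V × ((ZMod p × ZMod p) × ZMod p)),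
      G.IsQuadraticExpander (2 * s * Fintype.card U * p ^ 2)
        ((2 * s * c + 1) * Fintype.card U * p ^ 2) := by
  classical
  have hp0 : (0 : ℝ) < p := by exact_mod_cast (Fact.out : p.Prime).pos
  let m (v w : V) : ℕ := #{u | (r (v, u)).1 = w}
  have hm_sum (φ : V → ℝ) (v : V) : ∑ w, (m v w : ℝ) * φ w = ∑ u, φ (r (v, u)).1 := by
    simp only [m, Finset.card_filter, Nat.cast_sum, Finset.sum_mul]
    rw [Finset.sum_comm]
    simp
  have hm_one (v : V) : ∑ w, (m v w : ℝ) = Fintype.card U := by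
    simpa using hm_sum (fun _ => 1) v
  have hm_symm (v w : V) : m v w = m w v := by
    refine Finset.card_nbij' (fun u => (r (v, u)).2) (fun u => (r (w, u)).2) ?_ ?_ ?_ ?_
    all_goals
      intro u hu
      simp only [Finset.coe_filter, Finset.mem_univ, true_and,
        Set.mem_ofPred_eq] at hu ⊢
      subst hu
      simp [h.1 _]
  have hm_le (v w : V) : m v w ≤ Fintype.card U := Finset.card_le_univ _
  have hS (a : ℕ) : ∃ S : Finset (ZMod p),
      (a ≤ Fintype.card U → #S = 2 * (a * s)) ∧ 0 ∉ S ∧ ∀ z ∈ S, -z ∈ S := by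
    by_cases ha : a ≤ Fintype.card U
    · obtain ⟨S, h1, h2⟩ := exists_symmetric_finset_zmod (p := p) (k := a * s)
        (lt_of_le_of_lt (by gcongr) hp)
      exact ⟨S, fun _ => h1, h2⟩
    · exact ⟨∅, fun h => absurd h ha, by simp, by simp⟩
  choose S hcard hzero hneg using hS
  let G : SimpleGraph (V × ((ZMod p × ZMod p) × ZMod p)) :=
    { Adj := fun x y => heisenbergForm x.2 y.2 ∈ S (m x.1 y.1)
      symm := ⟨fun x y hxy => by
        rw [heisenbergForm_swap, hm_symm]
        exact hneg _ _ hxy⟩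
      loopless := ⟨fun x hx => by
        rw [heisenbergForm_self] at hx
        exact hzero _ hx⟩ }
  let i (a : ℕ) (z : ZMod p) : ℝ := if z ∈ S a then 1 else 0
  have hi_sum (a : ℕ) (ha : a ≤ Fintype.card U) : ∑ z, i a z = 2 * (a * s) := by
    simp only [i, Finset.sum_ite_mem, Finset.univ_inter, Finset.sum_const, hcard a ha]
    simp
  have hker (x y) : G.adjKernel x y = i (m x.1 y.1) (heisenbergForm x.2 y.2) := by
    simp only [SimpleGraph.adjKernel, i, G]
    congr
  refine ⟨G, fun x => ?_, fun f hf => ?_⟩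
  · simp only [hker]
    rw [Fintype.sum_prod_type]
    simp only [sum_heisenbergForm, hi_sum _ (hm_le _ _)]
    rw [← Finset.mul_sum, ← Finset.mul_sum, ← Finset.sum_mul, hm_one]
    push_cast
    ring
  let g (a : ℕ) (z : ZMod p) : ℝ := i a z - 2 * (a * s) / p
  have hg_sum (a : ℕ) (ha : a ≤ Fintype.card U) : ∑ z, g a z = 0 := by
    simp only [g, Finset.sum_sub_distrib, hi_sum a ha, Finset.sum_const, Finset.card_univ,
      ZMod.card, nsmul_eq_mul]
    field_simp
    ring
  have hg_le (a : ℕ) (ha : a ≤ Fintype.card U) (z : ZMod p) : |g a z| ≤ 1 := by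
    have h0 : (0 : ℝ) ≤ 2 * (a * s) / p := by positivity
    have h1 : 2 * (a * s : ℝ) / p ≤ 1 := by
      rw [div_le_one hp0]
      have : 2 * (a * s) ≤ p := le_trans (by gcongr) hp.le
      exact_mod_cast this
    simp only [g, i, abs_le]
    split_ifs <;> constructor <;> linarith
  have hg_zero (z : ZMod p) : g 0 z = 0 := by
    have : S 0 = ∅ := by
      have := hcard 0 (Nat.zero_le _)
      simpa using this
    simp [g, i, this]
  set N : V → ℝ := fun v => ∑ x, f (v, x) ^ 2 with hN
  set H : V → ℝ := fun v => ∑ x, f (v, x) with hH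
  have hN0 (v : V) : 0 ≤ N v := Finset.sum_nonneg fun i _ => sq_nonneg _
  have hfN : ∑ x, f x ^ 2 = ∑ v, N v := by rw [Fintype.sum_prod_type]
  have hH0 : ∑ v, H v = 0 := by rw [← hf, Fintype.sum_prod_type]
  have hHN (v : V) : H v ^ 2 ≤ p ^ 3 * N v := by
    have := sq_sum_le_card_mul_sum_sq (s := Finset.univ) (f := fun x => f (v, x))
    refine this.trans (le_of_eq ?_)
    simp only [Finset.card_univ, Fintype.card_prod, ZMod.card, hN]
    push_cast
    ring
  have hmain : |2 * s / p * ∑ v, ∑ w, (m v w : ℝ) * (H v * H w)|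
      ≤ 2 * s * c * Fintype.card U * p ^ 2 * ∑ v, N v := by
    have e : ∑ v, ∑ w, (m v w : ℝ) * (H v * H w) = ∑ v, ∑ u, H v * H (r (v, u)).1 := by
      refine Finset.sum_congr rfl fun v _ => ?_
      rw [← Finset.mul_sum, ← hm_sum, Finset.mul_sum]
      exact Finset.sum_congr rfl fun w _ => by ring
    rw [e, abs_mul, abs_of_nonneg (by positivity)]
    calc _ ≤ 2 * s / p * (c * Fintype.card U * ∑ v, p ^ 3 * N v) := by
          gcongr
          refine (h.2 H hH0).trans ?_
          gcongr
          exact hHN _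
      _ = _ := by
          rw [← Finset.mul_sum]
          field_simp
  have hterm (v w : V) : |∑ x, ∑ y, g (m v w) (heisenbergForm x y) * (f (v, x) * f (w, y))|
      ≤ m v w * (p ^ 2 * (N v + N w) / 2) := by
    rcases Nat.eq_zero_or_pos (m v w) with h0 | h0
    · simp [h0, hg_zero]
    · refine (abs_sum_heisenbergForm_le (hg_sum _ (hm_le v w)) (hg_le _ (hm_le v w)) _ _).trans ?_
      refine le_mul_of_one_le_left ?_ (by exact_mod_cast h0)
      have := hN0 v
      have := hN0 w
      positivity
  have herr : |∑ v, ∑ w, ∑ x, ∑ y, g (m v w) (heisenbergForm x y) * (f (v, x) * f (w, y))|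
      ≤ Fintype.card U * p ^ 2 * ∑ v, N v := by
    calc _ ≤ ∑ v, ∑ w, (m v w : ℝ) * (p ^ 2 * (N v + N w) / 2) :=
          (Finset.abs_sum_le_sum_abs _ _).trans <| Finset.sum_le_sum fun v _ =>
            (Finset.abs_sum_le_sum_abs _ _).trans <| Finset.sum_le_sum fun w _ => hterm v w
      _ = p ^ 2 / 2 * (∑ v, ∑ w, (m v w : ℝ) * N v + ∑ v, ∑ w, (m v w : ℝ) * N w) := by
          simp only [Finset.mul_sum, ← Finset.sum_add_distrib]
          exact Finset.sum_congr rfl fun v _ => Finset.sum_congr rfl fun w _ => by ring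
      _ = p ^ 2 / 2 * (∑ v, ∑ w, (m v w : ℝ) * N v + ∑ v, ∑ w, (m v w : ℝ) * N v) := by
          rw [Finset.sum_comm (f := fun v w => (m v w : ℝ) * N w)]
          simp only [hm_symm]
      _ = _ := by
          simp only [← Finset.sum_mul, hm_one, ← Finset.mul_sum]
          ring
  have hsplit : ∑ x, ∑ y, G.adjKernel x y * (f x * f y)
      = 2 * s / p * ∑ v, ∑ w, (m v w : ℝ) * (H v * H w)
        + ∑ v, ∑ w, ∑ x, ∑ y, g (m v w) (heisenbergForm x y) * (f (v, x) * f (w, y)) := by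
    have hprod (φ : V × ((ZMod p × ZMod p) × ZMod p) → ℝ) : ∑ x, φ x = ∑ v, ∑ x, φ (v, x) :=
      Fintype.sum_prod_type φ
    simp only [hker, hprod]
    rw [Finset.mul_sum, ← Finset.sum_add_distrib]
    refine Finset.sum_congr rfl fun v _ => ?_
    rw [Finset.sum_comm, Finset.mul_sum, ← Finset.sum_add_distrib]
    refine Finset.sum_congr rfl fun w _ => ?_
    simp only [hH, Fintype.sum_mul_sum]
    simp only [Finset.mul_sum, ← Finset.sum_add_distrib, g]
    exact Finset.sum_congr rfl fun x _ => Finset.sum_congr rfl fun y _ => by ring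
  rw [hsplit, hfN]
  refine (abs_add_le _ _).trans ((add_le_add hmain herr).trans (le_of_eq ?_))
  ring

section BlowUp

variable {Y T : Type}

/-- Replace every vertex of `H` by a copy of `R`, and every edge of `H` by a complete bipartite
graph. -/
def SimpleGraph.blowUp (H : SimpleGraph Y) (R : SimpleGraph T) : SimpleGraph (Y × T) where
  Adj x y := H.Adj x.1 y.1 ∨ x.1 = y.1 ∧ R.Adj x.2 y.2
  symm := ⟨fun _ _ h => h.imp (fun h => h.symm) fun h => ⟨h.1.symm, h.2.symm⟩⟩
  loopless := ⟨fun x h => h.elim (H.loopless.irrefl x.1) fun h => R.loopless.irrefl x.2 h.2⟩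

lemma SimpleGraph.adjKernel_of_adj {G : SimpleGraph Y} {x y : Y} (h : G.Adj x y) :
    G.adjKernel x y = 1 := if_pos h

lemma SimpleGraph.adjKernel_of_not_adj {G : SimpleGraph Y} {x y : Y} (h : ¬G.Adj x y) :
    G.adjKernel x y = 0 := if_neg h

lemma SimpleGraph.adjKernel_congr {G : SimpleGraph Y} {G' : SimpleGraph T} {x y : Y} {x' y' : T}
    (h : G.Adj x y ↔ G'.Adj x' y') : G.adjKernel x y = G'.adjKernel x' y' := by
  by_cases hx : G.Adj x y
  · rw [adjKernel_of_adj hx, adjKernel_of_adj (h.1 hx)]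
  · rw [adjKernel_of_not_adj hx, adjKernel_of_not_adj (mt h.2 hx)]

lemma SimpleGraph.adjKernel_comm (H : SimpleGraph Y) (x y : Y) :
    H.adjKernel x y = H.adjKernel y x :=
  adjKernel_congr (H.adj_comm x y)

lemma SimpleGraph.adjKernel_nonneg (H : SimpleGraph Y) (x y : Y) : 0 ≤ H.adjKernel x y := by
  unfold SimpleGraph.adjKernel
  split_ifs <;> simp

lemma SimpleGraph.adjKernel_blowUp [DecidableEq Y] (H : SimpleGraph Y) (R : SimpleGraph T)
    (x y : Y × T) : (H.blowUp R).adjKernel x y =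
      H.adjKernel x.1 y.1 + if x.1 = y.1 then R.adjKernel x.2 y.2 else 0 := by
  by_cases h : x.1 = y.1
  · rw [if_pos h, adjKernel_of_not_adj (h ▸ H.loopless.irrefl x.1 : ¬H.Adj x.1 y.1), zero_add]
    exact adjKernel_congr (by simp [blowUp, h])
  · rw [if_neg h, add_zero]
    exact adjKernel_congr (by simp [blowUp, h])

variable [Fintype Y] [Fintype T]

lemma SimpleGraph.abs_quadraticForm_le_of_regular {R : SimpleGraph T} {r : ℕ}
    (hR : ∀ v, ∑ w, R.adjKernel v w = r) (f : T → ℝ) :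
    |∑ v, ∑ w, R.adjKernel v w * (f v * f w)| ≤ r * ∑ v, f v ^ 2 := by
  calc _ ≤ ∑ v, ∑ w, R.adjKernel v w * ((f v ^ 2 + f w ^ 2) / 2) := by
        refine (Finset.abs_sum_le_sum_abs _ _).trans <| Finset.sum_le_sum fun v _ =>
          (Finset.abs_sum_le_sum_abs _ _).trans <| Finset.sum_le_sum fun w _ => ?_
        rw [abs_mul, abs_of_nonneg (R.adjKernel_nonneg v w)]
        refine mul_le_mul_of_nonneg_left ?_ (R.adjKernel_nonneg v w)
        rw [abs_le]
        constructor <;> nlinarith [sq_nonneg (f v + f w), sq_nonneg (f v - f w)]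
    _ = (∑ v, ∑ w, R.adjKernel v w * f v ^ 2 + ∑ v, ∑ w, R.adjKernel v w * f w ^ 2) / 2 := by
        simp only [← Finset.sum_add_distrib, Finset.sum_div]
        exact Finset.sum_congr rfl fun v _ => Finset.sum_congr rfl fun w _ => by ring
    _ = (∑ v, ∑ w, R.adjKernel v w * f v ^ 2 + ∑ v, ∑ w, R.adjKernel v w * f v ^ 2) / 2 := by
        rw [Finset.sum_comm (f := fun v w => R.adjKernel v w * f w ^ 2)]
        simp only [R.adjKernel_comm]
    _ = r * ∑ v, f v ^ 2 := by
        simp only [← Finset.sum_mul, hR, ← Finset.mul_sum]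
        ring

lemma SimpleGraph.IsQuadraticExpander.blowUp {H : SimpleGraph Y} {R : SimpleGraph T} {D r : ℕ}
    {c : ℝ} (hH : H.IsQuadraticExpander D c) (hc : 0 ≤ c) (hR : ∀ v, ∑ w, R.adjKernel v w = r) :
    (H.blowUp R).IsQuadraticExpander (D * Fintype.card T + r) (c * Fintype.card T + r) := by
  classical
  have hprod (φ : Y × T → ℝ) : ∑ x, φ x = ∑ y, ∑ t, φ (y, t) := Fintype.sum_prod_type φ
  refine ⟨fun x => ?_, fun f hf => ?_⟩
  · simp only [SimpleGraph.adjKernel_blowUp, Finset.sum_add_distrib, hprod, Finset.sum_const,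
      Finset.card_univ, nsmul_eq_mul, ← Finset.mul_sum, hH.1]
    rw [Finset.sum_eq_single x.1 (fun y _ hy => by simp [hy.symm]) (by simp)]
    simp only [if_true, hR]
    push_cast
    ring
  · set F : Y → ℝ := fun y => ∑ t, f (y, t) with hF
    have hF0 : ∑ y, F y = 0 := by rw [← hf, hprod]
    have hFn : ∑ y, F y ^ 2 ≤ Fintype.card T * ∑ x, f x ^ 2 := by
      rw [hprod, Finset.mul_sum]
      exact Finset.sum_le_sum fun y _ => sq_sum_le_card_mul_sum_sq
    have hsplit : ∑ x, ∑ y, (H.blowUp R).adjKernel x y * (f x * f y)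
        = ∑ y, ∑ z, H.adjKernel y z * (F y * F z)
          + ∑ y, ∑ s, ∑ t, R.adjKernel s t * (f (y, s) * f (y, t)) := by
      simp only [SimpleGraph.adjKernel_blowUp, hprod]
      rw [← Finset.sum_add_distrib]
      refine Finset.sum_congr rfl fun y _ => ?_
      simp only [hF, Fintype.sum_mul_sum]
      simp only [Finset.mul_sum]
      rw [Finset.sum_comm (γ := Y), ← Finset.sum_add_distrib]
      refine Finset.sum_congr rfl fun s _ => ?_
      simp only [add_mul, Finset.sum_add_distrib]
      congr 1
      rw [Finset.sum_eq_single y (fun z _ hz => by simp [hz.symm]) (by simp)]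
      simp
    have h1 := (hH.2 F hF0).trans (mul_le_mul_of_nonneg_left hFn hc)
    have h2 : |∑ y, ∑ s, ∑ t, R.adjKernel s t * (f (y, s) * f (y, t))| ≤ r * ∑ x, f x ^ 2 := by
      rw [hprod, Finset.mul_sum]
      exact (Finset.abs_sum_le_sum_abs _ _).trans <| Finset.sum_le_sum fun y _ =>
        SimpleGraph.abs_quadraticForm_le_of_regular hR fun t => f (y, t)
    rw [hsplit]
    refine (abs_add_le _ _).trans ((add_le_add h1 h2).trans (le_of_eq ?_))
    ring

/-- An induced path either stays inside one part of a blow-up or meets every part at most twice. -/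
lemma SimpleGraph.inducedPath_blowUp_le {H : SimpleGraph Y} {R : SimpleGraph T}
    {k : ℕ} (h : HasInducedPath (H.blowUp R) k) :
    k ≤ max (Fintype.card T) (2 * Fintype.card Y) := by
  classical
  obtain ⟨f, hf, hadj⟩ := h
  by_cases hone : ∃ y, ∀ i, (f i).1 = y
  · obtain ⟨y, hy⟩ := hone
    refine le_max_of_le_left ?_
    simpa using Fintype.card_le_of_injective (fun i => (f i).2)
      fun i j hij => hf (Prod.ext ((hy i).trans (hy j).symm) hij)
  · refine le_max_of_le_right ?_
    have hfib (y : Y) : #{i | (f i).1 = y} ≤ 2 := by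
      rcases Finset.eq_empty_or_nonempty ({i | (f i).1 = y} : Finset (Fin k)) with he | ⟨i₀, hi₀⟩
      · rw [he]; simp
      have hi₀' : (f i₀).1 = y := by simpa using hi₀
      obtain ⟨a, b, ha, hb, hab⟩ : ∃ a b : Fin k, (f a).1 = y ∧ (f b).1 ≠ y ∧
          (H.blowUp R).Adj (f a) (f b) := by
        by_contra! hno
        refine hone ⟨y, ?_⟩
        have hstep (i j : Fin k) (hij : (i : ℕ) + 1 = j) : (f i).1 = y ↔ (f j).1 = y := by
          constructor
          · intro hi
            by_contra hj
            exact hno i j hi hj ((hadj i j).2 (Or.inl hij))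
          · intro hj
            by_contra hi
            exact hno j i hj hi ((hadj j i).2 (Or.inr hij))
        have hzero (n : ℕ) (hn : n < k) : (f ⟨n, hn⟩).1 = y ↔ (f ⟨0, by omega⟩).1 = y := by
          induction n with
          | zero => rfl
          | succ n ih => rw [← hstep ⟨n, by omega⟩ ⟨n + 1, hn⟩ rfl, ih]
        intro i
        rw [hzero i i.2, ← hzero i₀ i₀.2]
        exact hi₀'
      have hHab : H.Adj y (f b).1 := by
        rcases hab with h1 | h1
        · rwa [ha] at h1
        · exact absurd (h1.1.symm.trans ha) hb
      calc #{i | (f i).1 = y} ≤ #({(b : ℕ) - 1, (b : ℕ) + 1} : Finset ℕ) := by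
            refine Finset.card_le_card_of_injOn (fun i => (i : ℕ)) ?_ Fin.val_injective.injOn
            intro i hi
            have hi' : (f i).1 = y := by simpa using hi
            have : (H.blowUp R).Adj (f i) (f b) := Or.inl (by rwa [hi'])
            rw [hadj] at this
            simp only [Finset.coe_insert, Finset.coe_singleton, Set.mem_insert_iff,
              Set.mem_singleton_iff]
            omega
        _ ≤ 2 := Finset.card_le_two
    calc k = #(Finset.univ : Finset (Fin k)) := by simp
      _ ≤ 2 * #(Finset.univ : Finset Y) :=
          Finset.card_le_mul_card_image_of_maps_to (f := fun i => (f i).1)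
            (fun _ _ => Finset.mem_univ _) 2 fun y _ => hfib y
      _ = _ := by simp

end BlowUp

/-- A regular bipartite graph of degree `r` on `2 * s` vertices. -/
def bipartiteSumGraph (s r : ℕ) : SimpleGraph (Bool × ZMod s) where
  Adj x y := x.1 ≠ y.1 ∧ (x.2 + y.2).val < r
  symm := ⟨fun _ _ h => ⟨h.1.symm, by rw [add_comm]; exact h.2⟩⟩
  loopless := ⟨fun _ h => h.1 rfl⟩

lemma sum_adjKernel_bipartiteSumGraph {s r : ℕ} [NeZero s] (hr : r ≤ s) (x : Bool × ZMod s) :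
    ∑ y, (bipartiteSumGraph s r).adjKernel x y = r := by
  classical
  have hprod (φ : Bool × ZMod s → ℝ) : ∑ y, φ y = ∑ b, ∑ t, φ (b, t) := Fintype.sum_prod_type φ
  have hcount : ∑ t : ZMod s, (if (x.2 + t).val < r then (1 : ℝ) else 0) = r := by
    refine (Equiv.sum_comp (Equiv.addLeft x.2)
      (fun t : ZMod s => if t.val < r then (1 : ℝ) else 0)).trans ?_
    rw [Finset.sum_boole]
    congr 1
    calc #{t : ZMod s | t.val < r} = #(Finset.range r) := by
          refine Finset.card_nbij' ZMod.val (fun n => (n : ZMod s)) ?_ ?_ ?_ ?_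
          · intro t ht
            simpa using ht
          · intro n hn
            have hn : n < r := by simpa using hn
            simp [ZMod.val_natCast, Nat.mod_eq_of_lt (hn.trans_le hr), hn]
          · intro t _
            simp
          · intro n hn
            have hn : n < r := by simpa using hn
            simp [ZMod.val_natCast, Nat.mod_eq_of_lt (hn.trans_le hr)]
      _ = r := Finset.card_range r
  rw [hprod, Fintype.sum_bool]
  obtain ⟨b, t⟩ := x
  cases b <;> simpa [SimpleGraph.adjKernel, bipartiteSumGraph] using hcount

section Transfer

lemma SimpleGraph.IsQuadraticExpander.comap {V W : Type} [Fintype V] [Fintype W]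
    {G : SimpleGraph V} {D : ℕ} {c : ℝ} (h : G.IsQuadraticExpander D c) (e : W ≃ V) :
    (G.comap e).IsQuadraticExpander D c := by
  have hker (x y) : (G.comap e).adjKernel x y = G.adjKernel (e x) (e y) :=
    SimpleGraph.adjKernel_congr SimpleGraph.comap_adj
  refine ⟨fun x => ?_, fun f hf => ?_⟩
  · simp only [hker]
    rw [Equiv.sum_comp e (fun y => G.adjKernel (e x) y), h.1]
  · have := h.2 (fun v => f (e.symm v)) (by rw [Equiv.sum_comp e.symm f, hf])
    rw [← Equiv.sum_comp e, ← Equiv.sum_comp e (fun v => f (e.symm v) ^ 2)] at this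
    simp only [← Equiv.sum_comp e (fun w => G.adjKernel _ w * _), Equiv.symm_apply_apply] at this
    simpa only [hker] using this

lemma HasInducedPath.of_comap {V W : Type*} {G : SimpleGraph V} {e : W ≃ V} {k : ℕ}
    (h : HasInducedPath (G.comap e) k) : HasInducedPath G k :=
  let ⟨f, hf, hadj⟩ := h
  ⟨fun i => e (f i), e.injective.comp hf, hadj⟩

open Matrix in
lemma SimpleGraph.IsQuadraticExpander.isNDLGraph {n D : ℕ} {c : ℝ} {G : SimpleGraph (Fin n)}
    (h : G.IsQuadraticExpander D c) (hn : 0 < n) : IsNDLGraph n D c G := by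
  let := Classical.decRel G.Adj
  have hA (v w : Fin n) : G.adjMatrix ℝ v w = G.adjKernel v w := by
    simp only [SimpleGraph.adjMatrix_apply, SimpleGraph.adjKernel]
  have hone : G.adjMatrix ℝ *ᵥ (fun _ => 1) = fun _ => (D : ℝ) := by
    ext v
    simp only [mulVec, dotProduct, mul_one, hA, h.1]
  refine ⟨fun v => ?_, ?_⟩
  · have := congrFun hone v
    rw [show (fun _ : Fin n => (1 : ℝ)) = Function.const _ 1 from rfl,
      SimpleGraph.adjMatrix_mulVec_const_apply, mul_one] at this
    exact_mod_cast this
  · set A := G.adjMatrix ℝ with hAdef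
    have hH : A.IsHermitian := G.adjHermitian
    set b : Fin n → Fin n → ℝ := fun i => ⇑(hH.eigenvectorBasis i) with hb
    set μ := hH.eigenvalues with hμ
    have hmul (i) : A *ᵥ b i = μ i • b i := hH.mulVec_eigenvectorBasis i
    have hsymm (x y : Fin n → ℝ) : x ⬝ᵥ A *ᵥ y = (A *ᵥ x) ⬝ᵥ y := by
      rw [dotProduct_mulVec, ← mulVec_transpose, G.transpose_adjMatrix]
    have hinner (i j) : b i ⬝ᵥ b j = if i = j then 1 else 0 := by
      have := orthonormal_iff_ite.1 hH.eigenvectorBasis.orthonormal j i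
      rw [EuclideanSpace.inner_eq_star_dotProduct] at this
      simpa [eq_comm] using this
    have hquad (x : Fin n → ℝ) (hx : ∑ v, x v = 0) : |x ⬝ᵥ A *ᵥ x| ≤ c * (x ⬝ᵥ x) := by
      have := h.2 x hx
      convert this using 2
      · simp only [dotProduct, mulVec, Finset.mul_sum, hA]
        exact Finset.sum_congr rfl fun v _ => Finset.sum_congr rfl fun w _ => by ring
      · simp only [dotProduct, sq]
    let σ : Fin n → ℝ := fun i => ∑ v, b i v
    have hσ (i) (hi : σ i ≠ 0) : μ i = D := by
      have := hsymm (b i) (fun _ => 1)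
      rw [hone, hmul] at this
      simp only [dotProduct, Pi.smul_apply, smul_eq_mul, mul_one, ← Finset.sum_mul,
        ← Finset.mul_sum] at this
      exact mul_right_cancel₀ hi (this.symm.trans (mul_comm _ _))
    obtain ⟨i₀, hi₀⟩ : ∃ i, σ i ≠ 0 := by
      by_contra! hall
      have hz : WithLp.toLp 2 (fun _ : Fin n => (1 : ℝ)) = 0 := by
        refine InnerProductSpace.ext_inner_left_basis hH.eigenvectorBasis.toBasis fun i => ?_
        rw [inner_zero_right, OrthonormalBasis.coe_toBasis,
          EuclideanSpace.inner_eq_star_dotProduct]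
        simpa [dotProduct, σ, b] using hall i
      have := congrFun (congrArg WithLp.ofLp hz) ⟨0, hn⟩
      simp at this
    refine ⟨i₀, hσ i₀ hi₀, fun j hj => ?_⟩
    by_cases hj0 : σ j = 0
    · have := hquad (b j) hj0
      rw [hmul, dotProduct_smul, hinner] at this
      simpa using this
    · have hx : ∑ v, (σ j • b i₀ - σ i₀ • b j) v = 0 := by
        simp only [Pi.sub_apply, Pi.smul_apply, smul_eq_mul, Finset.sum_sub_distrib,
          ← Finset.mul_sum]
        simp only [σ]
        ring
      have := hquad _ hx
      rw [mulVec_sub, mulVec_smul, mulVec_smul, hmul, hmul, hσ i₀ hi₀, hσ j hj0] at this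
      have hne : i₀ ≠ j := hj.symm
      simp only [sub_dotProduct, dotProduct_sub, smul_dotProduct, dotProduct_smul, hinner,
        if_true, hne, hj, if_false, smul_eq_mul, mul_one, mul_zero, sub_zero, zero_sub]
        at this
      have hpos : 0 < σ j * σ j + σ i₀ * σ i₀ :=
        add_pos (mul_self_pos.2 hj0) (mul_self_pos.2 hi₀)
      change |μ j| ≤ c
      rw [hσ j hj0, abs_of_nonneg (Nat.cast_nonneg D)]
      have h2 := (le_abs_self _).trans this
      refine le_of_mul_le_mul_right ?_ hpos
      linarith

end Transfer

/-- Bounded-degree simple graph expanders of arbitrarily small normalized second eigenvalue. -/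
lemma exists_isQuadraticExpander_family {ε : ℝ} (hε : 0 < ε) :
    ∃ D : ℕ, 0 < D ∧ ∀ N : ℕ, ∃ (Y : Type) (_ : Fintype Y) (H : SimpleGraph Y),
      N ≤ Fintype.card Y ∧ H.IsQuadraticExpander D (ε * D) := by
  obtain ⟨D, hD, hfam⟩ := exists_expandingRotation_family (half_pos hε)
  obtain ⟨s, hs⟩ := exists_nat_gt (1 / ε)
  have hs0 : (0 : ℝ) < s := lt_trans (by positivity) hs
  have hs1 : 0 < s := by exact_mod_cast hs0
  obtain ⟨p, hpN, hp⟩ := Nat.exists_infinite_primes (2 * (D * s) + 1)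
  have : Fact p.Prime := ⟨hp⟩
  have hp0 := hp.pos
  refine ⟨2 * s * D * p ^ 2, by positivity, fun N => ?_⟩
  obtain ⟨n, hn, r, hr⟩ := hfam N
  obtain ⟨G, hG⟩ := exists_isQuadraticExpander_of_rotation hr (half_pos hε).le (p := p) (s := s)
    (by rw [Fintype.card_fin]; omega)
  rw [Fintype.card_fin] at hG
  refine ⟨_, inferInstance, G, ?_, hG.1, fun f hf => (hG.2 f hf).trans ?_⟩
  · rw [Fintype.card_prod, Fintype.card_fin]
    exact hn.trans (Nat.le_mul_of_pos_right n Fintype.card_pos)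
  · refine mul_le_mul_of_nonneg_right ?_ (Finset.sum_nonneg fun i _ => sq_nonneg _)
    have h1 : 1 ≤ s * ε := by
      rw [div_lt_iff₀ hε] at hs
      exact hs.le
    push_cast
    calc (2 * s * (ε / 2) + 1) * D * (p : ℝ) ^ 2 ≤ (2 * (s * ε)) * D * (p : ℝ) ^ 2 := by
          gcongr
          linarith
      _ = _ := by ring

/-- For every `δ > 0` there is `C = C(δ) > 0` such that for every sufficiently large `d`
there are infinitely many `n` admitting an `(n,d,λ)`-graph with `λ/d ≤ δ` whose longest
induced path has at most `C n / d` vertices. -/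
theorem construction_short_induced_paths :
    ∀ δ > (0 : ℝ), ∃ C > (0 : ℝ), ∃ d₀ : ℕ, ∀ d : ℕ, d₀ ≤ d →
      ∀ N : ℕ, ∃ n : ℕ, N ≤ n ∧
        ∃ (lam : ℝ) (G : SimpleGraph (Fin n)),
          IsNDLGraph n d lam G ∧ lam / d ≤ δ ∧
            ∀ k : ℕ, HasInducedPath G k → (k : ℝ) ≤ C * n / d := by
  intro δ hδ
  obtain ⟨D, hD, hfam⟩ := exists_isQuadraticExpander_family (half_pos hδ)
  have hD' : (0 : ℝ) < D := by exact_mod_cast hD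
  obtain ⟨q, hq⟩ := exists_nat_gt (2 / δ)
  refine ⟨4 * D, by positivity, 2 * D * (2 * D + q), fun d hd N => ?_⟩
  set s := d / (2 * D) with hs
  set r := d % (2 * D) with hr
  have hd_eq : D * (2 * s) + r = d := by
    rw [← Nat.div_add_mod d (2 * D)]; ring
  have hs_le : 2 * D + q ≤ s := by
    rw [hs, Nat.le_div_iff_mul_le (by positivity)]
    linarith
  have hr_lt : r < 2 * D := Nat.mod_lt _ (by positivity)
  have hs_pos : 0 < s := by omega
  have : NeZero s := ⟨hs_pos.ne'⟩
  obtain ⟨Y, _, H, hY, hH⟩ := hfam (max N (2 * s))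
  set R := bipartiteSumGraph s r
  have hcardT : Fintype.card (Bool × ZMod s) = 2 * s := by simp [ZMod.card]
  have hG := hH.blowUp (by positivity)
    (sum_adjKernel_bipartiteSumGraph (s := s) (r := r) (by omega))
  rw [hcardT, hd_eq] at hG
  have hcard : Fintype.card (Y × (Bool × ZMod s)) = Fintype.card Y * (2 * s) := by
    rw [Fintype.card_prod, hcardT]
  have hNY : N ≤ Fintype.card Y := (le_max_left _ _).trans hY
  have hsY : 2 * s ≤ Fintype.card Y := (le_max_right _ _).trans hY
  let e : Fin (Fintype.card Y * (2 * s)) ≃ Y × (Bool × ZMod s) :=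
    (Fintype.equivFinOfCardEq hcard).symm
  have hd_pos : (0 : ℝ) < d := by
    have : 0 < d := by rw [← hd_eq]; positivity
    exact_mod_cast this
  have hd_eqR : (D : ℝ) * (2 * s) + r = d := by exact_mod_cast hd_eq
  have hsR : (0 : ℝ) < s := by exact_mod_cast hs_pos
  have hs_leR : 2 * (D : ℝ) + q ≤ s := by exact_mod_cast hs_le
  have hr_ltR : (r : ℝ) ≤ 2 * D := by exact_mod_cast hr_lt.le
  refine ⟨Fintype.card Y * (2 * s), hNY.trans (Nat.le_mul_of_pos_right _ (by positivity)),
    _, _, (hG.comap e).isNDLGraph (by nlinarith), ?_, fun k hk => ?_⟩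
  · rw [div_le_iff₀ hd_pos, ← hd_eqR]
    have h1 : 2 ≤ δ * s := by
      rw [div_lt_iff₀ hδ] at hq
      nlinarith
    push_cast
    have h2 : 0 ≤ δ * r := by positivity
    have h3 : 2 * (D : ℝ) ≤ δ * s * D := by gcongr
    nlinarith
  · have hk' : k ≤ 2 * Fintype.card Y := by
      have := SimpleGraph.inducedPath_blowUp_le hk.of_comap
      rw [hcardT] at this
      omega
    rw [le_div_iff₀ hd_pos, ← hd_eqR]
    have hkR : (k : ℝ) ≤ 2 * Fintype.card Y := by exact_mod_cast hk'
    have h1 : (D : ℝ) * (2 * s) + r ≤ 4 * D * s := by nlinarith [(Nat.one_le_cast (α := ℝ)).2 hs_pos]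
    calc (k : ℝ) * (D * (2 * s) + r) ≤ 2 * Fintype.card Y * (4 * D * s) := by gcongr
      _ = _ := by push_cast; ring
end

section
/- There exist constants δ₁, δ₂, δ₃ > 0 such that the following holds for all positive integers n and d. If G is an (n,d,λ)-graph with d ≤ δ₃·n and λ/d ≤ δ₁, then μ(G) ≥ exp(δ₂·n·log d / d), where μ(G) is the number of pairwise non-isomorphic induced subgraphs of G. -/
open Finset

lemma Matrix.IsHermitian.sum_mulVec_sq_le_of_dotProduct_eq_zero {n : ℕ}
    {A : Matrix (Fin n) (Fin n) ℝ} (hA : A.IsHermitian) {D lam : ℝ} {i₀ : Fin n}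
    (hlam : ∀ i, i ≠ i₀ → |hA.eigenvalues i| ≤ lam) (hD : lam < D)
    {w : Fin n → ℝ} (hw0 : w ≠ 0) (hw : A.mulVec w = D • w)
    {f : Fin n → ℝ} (hf : f ⬝ᵥ w = 0) :
    ∑ x, (A.mulVec f x) ^ 2 ≤ lam ^ 2 * ∑ x, f x ^ 2 := by
  classical
  set b := hA.eigenvectorBasis with hb
  have hsymm : ∀ g h : Fin n → ℝ, g ⬝ᵥ A.mulVec h = (A.mulVec g) ⬝ᵥ h := by
    intro g h
    have : A.transpose = A := by
      have := hA
      rwa [Matrix.IsHermitian, Matrix.conjTranspose_eq_transpose_of_trivial] at this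
    rw [Matrix.dotProduct_mulVec, ← Matrix.mulVec_transpose, this]
  have hcoef : ∀ (i : Fin n) (g : Fin n → ℝ),
      ⇑(b i) ⬝ᵥ A.mulVec g = hA.eigenvalues i * (⇑(b i) ⬝ᵥ g) := by
    intro i g
    rw [hsymm, hA.mulVec_eigenvectorBasis i, smul_dotProduct, smul_eq_mul]
  have hinner : ∀ (i : Fin n) (g : Fin n → ℝ),
      inner ℝ (b i) (WithLp.toLp 2 g) = ⇑(b i) ⬝ᵥ g := by
    intro i g
    simp [PiLp.inner_apply, dotProduct, mul_comm]
  have hpars : ∀ g : Fin n → ℝ, ∑ x, g x ^ 2 = ∑ i, (⇑(b i) ⬝ᵥ g) ^ 2 := by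
    intro g
    have := b.sum_sq_norm_inner_right (WithLp.toLp 2 g)
    rw [EuclideanSpace.real_norm_sq_eq] at this
    rw [← this]
    refine Finset.sum_congr rfl fun i _ => ?_
    rw [hinner, Real.norm_eq_abs, sq_abs]
  have hwi : ∀ i, i ≠ i₀ → ⇑(b i) ⬝ᵥ w = 0 := by
    intro i hi
    have h := hcoef i w
    rw [hw, dotProduct_smul, smul_eq_mul] at h
    have h' : (D - hA.eigenvalues i) * (⇑(b i) ⬝ᵥ w) = 0 := by linarith
    refine (mul_eq_zero.mp h').resolve_left ?_
    have := (le_abs_self _).trans (hlam i hi)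
    linarith
  have hfw : ∑ i, (⇑(b i) ⬝ᵥ f) * (⇑(b i) ⬝ᵥ w) = 0 := by
    have := b.sum_inner_mul_inner (WithLp.toLp 2 f) (WithLp.toLp 2 w)
    simp_rw [real_inner_comm (b _) (WithLp.toLp 2 f), hinner] at this
    rw [this]
    simpa [PiLp.inner_apply, dotProduct, mul_comm] using hf
  have hw0' : ⇑(b i₀) ⬝ᵥ w ≠ 0 := by
    intro h
    apply hw0
    have h2 : ∑ x, w x ^ 2 = 0 := by
      rw [hpars]
      refine Finset.sum_eq_zero fun i _ => ?_
      by_cases hi : i = i₀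
      · rw [hi, h]; norm_num
      · rw [hwi i hi]; norm_num
    rw [Finset.sum_eq_zero_iff_of_nonneg (fun _ _ => sq_nonneg _)] at h2
    funext x
    exact pow_eq_zero_iff two_ne_zero |>.mp (h2 x (mem_univ x))
  have hf0 : ⇑(b i₀) ⬝ᵥ f = 0 := by
    rw [Finset.sum_eq_single i₀ (fun i _ hi => by rw [hwi i hi, mul_zero]) (by simp)] at hfw
    exact (mul_eq_zero.mp hfw).resolve_right hw0'
  rw [hpars, hpars f, Finset.mul_sum]
  refine Finset.sum_le_sum fun i _ => ?_
  rw [hcoef, mul_pow]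
  by_cases hi : i = i₀
  · rw [hi, hf0]; simp
  · refine mul_le_mul_of_nonneg_right ?_ (sq_nonneg _)
    exact sq_le_sq' (by linarith [neg_abs_le (hA.eigenvalues i), hlam i hi])
      ((le_abs_self _).trans (hlam i hi))

open Classical in
/-- The set of neighbors of `x`, as a finset. -/
noncomputable def SimpleGraph.nbr {V : Type*} [Fintype V] (G : SimpleGraph V) (x : V) : Finset V :=
  {y | G.Adj x y}

lemma SimpleGraph.mem_nbr {V : Type*} [Fintype V] {G : SimpleGraph V} {x y : V} :
    y ∈ G.nbr x ↔ G.Adj x y := by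
  simp [SimpleGraph.nbr]

lemma IsNDLGraph.card_nbr {n d : ℕ} {lam : ℝ} {G : SimpleGraph (Fin n)}
    (h : IsNDLGraph n d lam G) (x : Fin n) : #(G.nbr x) = d := by
  let _ := Classical.decRel G.Adj
  rw [← h.1 x, ← SimpleGraph.card_neighborFinset_eq_degree]
  congr 1
  ext y
  simp [SimpleGraph.mem_nbr]

/-- A one-sided variance form of the expander mixing lemma. -/
lemma IsNDLGraph.sum_sq_le {n d : ℕ} {lam : ℝ} {G : SimpleGraph (Fin n)}
    (h : IsNDLGraph n d lam G) (hn : 0 < n) (hlam : lam < d) (Y : Finset (Fin n)) :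
    ∑ x, ((#(G.nbr x ∩ Y) : ℝ) - d * #Y / n) ^ 2 ≤ lam ^ 2 * #Y := by
  let _ := Classical.decRel G.Adj
  obtain ⟨hreg, i₀, -, hi⟩ := h
  have hn' : (n : ℝ) ≠ 0 := by positivity
  set c : ℝ := #Y / n with hc
  have hrow : ∀ (x : Fin n), ∑ y, (if G.Adj x y then (1 : ℝ) else 0) = d := by
    intro x
    rw [← hreg x, ← SimpleGraph.card_neighborFinset_eq_degree]
    rw [Finset.sum_boole, SimpleGraph.neighborFinset_eq_filter]
  have hA1 : (G.adjMatrix ℝ).mulVec (fun _ => (1 : ℝ)) = (d : ℝ) • fun _ => (1 : ℝ) := by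
    funext x
    simpa [Matrix.mulVec, dotProduct, SimpleGraph.adjMatrix_apply] using hrow x
  have hone : (fun _ : Fin n => (1 : ℝ)) ≠ 0 := by
    intro h0
    have := congrFun h0 ⟨0, hn⟩
    simp at this
  set f : Fin n → ℝ := fun x => (if x ∈ Y then (1 : ℝ) else 0) - c with hf
  have hsumf : f ⬝ᵥ (fun _ => (1 : ℝ)) = 0 := by
    simp only [dotProduct, mul_one, hf, Finset.sum_sub_distrib]
    simp [hc]
    field_simp
    ring
  have key := G.adjHermitian.sum_mulVec_sq_le_of_dotProduct_eq_zero hi hlam hone hA1 hsumf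
  have hAf : ∀ x, (G.adjMatrix ℝ).mulVec f x = (#(G.nbr x ∩ Y) : ℝ) - d * #Y / n := by
    intro x
    simp only [Matrix.mulVec, dotProduct, SimpleGraph.adjMatrix_apply, hf, mul_sub,
      Finset.sum_sub_distrib, ← Finset.sum_mul, hrow]
    have : ∑ y, (if G.Adj x y then (1 : ℝ) else 0) * (if y ∈ Y then (1 : ℝ) else 0)
        = #(G.nbr x ∩ Y) := by
      simp only [← ite_and, mul_ite, mul_one, mul_zero]
      rw [← Finset.sum_filter]
      simp only [Finset.sum_const, nsmul_eq_mul, mul_one]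
      congr 2
      ext y
      simp [SimpleGraph.mem_nbr, and_comm]
    rw [this, hc]
    ring
  have hnorm : ∑ x, f x ^ 2 ≤ #Y := by
    have h1 : ∀ x, f x ^ 2 = (if x ∈ Y then (1 : ℝ) else 0) - 2 * c * (if x ∈ Y then (1 : ℝ) else 0)
        + c ^ 2 := by
      intro x
      simp only [hf]
      split_ifs <;> ring
    simp only [h1, Finset.sum_add_distrib, Finset.sum_sub_distrib, ← Finset.mul_sum]
    simp
    have : (n : ℝ) * c ^ 2 = c * #Y := by
      rw [hc]; field_simp
    have h2 : 0 ≤ c * #Y := by positivity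
    nlinarith
  simp only [hAf] at key
  exact key.trans (mul_le_mul_of_nonneg_left hnorm (sq_nonneg _))

namespace SimpleGraph

variable {V : Type*} [Fintype V] [DecidableEq V]

/-- The union of the neighborhoods of the vertices in `U`. -/
noncomputable def nbrs (G : SimpleGraph V) (U : Finset V) : Finset V := U.biUnion G.nbr

lemma mem_nbrs {G : SimpleGraph V} {U : Finset V} {x : V} :
    x ∈ G.nbrs U ↔ ∃ u ∈ U, G.Adj u x := by
  simp [nbrs, mem_nbr]

/-- A `d`-regular graph, with `d` large, in which only few vertices have an unexpectedly large
number of neighbors in any given small set. -/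
structure IsSpread (G : SimpleGraph V) (d : ℕ) : Prop where
  card_nbr : ∀ x, #(G.nbr x) = d
  le_deg : 1000 ≤ d
  card_bad : ∀ Y : Finset V, 80 * #Y ≤ Fintype.card V →
    1000 * #{x | d < 40 * #(G.nbr x ∩ Y)} ≤ #Y

/-- The vertices outside `U` having exactly one neighbor in `U`, with this neighbor in `L`, and
having few neighbors in the neighborhood of `U`. -/
noncomputable def privateNbrs (G : SimpleGraph V) (d : ℕ) (U L : Finset V) : Finset V :=
  {x | x ∉ U ∧ #(G.nbr x ∩ U) = 1 ∧ G.nbr x ∩ U ⊆ L ∧ 40 * #(G.nbr x ∩ G.nbrs U) ≤ d}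

lemma sum_card_nbr_inter (G : SimpleGraph V) (L : Finset V) :
    ∑ x, #(G.nbr x ∩ L) = ∑ u ∈ L, #(G.nbr u) := by
  have := Finset.sum_card_bipartiteAbove_eq_sum_card_bipartiteBelow (s := (univ : Finset V))
    (t := L) (fun x u => x ∈ G.nbr u)
  convert this using 3 with x _ u _
  · ext y
    simp [bipartiteAbove, mem_nbr, G.adj_comm, and_comm]
  · ext y
    simp [bipartiteBelow]

lemma IsSpread.card_nbrs_le {G : SimpleGraph V} {d : ℕ} (h : G.IsSpread d) (U : Finset V) :
    #(G.nbrs U) ≤ #U * d :=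
  Finset.card_biUnion_le_card_mul _ _ _ fun x _ => (h.card_nbr x).le

lemma IsSpread.le_card_privateNbrs {G : SimpleGraph V} {d : ℕ} (h : G.IsSpread d)
    {U L : Finset V} (hLU : L ⊆ U) (hU : 80 * (#U * d) ≤ Fintype.card V)
    (hW : 39 * (#U * d) ≤ 40 * #(G.nbrs U)) :
    16 * (#L * d) ≤ 16 * #(G.privateNbrs d U L) + #U * d := by
  have hWle := h.card_nbrs_le U
  have hbad := h.card_bad (G.nbrs U) (by omega)
  have hdU : 1000 * #U ≤ #U * d := by nlinarith [h.le_deg]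
  set B : Finset V := {x | d < 40 * #(G.nbr x ∩ G.nbrs U)} with hB
  have hpt : ∀ x, #(G.nbr x ∩ L) + 2 * (if x ∈ G.nbrs U then 1 else 0) ≤
      (if x ∈ G.privateNbrs d U L then 1 else 0) + (if x ∈ U then 1 else 0) +
      (if x ∈ B then 1 else 0) + 2 * #(G.nbr x ∩ U) := by
    intro x
    have hle : #(G.nbr x ∩ L) ≤ #(G.nbr x ∩ U) := card_le_card (inter_subset_inter_left hLU)
    have hWiff : x ∈ G.nbrs U ↔ 0 < #(G.nbr x ∩ U) := by
      rw [card_pos, mem_nbrs]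
      constructor
      · rintro ⟨u, hu, hux⟩
        exact ⟨u, mem_inter.2 ⟨mem_nbr.2 hux.symm, hu⟩⟩
      · rintro ⟨u, hu⟩
        rw [mem_inter, mem_nbr] at hu
        exact ⟨u, hu.2, hu.1.symm⟩
    by_cases h1 : #(G.nbr x ∩ U) = 1
    · have hxW : x ∈ G.nbrs U := hWiff.2 (by omega)
      rw [if_pos hxW]
      by_cases hL : G.nbr x ∩ U ⊆ L
      · by_cases hxU : x ∈ U
        · rw [if_pos hxU]; omega
        · by_cases hxB : x ∈ B
          · rw [if_pos hxB]; omega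
          · have : x ∈ G.privateNbrs d U L := by
              simp only [privateNbrs, mem_filter, mem_univ, true_and]
              simp only [hB, mem_filter, mem_univ, true_and, not_lt] at hxB
              exact ⟨hxU, h1, hL, hxB⟩
            rw [if_pos this]; omega
      · have : #(G.nbr x ∩ L) = 0 := by
          rw [card_eq_zero, eq_empty_iff_forall_notMem]
          intro y hy
          apply hL
          obtain ⟨z, hz⟩ := card_eq_one.1 h1
          rw [mem_inter] at hy
          have : y ∈ G.nbr x ∩ U := mem_inter.2 ⟨hy.1, hLU hy.2⟩
          rw [hz, mem_singleton] at this
          rw [hz, ← this, singleton_subset_iff]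
          exact hy.2
        omega
    · by_cases hxW : x ∈ G.nbrs U
      · have := hWiff.1 hxW
        rw [if_pos hxW]; omega
      · have : ¬ 0 < #(G.nbr x ∩ U) := fun h => hxW (hWiff.2 h)
        rw [if_neg hxW]; omega
  have hsum := Finset.sum_le_sum fun x (_ : x ∈ (univ : Finset V)) => hpt x
  simp only [sum_add_distrib, ← mul_sum, sum_card_nbr_inter, h.card_nbr, sum_const, smul_eq_mul,
    sum_boole, filter_univ_mem, Nat.cast_id] at hsum
  omega

/-- `v` enumerates, for indices below `k`, the vertices of a tree of bounded degree in `G` whose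
vertices have almost disjoint neighborhoods; `p` is the parent function. -/
structure IsSpreadTree (G : SimpleGraph V) (d k : ℕ) (v : ℕ → V) (p : ℕ → ℕ) : Prop where
  injOn : Set.InjOn v (range k)
  parent_lt : ∀ j, 0 < j → j < k → p j < j
  adj_parent : ∀ j, 0 < j → j < k → G.Adj (v (p j)) (v j)
  card_le_five : ∀ x ∈ (range k).image v, #(G.nbr x ∩ (range k).image v) ≤ 5
  sum_le : ∑ x ∈ (range k).image v, #(G.nbr x ∩ (range k).image v) ≤ 2 * k
  le_card_nbrs : 39 * (k * d) ≤ 40 * #(G.nbrs ((range k).image v))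

lemma IsSpreadTree.card_image {G : SimpleGraph V} {d k : ℕ} {v : ℕ → V} {p : ℕ → ℕ}
    (h : G.IsSpreadTree d k v p) : #((range k).image v) = k := by
  rw [card_image_of_injOn h.injOn, card_range]

lemma IsSpread.isSpreadTree_one {G : SimpleGraph V} {d : ℕ} (h : G.IsSpread d) (x : V) :
    G.IsSpreadTree d 1 (fun _ => x) id where
  injOn := by intro i hi j hj _; simp at hi hj; omega
  parent_lt := by omega
  adj_parent := by omega
  card_le_five := by
    intro y _
    refine (card_le_card inter_subset_right).trans ?_
    simp
  sum_le := by
    simp only [range_one, image_singleton, sum_singleton]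
    refine (card_le_card inter_subset_right).trans ?_
    simp
  le_card_nbrs := by
    simp only [range_one, image_singleton, nbrs, singleton_biUnion, h.card_nbr]
    omega

lemma IsSpread.exists_extend {G : SimpleGraph V} {d k : ℕ} (h : G.IsSpread d)
    (hk : 0 < k) (hkd : 80 * (k * d) ≤ Fintype.card V) {v : ℕ → V} {p : ℕ → ℕ}
    (ht : G.IsSpreadTree d k v p) :
    ∃ v' p', G.IsSpreadTree d (k + 1) v' p' := by
  set U := (range k).image v with hU
  have hcard : #U = k := ht.card_image
  set L : Finset V := {u ∈ U | #(G.nbr u ∩ U) ≤ 4} with hL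
  have hLU : L ⊆ U := filter_subset _ _
  have hLcard : 3 * k ≤ 5 * #L := by
    have h1 : ∑ x ∈ U, (5 - 5 * (if #(G.nbr x ∩ U) ≤ 4 then 1 else 0)) ≤
        ∑ x ∈ U, #(G.nbr x ∩ U) := by
      refine sum_le_sum fun x _ => ?_
      split_ifs <;> omega
    have h2 : ∑ x ∈ U, (5 - 5 * (if #(G.nbr x ∩ U) ≤ 4 then 1 else 0)) +
        ∑ x ∈ U, 5 * (if #(G.nbr x ∩ U) ≤ 4 then 1 else 0) = ∑ x ∈ U, 5 := by
      rw [← sum_add_distrib]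
      refine sum_congr rfl fun x _ => ?_
      split_ifs <;> omega
    rw [← mul_sum, sum_boole, sum_const, hcard] at h2
    have := ht.sum_le
    rw [← hU] at this
    simp only [Nat.cast_id, smul_eq_mul] at h2
    change _ + 5 * #L = _ at h2
    omega
  have hpriv := h.le_card_privateNbrs hLU (by rwa [hcard]) (by rw [hcard]; exact ht.le_card_nbrs)
  have hpos : 0 < #(G.privateNbrs d U L) := by
    have := h.le_deg
    have h3 : 3 * (k * d) ≤ 5 * (#L * d) := by nlinarith
    have : 0 < k * d := by positivity
    rw [hcard] at hpriv
    omega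
  obtain ⟨x, hx⟩ := card_pos.1 hpos
  simp only [privateNbrs, mem_filter, mem_univ, true_and] at hx
  obtain ⟨hxU, hx1, hxL, hxW⟩ := hx
  obtain ⟨w, hw⟩ := card_eq_one.1 hx1
  have hwL : w ∈ L := hxL (by rw [hw]; exact mem_singleton_self w)
  have hwx : G.Adj w x := by
    have : w ∈ G.nbr x ∩ U := by rw [hw]; exact mem_singleton_self w
    exact (mem_nbr.1 (mem_inter.1 this).1).symm
  obtain ⟨i, hi, hiw⟩ := mem_image.1 (hLU hwL)
  rw [mem_range] at hi
  have hv' : ∀ j, j < k → Function.update v k x j = v j := fun j hj =>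
    Function.update_of_ne hj.ne _ _
  have himg : (range (k + 1)).image (Function.update v k x) = insert x U := by
    rw [range_add_one, image_insert, Function.update_self, hU]
    congr 1
    exact image_congr fun j hj => hv' j (by simpa using hj)
  have hadj : ∀ y ∈ U, G.Adj x y → y = w := by
    intro y hy hxy
    have : y ∈ G.nbr x ∩ U := mem_inter.2 ⟨mem_nbr.2 hxy, hy⟩
    rwa [hw, mem_singleton] at this
  have hdegx : #(G.nbr x ∩ insert x U) = 1 := by
    rw [inter_insert_of_notMem (by simp [mem_nbr]), hx1]
  have hdeg : ∀ y ∈ U, #(G.nbr y ∩ insert x U) = #(G.nbr y ∩ U) + if y = w then 1 else 0 := by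
    intro y hy
    by_cases hyw : y = w
    · subst hyw
      rw [inter_insert_of_mem (mem_nbr.2 hwx), card_insert_of_notMem (by simp [hxU]), if_pos rfl]
    · rw [inter_insert_of_notMem, if_neg hyw, add_zero]
      rw [mem_nbr]
      exact fun hh => hyw (hadj y hy hh.symm)
  refine ⟨Function.update v k x, Function.update p k i, ?_, ?_, ?_, ?_, ?_, ?_⟩
  · rw [← card_image_iff, himg, card_insert_of_notMem hxU, hcard, card_range]
  · intro j hj0 hj
    rcases Nat.lt_succ_iff_lt_or_eq.1 hj with hj | rfl
    · rw [Function.update_of_ne hj.ne]; exact ht.parent_lt j hj0 hj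
    · rwa [Function.update_self]
  · intro j hj0 hj
    rcases Nat.lt_succ_iff_lt_or_eq.1 hj with hj | rfl
    · rw [Function.update_of_ne hj.ne, hv' j hj, hv' _ ((ht.parent_lt j hj0 hj).trans hj)]
      exact ht.adj_parent j hj0 hj
    · rw [Function.update_self, hv' i hi, Function.update_self, hiw]
      exact hwx
  · rw [himg]
    intro y hy
    rcases mem_insert.1 hy with rfl | hy
    · omega
    · rw [hdeg y hy]
      split_ifs with hyw
      · subst hyw
        have := (mem_filter.1 hwL).2
        omega
      · exact ht.card_le_five y hy
  · rw [himg, sum_insert hxU, hdegx, sum_congr rfl hdeg, sum_add_distrib, sum_ite_eq',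
      if_pos (hLU hwL)]
    have := ht.sum_le
    rw [← hU] at this
    omega
  · rw [himg, nbrs, biUnion_insert, ← nbrs]
    have h1 := card_union_add_card_inter (G.nbr x) (G.nbrs U)
    have h2 := ht.le_card_nbrs
    rw [← hU] at h2
    rw [h.card_nbr] at h1
    rw [add_mul, one_mul]
    omega

lemma IsSpread.exists_isSpreadTree [Nonempty V] {G : SimpleGraph V} {d : ℕ} (h : G.IsSpread d)
    (k : ℕ) (hkd : 80 * (k * d) ≤ Fintype.card V) :
    ∃ v p, G.IsSpreadTree d (k + 1) v p := by
  induction k with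
  | zero => exact ⟨_, _, h.isSpreadTree_one (Classical.arbitrary V)⟩
  | succ k ih =>
    obtain ⟨v, p, ht⟩ := ih (by nlinarith)
    exact h.exists_extend (Nat.succ_pos k) hkd ht

/-- If each value `Φ b j` with `0 < j` lies in a set of size at most `c j` determined by an earlier
value of `Φ b`, then there are few possibilities for the first values of `Φ b`. -/
lemma card_image_le_mul_prod {β : Type*} (F : Finset β) (Φ : β → ℕ → V) (p : ℕ → ℕ)
    (T : ℕ → V → Finset V) (c : ℕ → ℕ) (hc : ∀ j, 1 ≤ c j) (hT : ∀ j w, #(T j w) ≤ c j) (k : ℕ)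
    (hp : ∀ j, 0 < j → j < k + 1 → p j < j)
    (hΦ : ∀ b ∈ F, ∀ j, 0 < j → j < k + 1 → Φ b j ∈ T j (Φ b (p j))) :
    #(F.image fun b (i : Fin (k + 1)) => Φ b i) ≤
      Fintype.card V * ∏ j ∈ range (k + 1), c j := by
  induction k with
  | zero =>
    refine (card_le_univ _).trans ?_
    rw [Fintype.card_fun, Fintype.card_fin, zero_add, pow_one, prod_range_one]
    exact Nat.le_mul_of_pos_right _ (hc 0)
  | succ k ih =>
    have ih' := ih (fun j h0 hj => hp j h0 (by omega)) (fun b hb j h0 hj => hΦ b hb j h0 (by omega))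
    have himg : (F.image fun b (i : Fin (k + 1 + 1)) => Φ b i).image
        (fun (φ : Fin (k + 1 + 1) → V) (i : Fin (k + 1)) => φ i.castSucc) =
        F.image fun b (i : Fin (k + 1)) => Φ b i := by
      rw [image_image]
      rfl
    have hfib := card_le_mul_card_image
      (f := fun (φ : Fin (k + 1 + 1) → V) (i : Fin (k + 1)) => φ i.castSucc)
      (F.image fun b (i : Fin (k + 1 + 1)) => Φ b i) (c (k + 1)) (by
        intro ψ _
        have hpk : p (k + 1) < k + 1 := hp (k + 1) (by omega) (by omega)
        refine (card_le_card_of_injOn (fun φ => φ (Fin.last (k + 1)))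
          (t := T (k + 1) (ψ ⟨p (k + 1), hpk⟩)) ?_ ?_).trans (hT _ _)
        · intro φ hφ
          simp only [coe_filter, mem_image, Set.mem_ofPred_eq] at hφ
          obtain ⟨⟨b, hb, rfl⟩, rfl⟩ := hφ
          exact hΦ b hb (k + 1) (by omega) (by omega)
        · intro φ hφ φ' hφ' hlast
          simp only [coe_filter, Set.mem_ofPred_eq] at hφ hφ'
          funext i
          refine Fin.lastCases hlast (fun i => ?_) i
          exact congrFun (hφ.2.trans hφ'.2.symm) i)
    rw [himg] at hfib
    rw [prod_range_succ]
    calc _ ≤ _ := hfib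
      _ ≤ c (k + 1) * _ := Nat.mul_le_mul_left _ ih'
      _ = _ := by ring

lemma card_nbr_inter_eq_of_iso {G : SimpleGraph V} {S S' : Finset V}
    (ψ : G.induce (S : Set V) ≃g G.induce (S' : Set V)) (x : (S : Set V)) :
    #(G.nbr x ∩ S) = #(G.nbr (ψ x) ∩ S') := by
  refine card_bij' (fun y hy => (ψ ⟨y, (mem_inter.1 hy).2⟩ : V))
    (fun y hy => (ψ.symm ⟨y, (mem_inter.1 hy).2⟩ : V)) ?_ ?_ ?_ ?_
  · intro y hy
    refine mem_inter.2 ⟨mem_nbr.2 ?_, (ψ _).2⟩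
    have : (G.induce (S : Set V)).Adj x ⟨y, (mem_inter.1 hy).2⟩ :=
      (mem_nbr (G := G)).1 (mem_inter.1 hy).1
    exact ψ.map_rel_iff.2 this
  · intro y hy
    refine mem_inter.2 ⟨mem_nbr.2 ?_, (ψ.symm _).2⟩
    have : (G.induce (S' : Set V)).Adj (ψ x) ⟨y, (mem_inter.1 hy).2⟩ :=
      (mem_nbr (G := G)).1 (mem_inter.1 hy).1
    have h2 := ψ.symm.map_rel_iff.2 this
    rw [ψ.symm_apply_apply] at h2
    exact h2
  · intro y hy
    simp
  · intro y hy
    simp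

lemma exists_map_of_iso {G : SimpleGraph V} {S S' : Finset V}
    (ψ : G.induce (S : Set V) ≃g G.induce (S' : Set V)) :
    ∃ φ : V → V, (∀ x ∈ S, φ x ∈ S' ∧ #(G.nbr x ∩ S) = #(G.nbr (φ x) ∩ S')) ∧
      ∀ x ∈ S, ∀ y ∈ S, G.Adj x y → G.Adj (φ x) (φ y) := by
  have hφ : ∀ x (hx : x ∈ S), (fun x => if hx : x ∈ S then (ψ ⟨x, hx⟩ : V) else x) x =
      ψ ⟨x, hx⟩ := fun x hx => dif_pos hx
  refine ⟨fun x => if hx : x ∈ S then (ψ ⟨x, hx⟩ : V) else x, fun x hx => ?_,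
    fun x hx y hy hxy => ?_⟩
  · rw [hφ x hx]
    exact ⟨(ψ ⟨x, hx⟩).2, card_nbr_inter_eq_of_iso ψ ⟨x, hx⟩⟩
  · rw [hφ x hx, hφ y hy]
    have : (G.induce (S : Set V)).Adj ⟨x, hx⟩ ⟨y, hy⟩ := hxy
    exact ψ.map_rel_iff.2 this

omit [Fintype V] [DecidableEq V] in
lemma exists_nonisomorphic_family (G : SimpleGraph V) {ι : Type*} (F : Finset ι)
    (S : ι → Set V) (K : ℕ)
    (h : ∀ a ∈ F, ∀ F' ⊆ F, (∀ b ∈ F', Nonempty (G.induce (S b) ≃g G.induce (S a))) → #F' ≤ K) :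
    ∃ N : ℕ, #F ≤ K * N ∧ ∃ f : Fin N → Set V,
      ∀ i j : Fin N, i ≠ j → IsEmpty (G.induce (f i) ≃g G.induce (f j)) := by
  classical
  let s : Setoid ι :=
    { r := fun a b => Nonempty (G.induce (S a) ≃g G.induce (S b))
      iseqv := ⟨fun _ => ⟨Iso.refl⟩, fun ⟨e⟩ => ⟨e.symm⟩, fun ⟨e⟩ ⟨e'⟩ => ⟨e.trans e'⟩⟩ }
  refine ⟨#(F.image (Quotient.mk s)), card_le_mul_card_image F K ?_,
    fun i => S ((F.image (Quotient.mk s)).equivFin.symm i).1.out, ?_⟩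
  · intro q hq
    obtain ⟨a, ha, rfl⟩ := mem_image.1 hq
    exact h a ha _ (filter_subset _ _) fun b hb => Quotient.exact (mem_filter.1 hb).2
  · intro i j hij
    by_contra hne
    rw [not_isEmpty_iff] at hne
    apply hij
    have := Quotient.sound (s := s) hne
    rw [Quotient.out_eq, Quotient.out_eq] at this
    exact (Equiv.injective _) (Subtype.ext this)

lemma IsSpread.card_deficient_le {G : SimpleGraph V} {d : ℕ} (h : G.IsSpread d)
    {P L : Finset V} (hLP : L ⊆ P) (hP : 80 * (#P * d) ≤ Fintype.card V)
    (hW : 39 * (#P * d) ≤ 40 * #(G.nbrs P))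
    (hL : ∀ u ∈ L, 2 * #(G.privateNbrs d P {u}) ≤ d) : 8 * #L ≤ #P := by
  have h1 := h.le_card_privateNbrs hLP hP hW
  have h2 : G.privateNbrs d P L ⊆ L.biUnion fun u => G.privateNbrs d P {u} := by
    intro x hx
    simp only [privateNbrs, mem_filter, mem_univ, true_and] at hx
    obtain ⟨u, hu⟩ := card_eq_one.1 hx.2.1
    refine mem_biUnion.2 ⟨u, hx.2.2.1 (by rw [hu]; exact mem_singleton_self u), ?_⟩
    simp only [privateNbrs, mem_filter, mem_univ, true_and]
    exact ⟨hx.1, hx.2.1, hu.subset, hx.2.2.2⟩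
  have h3 : #(G.privateNbrs d P L) ≤ #L * (d / 2) :=
    (card_le_card h2).trans (card_biUnion_le_card_mul _ _ _ fun u hu => by
      have := hL u hu
      omega)
  have h4 : 2 * (#L * (d / 2)) ≤ #L * d := by
    calc _ = #L * (2 * (d / 2)) := by ring
      _ ≤ _ := Nat.mul_le_mul_left _ (by omega)
  have h5 : 8 * #L * d ≤ #P * d := by
    rw [mul_assoc]; omega
  exact Nat.le_of_mul_le_mul_right h5 (by have := h.le_deg; omega)

lemma IsSpread.exists_nonisomorphic {G : SimpleGraph V} {d k : ℕ} (h : G.IsSpread d)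
    {v : ℕ → V} {p : ℕ → ℕ} (ht : G.IsSpreadTree d (k + 1) v p)
    (hkd : 80 * ((k + 1) * d) ≤ Fintype.card V) :
    ∃ l, 8 * l ≤ k + 1 ∧ ∃ N : ℕ,
      (d / 8) ^ (k + 1 - l) ≤ (Fintype.card V * (5 ^ (k + 1 - l) * d ^ l)) * N ∧
      ∃ f : Fin N → Set V, ∀ i j : Fin N, i ≠ j →
        IsEmpty (G.induce (f i) ≃g G.induce (f j)) := by
  have hd := h.le_deg
  set P := (range (k + 1)).image v with hP
  have hcard : #P = k + 1 := ht.card_image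
  set M : Finset V := {u ∈ P | d < 2 * #(G.privateNbrs d P {u})} with hM
  have hMP : M ⊆ P := filter_subset _ _
  have hcardM : #M = k + 1 - #(P \ M) := by
    have := card_sdiff_add_card_eq_card hMP
    omega
  have hl := h.card_deficient_le (L := P \ M) sdiff_subset (by rwa [hcard])
    (by rw [hcard]; exact ht.le_card_nbrs) (by
      intro u hu
      rw [mem_sdiff, hM, mem_filter] at hu
      by_contra hcon
      exact hu.2 ⟨hu.1, by omega⟩)
  rw [hcard] at hl
  have hA : ∀ u t, ∃ A ⊆ G.privateNbrs d P {u}, t ≤ #(G.privateNbrs d P {u}) → #A = t := by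
    intro u t
    by_cases htle : t ≤ #(G.privateNbrs d P {u})
    · obtain ⟨A, hA, hAt⟩ := exists_subset_card_eq htle
      exact ⟨A, hA, fun _ => hAt⟩
    · exact ⟨∅, empty_subset _, fun hh => absurd hh htle⟩
  choose A hAsub hAcard using hA
  let S : (V → ℕ) → Finset V := fun b => P ∪ M.biUnion fun u => A u (d / 4 + b u)
  let F : Finset (V → ℕ) := Fintype.piFinset fun u => if u ∈ M then range (d / 8) else {0}
  have hFcard : #F = (d / 8) ^ #M := by
    rw [Fintype.card_piFinset]
    rw [← prod_const, ← prod_subset (subset_univ M)]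
    · exact prod_congr rfl fun u hu => by rw [if_pos hu, card_range]
    · intro u _ hu
      rw [if_neg hu, card_singleton]
  have hpriv : ∀ u t x, x ∈ A u t → x ∉ P ∧ G.nbr x ∩ P = {u} ∧ 40 * #(G.nbr x ∩ G.nbrs P) ≤ d := by
    intro u t x hx
    have := hAsub u t hx
    simp only [privateNbrs, mem_filter, mem_univ, true_and] at this
    refine ⟨this.1, ?_, this.2.2.2⟩
    exact eq_of_subset_of_card_le this.2.2.1 (by rw [this.2.1, card_singleton])
  have hPS : ∀ b, P ⊆ S b := fun b => subset_union_left
  have hcase : ∀ b x, x ∈ S b → x ∉ P → ∃ u ∈ M, x ∈ A u (d / 4 + b u) := by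
    intro b x hx hxP
    rcases mem_union.1 hx with hx | hx
    · exact absurd hx hxP
    · exact mem_biUnion.1 hx
  have hfive : ∀ b x, x ∈ S b → #(G.nbr x ∩ P) ≤ 5 := by
    intro b x hx
    by_cases hxP : x ∈ P
    · exact ht.card_le_five x hxP
    · obtain ⟨u, -, hxu⟩ := hcase b x hx hxP
      rw [(hpriv u _ x hxu).2.1, card_singleton]
      omega
  have hlow : ∀ b x, x ∈ S b → x ∉ P → #(G.nbr x ∩ S b) < d / 4 := by
    intro b x hx hxP
    obtain ⟨u, -, hxu⟩ := hcase b x hx hxP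
    obtain ⟨-, h1, h2⟩ := hpriv u _ x hxu
    have hsub : G.nbr x ∩ S b ⊆ (G.nbr x ∩ P) ∪ (G.nbr x ∩ G.nbrs P) := by
      intro y hy
      rw [mem_inter] at hy
      by_cases hyP : y ∈ P
      · exact mem_union_left _ (mem_inter.2 ⟨hy.1, hyP⟩)
      · obtain ⟨w, hw, hyw⟩ := hcase b y hy.2 hyP
        refine mem_union_right _ (mem_inter.2 ⟨hy.1, mem_nbrs.2 ⟨w, hMP hw, ?_⟩⟩)
        have : w ∈ G.nbr y ∩ P := by rw [(hpriv w _ y hyw).2.1]; exact mem_singleton_self w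
        exact (mem_nbr.1 (mem_inter.1 this).1).symm
    have h3 := (card_le_card hsub).trans (card_union_le _ _)
    rw [h1, card_singleton] at h3
    omega
  have hhigh : ∀ b ∈ F, ∀ u ∈ M, #(G.nbr u ∩ S b) = #(G.nbr u ∩ P) + (d / 4 + b u) := by
    intro b hb u hu
    have hbu : b u < d / 8 := by
      have := Fintype.mem_piFinset.1 hb u
      rwa [if_pos hu, mem_range] at this
    have hsz : #(A u (d / 4 + b u)) = d / 4 + b u := hAcard u _ (by
      have := (mem_filter.1 hu).2
      omega)
    have hset : G.nbr u ∩ S b = (G.nbr u ∩ P) ∪ A u (d / 4 + b u) := by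
      ext y
      simp only [mem_union, mem_inter]
      constructor
      · rintro ⟨hy, hyS⟩
        by_cases hyP : y ∈ P
        · exact Or.inl ⟨hy, hyP⟩
        · obtain ⟨w, hw, hyw⟩ := hcase b y hyS hyP
          have : u ∈ G.nbr y ∩ P := mem_inter.2 ⟨mem_nbr.2 (mem_nbr.1 hy).symm, hMP hu⟩
          rw [(hpriv w _ y hyw).2.1, mem_singleton] at this
          subst this
          exact Or.inr hyw
      · rintro (⟨hy, hyP⟩ | hy)
        · exact ⟨hy, hPS b hyP⟩
        · refine ⟨?_, mem_union_right _ (mem_biUnion.2 ⟨u, hu, hy⟩)⟩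
          have : u ∈ G.nbr y ∩ P := by rw [(hpriv u _ y hy).2.1]; exact mem_singleton_self u
          exact mem_nbr.2 (mem_nbr.1 (mem_inter.1 this).1).symm
    rw [hset, card_union_of_disjoint (Finset.disjoint_left.2 fun y hy hy' =>
      (hpriv u _ y hy').1 (mem_inter.1 hy).2), hsz]
  have hvP : ∀ j, j < k + 1 → v j ∈ P := fun j hj => mem_image_of_mem v (mem_range.2 hj)
  refine ⟨#(P \ M), hl, ?_⟩
  rw [← hcardM, ← hFcard]
  refine exists_nonisomorphic_family G F (fun b => (S b : Set V)) _ ?_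
  intro a ha F' hF' hiso
  have hφ := fun b (hb : b ∈ F') => exists_map_of_iso (hiso b hb).some
  have : Nonempty V := ⟨v 0⟩
  choose! φ hφS hφadj using hφ
  have hφM : ∀ b ∈ F', ∀ u ∈ M, φ b u ∈ P := by
    intro b hb u hu
    obtain ⟨h1, h2⟩ := hφS b hb u (hPS b (hMP hu))
    by_contra hcon
    have h3 := hlow a _ h1 hcon
    have h4 := hhigh b (hF' hb) u hu
    omega
  have hinj : Set.InjOn (fun b (i : Fin (k + 1)) => φ b (v i)) (F' : Set (V → ℕ)) := by
    intro b hb b' hb' heq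
    funext u
    by_cases hu : u ∈ M
    · obtain ⟨j, hj, hju⟩ := mem_image.1 (hMP hu)
      have h0 : φ b u = φ b' u := by
        rw [← hju]
        exact congrFun heq ⟨j, mem_range.1 hj⟩
      have h1 := (hφS b hb u (hPS b (hMP hu))).2
      have h2 := (hφS b' hb' u (hPS b' (hMP hu))).2
      rw [hhigh b (hF' hb) u hu] at h1
      rw [hhigh b' (hF' hb') u hu, ← h0] at h2
      omega
    · have h1 := Fintype.mem_piFinset.1 (hF' hb) u
      have h2 := Fintype.mem_piFinset.1 (hF' hb') u
      rw [if_neg hu, mem_singleton] at h1 h2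
      rw [h1, h2]
  have hprod : ∏ j ∈ range (k + 1), (if v j ∈ M then 5 else d) = 5 ^ #M * d ^ #(P \ M) := by
    rw [← prod_image (s := range (k + 1)) (g := v) (f := fun u => if u ∈ M then 5 else d) ht.injOn,
      ← hP, prod_ite, prod_const, prod_const, filter_mem_eq_inter, inter_eq_right.2 hMP,
      filter_notMem_eq_sdiff]
  rw [← hprod, ← card_image_of_injOn hinj]
  refine card_image_le_mul_prod F' (fun b j => φ b (v j)) p
    (fun j w => if #(G.nbr w ∩ P) ≤ 5 then if v j ∈ M then G.nbr w ∩ P else G.nbr w else ∅)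
    _ ?_ ?_ k ht.parent_lt ?_
  · intro j
    split_ifs <;> omega
  · intro j w
    by_cases hw : #(G.nbr w ∩ P) ≤ 5
    · rw [if_pos hw]
      split_ifs
      · exact hw
      · exact (h.card_nbr w).le
    · rw [if_neg hw, card_empty]
      exact Nat.zero_le _
  · intro b hb j h0 hj
    have hpP := hvP (p j) ((ht.parent_lt j h0 hj).trans hj)
    have hadj := hφadj b hb _ (hPS b hpP) _ (hPS b (hvP j hj)) (ht.adj_parent j h0 hj)
    rw [if_pos (hfive a _ (hφS b hb _ (hPS b hpP)).1)]
    split_ifs with hjM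
    · exact mem_inter.2 ⟨mem_nbr.2 hadj, hφM b hb _ hjM⟩
    · exact mem_nbr.2 hadj

end SimpleGraph

lemma IsNDLGraph.nonneg {n d : ℕ} {lam : ℝ} {G : SimpleGraph (Fin n)}
    (h : IsNDLGraph n d lam G) (hn : 1 < n) : 0 ≤ lam := by
  obtain ⟨-, i₀, -, hi⟩ := h
  have : Nontrivial (Fin n) := Fin.nontrivial_iff_two_le.2 hn
  obtain ⟨i, hne⟩ := exists_ne i₀
  exact (abs_nonneg _).trans (hi i hne)

lemma IsNDLGraph.le_sq {n d : ℕ} {lam : ℝ} {G : SimpleGraph (Fin n)}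
    (h : IsNDLGraph n d lam G) (hn : 0 < n) (hlam : lam < d) :
    (1 - 2 * (d / n : ℝ)) * d ≤ lam ^ 2 := by
  have key := h.sum_sq_le hn hlam {⟨0, hn⟩}
  have hsum := G.sum_card_nbr_inter {⟨0, hn⟩}
  rw [sum_singleton, h.card_nbr] at hsum
  rw [card_singleton, Nat.cast_one, mul_one, mul_one] at key
  refine le_trans ?_ key
  have hsum' : ∑ x, (#(G.nbr x ∩ {⟨0, hn⟩}) : ℝ) = d := by exact_mod_cast hsum
  rw [← hsum', mul_sum]
  refine sum_le_sum fun x _ => ?_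
  rw [hsum']
  have h1 : #(G.nbr x ∩ {⟨0, hn⟩}) ≤ 1 := by
    simpa using card_le_card (inter_subset_right (s₁ := G.nbr x) (s₂ := {⟨0, hn⟩}))
  interval_cases #(G.nbr x ∩ {⟨0, hn⟩})
  · norm_num
    positivity
  · push_cast
    nlinarith [sq_nonneg (d / n : ℝ)]

lemma IsNDLGraph.pow_le_deg {n d : ℕ} {lam : ℝ} {G : SimpleGraph (Fin n)}
    (h : IsNDLGraph n d lam G) (hd : 0 < d) (hdn : 1600 * d ≤ n)
    (hlam : lam ≤ 1 / 10 ^ 20 * d) : 10 ^ 39 ≤ d := by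
  have hn : 0 < n := by omega
  have hn' : (0 : ℝ) < n := by exact_mod_cast hn
  have hd' : (0 : ℝ) < d := by exact_mod_cast hd
  have hsq := h.le_sq hn (by norm_num at hlam ⊢; linarith)
  have hdn' : (d / n : ℝ) ≤ 1 / 1600 := by
    rw [div_le_iff₀ hn']
    have : (1600 : ℝ) * d ≤ n := by exact_mod_cast hdn
    linarith
  have h2 : lam ^ 2 ≤ (1 / 10 ^ 20 * d) ^ 2 :=
    pow_le_pow_left₀ (h.nonneg (by omega)) hlam 2
  have h3 : (1 / 2 : ℝ) * d ≤ (1 / 10 ^ 40 * d) * d := by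
    have : (1 / 2 : ℝ) * d ≤ (1 - 2 * (d / n : ℝ)) * d :=
      mul_le_mul_of_nonneg_right (by linarith) hd'.le
    refine (this.trans (hsq.trans h2)).trans (le_of_eq ?_)
    ring
  have h4 := le_of_mul_le_mul_right h3 hd'
  have h5 : (10 : ℝ) ^ 39 ≤ d := by
    linarith
  exact_mod_cast h5

lemma IsNDLGraph.isSpread {n d : ℕ} {lam : ℝ} {G : SimpleGraph (Fin n)}
    (h : IsNDLGraph n d lam G) (hd : 0 < d) (hdn : 1600 * d ≤ n)
    (hlam : lam ≤ 1 / 10 ^ 20 * d) : G.IsSpread d := by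
  have hn : 0 < n := by omega
  have hn' : (0 : ℝ) < n := by exact_mod_cast hn
  have hd' : (0 : ℝ) < d := by exact_mod_cast hd
  refine ⟨h.card_nbr, le_trans (by norm_num) (h.pow_le_deg hd hdn hlam), fun Y hY => ?_⟩
  rw [Fintype.card_fin] at hY
  have key := h.sum_sq_le hn (by norm_num at hlam ⊢; linarith) Y
  set X : Finset (Fin n) := {x | d < 40 * #(G.nbr x ∩ Y)} with hX
  have h1 : (#X : ℝ) * (d / 80) ^ 2 ≤ lam ^ 2 * #Y := by
    refine le_trans ?_ key
    refine le_trans ?_ (sum_le_sum_of_subset_of_nonneg (subset_univ X) fun _ _ _ => sq_nonneg _)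
    rw [← nsmul_eq_mul]
    refine card_nsmul_le_sum _ _ _ fun x hx => ?_
    have hx' : (d : ℝ) < 40 * #(G.nbr x ∩ Y) := by exact_mod_cast (mem_filter.1 hx).2
    have hY' : (d * #Y / n : ℝ) ≤ d / 80 := by
      rw [div_le_iff₀ hn']
      have : (80 : ℝ) * #Y ≤ n := by exact_mod_cast hY
      nlinarith
    exact pow_le_pow_left₀ (by positivity) (by linarith) 2
  have h2 : lam ^ 2 ≤ (1 / 10 ^ 20 * d) ^ 2 :=
    pow_le_pow_left₀ (h.nonneg (by omega)) hlam 2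
  have h3 : (#X * (1 / 6400) : ℝ) * d ^ 2 ≤ (1 / 10 ^ 40 * #Y) * d ^ 2 := by
    have := h1.trans (mul_le_mul_of_nonneg_right h2 (Nat.cast_nonneg _))
    calc _ = (#X : ℝ) * (d / 80) ^ 2 := by ring
      _ ≤ _ := this
      _ = _ := by ring
  have h4 := le_of_mul_le_mul_right h3 (by positivity)
  have h5 : (1000 : ℝ) * #X ≤ #Y := by
    have : (0 : ℝ) ≤ #Y := Nat.cast_nonneg _
    norm_num at h4 ⊢
    linarith
  exact_mod_cast h5

lemma exp_le_of_pow_div_le {n d m l N : ℕ} (hd : 10 ^ 39 ≤ d) (hm : 20 ≤ m) (hl : 8 * l ≤ m)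
    (hn : n ≤ 160 * (m * d)) (h : (d / 8) ^ (m - l) ≤ n * (5 ^ (m - l) * d ^ l) * N) :
    Real.exp (1 / 320 * n * Real.log d / d) ≤ N := by
  have hd0 : (0 : ℝ) < d := by
    have : 0 < d := lt_of_lt_of_le (by norm_num) hd
    exact_mod_cast this
  have hm0 : (20 : ℝ) ≤ m := by exact_mod_cast hm
  have hd8 : (d / 16 : ℝ) ≤ ((d / 8 : ℕ) : ℝ) := by
    have h1 : d ≤ 16 * (d / 8) := by
      have : 8 ≤ d := le_trans (by norm_num) hd
      omega
    have h2 : (d : ℝ) ≤ 16 * ((d / 8 : ℕ) : ℝ) := by exact_mod_cast h1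
    linarith
  have hlog : 60 ≤ Real.log d := by
    rw [Real.le_log_iff_exp_le hd0]
    have h1 : Real.exp 60 = Real.exp 1 ^ 60 := by
      rw [← Real.exp_nat_mul]; norm_num
    rw [h1]
    refine (pow_le_pow_left₀ (Real.exp_pos 1).le Real.exp_one_lt_three.le 60).trans ?_
    have h2 : (10 : ℝ) ^ 39 ≤ d := by exact_mod_cast hd
    exact le_trans (by norm_num) h2
  have hreal : (d / 16 : ℝ) ^ (m - l) ≤ 160 * (m * d) * (5 ^ (m - l) * d ^ l) * N := by
    have h1 : (((d / 8 : ℕ) : ℝ)) ^ (m - l) ≤ n * (5 ^ (m - l) * d ^ l) * N := by exact_mod_cast h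
    have h2 : (n : ℝ) ≤ 160 * (m * d) := by exact_mod_cast hn
    refine (pow_le_pow_left₀ (by positivity) hd8 _).trans (h1.trans ?_)
    gcongr
  have hN : (0 : ℝ) < N := by
    have h1 : 0 < (d / 16 : ℝ) ^ (m - l) := by positivity
    rcases Nat.eq_zero_or_pos N with h0 | h0
    · rw [h0, Nat.cast_zero, mul_zero] at hreal
      linarith
    · exact_mod_cast h0
  have hml : ((m - l : ℕ) : ℝ) = m - l := Nat.cast_sub (by omega)
  have hlogs := Real.log_le_log (by positivity) hreal
  have hm1 : (m : ℝ) ≠ 0 := by positivity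
  rw [Real.log_pow, Real.log_div hd0.ne' (by norm_num), Real.log_mul (by positivity) hN.ne',
    Real.log_mul (by positivity) (by positivity), Real.log_mul (by norm_num) (by positivity),
    Real.log_mul hm1 hd0.ne', Real.log_mul (by positivity) (by positivity), Real.log_pow,
    Real.log_pow, hml] at hlogs
  have hlog16 : Real.log 16 + Real.log 5 ≤ 6 := by
    rw [← Real.log_mul (by norm_num) (by norm_num), Real.log_le_iff_le_exp (by norm_num)]
    have h1 : Real.exp 6 = Real.exp 1 ^ 6 := by
      rw [← Real.exp_nat_mul]; norm_num
    rw [h1]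
    refine le_trans ?_ (pow_le_pow_left₀ (by norm_num) (Real.exp_one_gt_d9).le 6)
    norm_num
  have hlog160 : Real.log 160 ≤ 6 := by
    rw [Real.log_le_iff_le_exp (by norm_num)]
    have h1 : Real.exp 6 = Real.exp 1 ^ 6 := by
      rw [← Real.exp_nat_mul]; norm_num
    rw [h1]
    refine le_trans ?_ (pow_le_pow_left₀ (by norm_num) (Real.exp_one_gt_d9).le 6)
    norm_num
  have hlogm : Real.log m ≤ m := by
    have := Real.log_le_sub_one_of_pos (show (0 : ℝ) < m by linarith)
    linarith
  have hl' : (8 : ℝ) * l ≤ m := by exact_mod_cast hl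
  have hl0 : (0 : ℝ) ≤ l := Nat.cast_nonneg _
  have hmain : (m : ℝ) * Real.log d / 2 ≤ Real.log N := by
    have h1 : ((m : ℝ) - l) * (Real.log 16 + Real.log 5) ≤ m * 6 :=
      mul_le_mul (by linarith) hlog16 (by positivity) (by linarith)
    have h2 : 8 * (l * Real.log d) ≤ m * Real.log d := by nlinarith
    have h3 : (m : ℝ) * 60 ≤ m * Real.log d := by nlinarith
    have h4 : 20 * Real.log d ≤ m * Real.log d := by nlinarith
    nlinarith
  rw [← Real.le_log_iff_exp_le hN]
  refine le_trans ?_ hmain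
  rw [div_le_iff₀ hd0]
  have h2 : (n : ℝ) ≤ 160 * (m * d) := by exact_mod_cast hn
  nlinarith [mul_le_mul_of_nonneg_right h2 (show 0 ≤ Real.log d by linarith)]

/-- There exist constants `δ₁, δ₂, δ₃ > 0` such that every `(n,d,λ)`-graph `G` with
`d ≤ δ₃ n` and `λ/d ≤ δ₁` has at least `exp(δ₂ n log d / d)` pairwise non-isomorphic
induced subgraphs. -/
theorem many_nonisomorphic_induced_subgraphs :
    ∃ δ₁ > (0 : ℝ), ∃ δ₂ > (0 : ℝ), ∃ δ₃ > (0 : ℝ),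
      ∀ (n d : ℕ), 0 < n → 0 < d →
        ∀ (lam : ℝ) (G : SimpleGraph (Fin n)),
          IsNDLGraph n d lam G → (d : ℝ) ≤ δ₃ * n → lam / d ≤ δ₁ →
            ∃ N : ℕ, Real.exp (δ₂ * n * Real.log d / d) ≤ (N : ℝ) ∧
              ∃ f : Fin N → Set (Fin n),
                ∀ i j : Fin N, i ≠ j →
                  IsEmpty (G.induce (f i) ≃g G.induce (f j)) := by
  refine ⟨1 / 10 ^ 20, by norm_num, 1 / 320, by norm_num, 1 / 1600, by norm_num, ?_⟩
  intro n d hn hd lam G h hdn hlam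
  have hd' : (0 : ℝ) < d := by exact_mod_cast hd
  rw [div_le_iff₀ hd'] at hlam
  have hdn' : 1600 * d ≤ n := by
    have : (1600 : ℝ) * d ≤ n := by linarith
    exact_mod_cast this
  have hs := h.isSpread hd hdn' hlam
  have : Nonempty (Fin n) := ⟨⟨0, hn⟩⟩
  obtain ⟨k, hk⟩ : ∃ k, n / (80 * d) = k + 1 :=
    Nat.exists_eq_succ_of_ne_zero (Nat.div_pos (by omega) (by omega)).ne'
  have hk20 : 20 ≤ k + 1 := by
    rw [← hk, Nat.le_div_iff_mul_le (by omega)]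
    omega
  have hkn : 80 * ((k + 1) * d) ≤ n := by
    have := Nat.div_mul_le_self n (80 * d)
    rw [hk] at this
    linarith
  have hnk : n ≤ 160 * ((k + 1) * d) := by
    have := Nat.lt_mul_div_succ n (show 0 < 80 * d by omega)
    rw [hk] at this
    nlinarith
  obtain ⟨v, p, ht⟩ := hs.exists_isSpreadTree k (by rw [Fintype.card_fin]; nlinarith)
  obtain ⟨l, hl, N, hN, hf⟩ := hs.exists_nonisomorphic ht (by rwa [Fintype.card_fin])
  rw [Fintype.card_fin] at hN
  exact ⟨N, exp_le_of_pow_div_le (h.pow_le_deg hd hdn' hlam) hk20 hl hnk hN, hf⟩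
end
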